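/- Let a ≥ 7 and b ≥ 7 be integers and let φ be a proper 5-coloring of the triangulated toroidal grid T[a×b]. If φ contains crossing pairs, then φ is nice, i.e., φ is Kempe 5-equivalent to a proper 5-coloring of T[a×b] that contains a good 4-template. -/

import Mathlib

namespace KempePaper

variable {V : Type*}

/-- A proper `k`-coloring: adjacent vertices receive distinct colors. -/
def Proper (G : SimpleGraph V) {k : ℕ} (c : V → Fin k) : Prop :=
  ∀ ⦃u v : V⦄, G.Adj u v → c u ≠ c v

/-- The subgraph of `G` induced by the vertices colored `α` or `β` under `c`
(as a graph on all of `V`, with edges only between such vertices). -/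
def kempeGraph (G : SimpleGraph V) {k : ℕ} (c : V → Fin k) (α β : Fin k) :
    SimpleGraph V :=
  SimpleGraph.fromRel (fun u v =>
    G.Adj u v ∧ (c u = α ∨ c u = β) ∧ (c v = α ∨ c v = β))

/-- `c₂` is obtained from `c₁` by a single Kempe swap: the colors `α` and `β`
are interchanged on the connected component (of the subgraph induced by the
vertices colored `α` or `β`) containing some vertex `w`, and nothing else changes. -/
def KempeStep (G : SimpleGraph V) {k : ℕ} (c₁ c₂ : V → Fin k) : Prop :=
  ∃ (α β : Fin k) (w : V),
    (∀ v : V, (kempeGraph G c₁ α β).Reachable w v → c₂ v = Equiv.swap α β (c₁ v)) ∧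
    (∀ v : V, ¬ (kempeGraph G c₁ α β).Reachable w v → c₂ v = c₁ v)

/-- Two `k`-colorings are Kempe `k`-equivalent if one can be obtained from the
other by a finite sequence of Kempe swaps. -/
def KempeEquiv (G : SimpleGraph V) {k : ℕ} (c₁ c₂ : V → Fin k) : Prop :=
  Relation.ReflTransGen (KempeStep G) c₁ c₂

/-- The triangulated toroidal grid `T[a×b]`. -/
def triGrid (a b : ℕ) : SimpleGraph (ZMod a × ZMod b) :=
  SimpleGraph.fromRel (fun u v =>
    u - v ∈ ({(0,1), (0,-1), (1,0), (-1,0), (1,-1), (-1,1)} : Set (ZMod a × ZMod b)))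

/-- `G` is `d`-degenerate: every nonempty finite set `S` of vertices contains a
vertex with at most `d` neighbors inside `S`. -/
def Degenerate (G : SimpleGraph V) (d : ℕ) : Prop :=
  ∀ S : Set V, S.Finite → S.Nonempty → ∃ v ∈ S, (S ∩ G.neighborSet v).ncard ≤ d

/-- `S` is an independent set in `G`. -/
def Indep (G : SimpleGraph V) (S : Set V) : Prop :=
  ∀ u ∈ S, ∀ v ∈ S, ¬ G.Adj u v

/-- The relation identifying all the vertices of `S`. -/
def identifyRel (S : Set V) (u v : V) : Prop :=
  u = v ∨ (u ∈ S ∧ v ∈ S)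

/-- The identification `G/S`: the vertices of `S` are merged into a single vertex,
and two distinct resulting vertices are adjacent iff some representatives are
adjacent in `G`. -/
def Identify (G : SimpleGraph V) (S : Set V) :
    SimpleGraph (Quot (identifyRel S)) :=
  SimpleGraph.fromRel (fun x y =>
    ∃ u v : V, Quot.mk (identifyRel S) u = x ∧ Quot.mk (identifyRel S) v = y ∧ G.Adj u v)

/-- A good 4-template: an independent set of exactly 4 vertices whose
identification yields a 4-degenerate graph. -/
def GoodFourTemplate (G : SimpleGraph V) (S : Set V) : Prop :=
  Indep G S ∧ S.ncard = 4 ∧ Degenerate (Identify G S) 4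

/-- A coloring is monochromatic on `S`. -/
def Mono {k : ℕ} (c : V → Fin k) (S : Set V) : Prop :=
  ∀ u ∈ S, ∀ v ∈ S, c u = c v

/-- `φ` is nice: it is Kempe 5-equivalent to a proper 5-coloring of `T[a×b]`
containing a good 4-template. -/
def Nice (a b : ℕ) (c : ZMod a × ZMod b → Fin 5) : Prop :=
  ∃ c' : ZMod a × ZMod b → Fin 5,
    Proper (triGrid a b) c' ∧ KempeEquiv (triGrid a b) c c' ∧
    ∃ S : Set (ZMod a × ZMod b), GoodFourTemplate (triGrid a b) S ∧ Mono c' S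

/-- The relation identifying the vertices within each color of the template `T`. -/
def contractRel (T : Set (Set V)) (u v : V) : Prop :=
  u = v ∨ ∃ C ∈ T, u ∈ C ∧ v ∈ C

/-- The contraction `G_T`: the vertices within each color of `T` are identified,
and two distinct resulting vertices are adjacent iff some representatives are
adjacent in `G`. -/
def Contract (G : SimpleGraph V) (T : Set (Set V)) :
    SimpleGraph (Quot (contractRel T)) :=
  SimpleGraph.fromRel (fun x y =>
    ∃ u v : V, Quot.mk (contractRel T) u = x ∧ Quot.mk (contractRel T) v = y ∧ G.Adj u v)

/-- `T` is a template in `G`: a finite collection of pairwise disjoint nonempty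
independent sets of vertices. -/
def IsTemplate (G : SimpleGraph V) (T : Set (Set V)) : Prop :=
  T.Finite ∧ (∀ C ∈ T, C.Nonempty) ∧ T.Pairwise (fun C D => Disjoint C D) ∧
    ∀ C ∈ T, Indep G C

/-- A coloring contains the template `T` if each color of `T` is monochromatic. -/
def ContainsTemplate {k : ℕ} (c : V → Fin k) (T : Set (Set V)) : Prop :=
  ∀ C ∈ T, Mono c C


/-! ### Kempe swaps on closed sets -/

/-- `C` is a union of components of the subgraph induced by the colors `α` and `β`. -/
def KempeClosed (G : SimpleGraph V) {k : ℕ} (c : V → Fin k) (α β : Fin k) (C : Set V) : Prop :=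
  ∀ u v, u ∈ C → (kempeGraph G c α β).Adj u v → v ∈ C

/-- Interchange the colors `α` and `β` on a union of Kempe components. -/
def SetStep (G : SimpleGraph V) {k : ℕ} (c₁ c₂ : V → Fin k) : Prop :=
  ∃ (α β : Fin k) (C : Set V), KempeClosed G c₁ α β C ∧
    (∀ v ∈ C, c₂ v = Equiv.swap α β (c₁ v)) ∧ ∀ v ∉ C, c₂ v = c₁ v

lemma kempeGraph_adj {G : SimpleGraph V} {k : ℕ} {c : V → Fin k} {α β : Fin k} {u v : V} :
    (kempeGraph G c α β).Adj u v ↔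
      G.Adj u v ∧ (c u = α ∨ c u = β) ∧ (c v = α ∨ c v = β) := by
  simp only [kempeGraph, SimpleGraph.fromRel_adj]
  constructor
  · rintro ⟨-, h | h⟩
    · exact h
    · exact ⟨h.1.symm, h.2.2, h.2.1⟩
  · intro h
    exact ⟨h.1.ne, Or.inl h⟩

lemma swap_eq_or_iff {k : ℕ} (α β x : Fin k) :
    (Equiv.swap α β x = α ∨ Equiv.swap α β x = β) ↔ (x = α ∨ x = β) := by
  rw [Equiv.swap_apply_def]
  split_ifs <;> simp_all

lemma kempeGraph_congr {G : SimpleGraph V} {k : ℕ} {c c' : V → Fin k} {α β : Fin k}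
    (h : ∀ v, (c' v = α ∨ c' v = β) ↔ (c v = α ∨ c v = β)) :
    kempeGraph G c' α β = kempeGraph G c α β := by
  ext u v
  rw [kempeGraph_adj, kempeGraph_adj, h, h]

lemma kempeEquiv_of_closed [Finite V] {G : SimpleGraph V} {k : ℕ} (α β : Fin k) :
    ∀ (n : ℕ) (C : Set V) (c₁ c₂ : V → Fin k), C.ncard = n → KempeClosed G c₁ α β C →
      (∀ v ∈ C, c₂ v = Equiv.swap α β (c₁ v)) → (∀ v ∉ C, c₂ v = c₁ v) →
      KempeEquiv G c₁ c₂ := by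
  classical
  intro n
  induction n using Nat.strong_induction_on with
  | _ n ih =>
  intro C c₁ c₂ hn hC h1 h2
  rcases C.eq_empty_or_nonempty with rfl | ⟨w, hw⟩
  · have : c₂ = c₁ := funext fun v => h2 v (Set.notMem_empty v)
    rw [this]
    exact Relation.ReflTransGen.refl
  set K : Set V := {v | (kempeGraph G c₁ α β).Reachable w v} with hK
  have hwK : w ∈ K := SimpleGraph.Reachable.refl w
  have hKC : K ⊆ C := by
    rintro v ⟨p⟩
    clear hn h1 h2
    induction p with
    | nil => exact hw
    | cons hadj p ih2 => exact ih2 (hC _ _ hw hadj) rfl (SimpleGraph.Reachable.refl _)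
  set d : V → Fin k := fun v => if v ∈ K then Equiv.swap α β (c₁ v) else c₁ v with hd
  have hstep : KempeStep G c₁ d :=
    ⟨α, β, w, fun v hv => if_pos hv, fun v hv => if_neg hv⟩
  have hg : kempeGraph G d α β = kempeGraph G c₁ α β := by
    refine kempeGraph_congr fun v => ?_
    simp only [hd]
    split_ifs
    · exact swap_eq_or_iff α β _
    · rfl
  refine Relation.ReflTransGen.head hstep
    (ih (C \ K).ncard ?_ (C \ K) d c₂ rfl ?_ ?_ ?_)
  · rw [← hn]
    exact Set.ncard_lt_ncard ⟨Set.sdiff_subset, fun h => (h hw).2 hwK⟩ (Set.toFinite C)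
  · intro u v hu huv
    rw [hg] at huv
    refine ⟨hC u v hu.1 huv, fun hv => hu.2 ?_⟩
    exact SimpleGraph.Reachable.trans hv huv.symm.reachable
  · intro v hv
    rw [h1 v hv.1]
    simp only [hd, if_neg hv.2]
  · intro v hv
    by_cases hvK : v ∈ K
    · rw [h1 v (hKC hvK)]
      simp only [hd, if_pos hvK]
    · rw [h2 v fun h => hv ⟨h, hvK⟩]
      simp only [hd, if_neg hvK]

lemma kempeEquiv_of_setSteps [Finite V] {G : SimpleGraph V} {k : ℕ} {c₁ c₂ : V → Fin k}
    (h : Relation.ReflTransGen (SetStep G) c₁ c₂) : KempeEquiv G c₁ c₂ := by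
  induction h with
  | refl => exact Relation.ReflTransGen.refl
  | tail _ hs ih =>
    obtain ⟨α, β, C, hC, h1, h2⟩ := hs
    exact ih.trans (kempeEquiv_of_closed α β _ C _ _ rfl hC h1 h2)

lemma SetStep.proper {G : SimpleGraph V} {k : ℕ} {c₁ c₂ : V → Fin k}
    (h : SetStep G c₁ c₂) (hc : Proper G c₁) : Proper G c₂ := by
  obtain ⟨α, β, C, hC, h1, h2⟩ := h
  have key : ∀ u v, G.Adj u v → u ∈ C → v ∉ C → c₂ u ≠ c₂ v := by
    intro u v huv hu hv heq
    rw [h1 u hu, h2 v hv] at heq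
    by_cases hcu : c₁ u = α ∨ c₁ u = β
    · refine hv (hC u v hu (kempeGraph_adj.2 ⟨huv, hcu, ?_⟩))
      rw [← heq]
      exact (swap_eq_or_iff α β _).2 hcu
    · push Not at hcu
      rw [Equiv.swap_apply_of_ne_of_ne hcu.1 hcu.2] at heq
      exact hc huv heq
  intro u v huv
  by_cases hu : u ∈ C <;> by_cases hv : v ∈ C
  · rw [h1 u hu, h1 v hv]
    exact fun h => hc huv ((Equiv.swap α β).injective h)
  · exact key u v huv hu hv
  · exact (key v u huv.symm hv hu).symm
  · rw [h2 u hu, h2 v hv]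
    exact hc huv

lemma setStep_update [DecidableEq V] {G : SimpleGraph V} {k : ℕ} {c : V → Fin k} {v : V}
    {δ : Fin k} (hc : ∀ u, G.Adj v u → c u ≠ c v) (hδ : ∀ u, G.Adj v u → c u ≠ δ) :
    SetStep G c (Function.update c v δ) := by
  refine ⟨c v, δ, {v}, ?_, ?_, ?_⟩
  · rintro u w rfl huw
    obtain ⟨h, -, h1 | h1⟩ := kempeGraph_adj.1 huw
    · exact absurd h1 (hc w h)
    · exact absurd h1 (hδ w h)
  · rintro u rfl
    simp
  · intro u hu
    exact Function.update_of_ne hu _ _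

/-! ### Colorings of degenerate graphs -/

/-- The graph on `V` whose edges are the edges of `G` inside `U`. -/
def within (G : SimpleGraph V) (U : Set V) : SimpleGraph V where
  Adj u v := G.Adj u v ∧ u ∈ U ∧ v ∈ U
  symm := ⟨fun _ _ h => ⟨h.1.symm, h.2.2, h.2.1⟩⟩
  loopless := ⟨fun _ h => h.1.ne rfl⟩

lemma exists_missing_color {X : Set V} {n : ℕ} (hX : X.Finite) (hn : X.ncard ≤ n)
    (c : V → Fin (n + 1)) : ∃ δ, ∀ u ∈ X, c u ≠ δ := by
  by_contra! h
  have h1 : (Set.univ : Set (Fin (n + 1))) ⊆ c '' X := fun δ _ => h δ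
  have h2 := Set.ncard_le_ncard h1 (hX.image c)
  have h3 := Set.ncard_image_le (f := c) hX
  rw [Set.ncard_univ, Nat.card_eq_fintype_card, Fintype.card_fin] at h2
  omega

lemma Degenerate.exists_coloring [Finite V] {G : SimpleGraph V} {d : ℕ} (hG : Degenerate G d) :
    ∃ c : V → Fin (d + 1), Proper G c := by
  classical
  suffices h : ∀ (n : ℕ) (U : Set V), U.ncard = n →
      ∃ c : V → Fin (d + 1), Proper (within G U) c by
    obtain ⟨c, hc⟩ := h _ Set.univ rfl
    exact ⟨c, fun u v huv => hc ⟨huv, trivial, trivial⟩⟩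
  intro n
  induction n with
  | zero =>
    intro U hU
    have : U = ∅ := (Set.ncard_eq_zero (Set.toFinite U)).1 hU
    subst this
    exact ⟨fun _ => 0, fun u v huv => huv.2.1.elim⟩
  | succ n ih =>
    intro U hU
    have hne : U.Nonempty := Set.nonempty_of_ncard_ne_zero (by omega)
    obtain ⟨v, hv, hdeg⟩ := hG U (Set.toFinite U) hne
    obtain ⟨c, hc⟩ := ih (U \ {v}) (by rw [Set.ncard_sdiff_singleton_of_mem hv]; omega)
    obtain ⟨δ, hδ⟩ := exists_missing_color (Set.toFinite _) hdeg c
    refine ⟨Function.update c v δ, ?_⟩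
    rintro x y ⟨hxy, hx, hy⟩
    by_cases hxv : x = v
    · subst hxv
      rw [Function.update_self, Function.update_of_ne hxy.ne']
      exact (hδ y ⟨hy, hxy⟩).symm
    · by_cases hyv : y = v
      · subst hyv
        rw [Function.update_self, Function.update_of_ne hxv]
        exact hδ x ⟨hx, hxy.symm⟩
      · rw [Function.update_of_ne hxv, Function.update_of_ne hyv]
        exact hc ⟨hxy, ⟨hx, hxv⟩, hy, hyv⟩

/-- A swap that avoids the color of the added vertex can be performed in the larger graph. -/
lemma lift_step_of_ne {G : SimpleGraph V} {U : Set V} {v : V} {k : ℕ} {c c' e : V → Fin k}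
    {α β : Fin k} {C : Set V}
    (hC : KempeClosed (within G (U \ {v})) c α β C)
    (h1 : ∀ u ∈ C, c' u = Equiv.swap α β (c u)) (h2 : ∀ u ∉ C, c' u = c u)
    (he : ∀ u, u ≠ v → e u = c u) (hα : e v ≠ α) (hβ : e v ≠ β) :
    ∃ e', SetStep (within G U) e e' ∧ ∀ u, u ≠ v → e' u = c' u := by
  classical
  refine ⟨fun u => if u ∈ C then Equiv.swap α β (e u) else e u, ⟨α, β, C, ?_, ?_, ?_⟩, ?_⟩
  · intro x y hx hxy
    obtain ⟨⟨h, hxU, hyU⟩, ex, ey⟩ := kempeGraph_adj.1 hxy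
    have hxv : x ≠ v := by rintro rfl; tauto
    have hyv : y ≠ v := by rintro rfl; tauto
    rw [he x hxv] at ex
    rw [he y hyv] at ey
    exact hC x y hx (kempeGraph_adj.2 ⟨⟨h, ⟨hxU, hxv⟩, hyU, hyv⟩, ex, ey⟩)
  · intro u hu
    simp [hu]
  · intro u hu
    simp [hu]
  · intro u hu
    by_cases huC : u ∈ C
    · simp [huC, h1, he u hu]
    · simp [huC, h2, he u hu]

lemma exists_recoloring {X : Set V} (hX : X.Finite) {n : ℕ} (hn : X.ncard ≤ n) {α : Fin (n + 1)}
    {c : V → Fin (n + 1)} {x y : V} (hx : x ∈ X) (hy : y ∈ X) (hxy : x ≠ y) (hc : c x = c y) :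
    ∃ δ, δ ≠ α ∧ ∀ u ∈ X, c u ≠ δ := by
  by_contra! h
  have h1 : (Set.univ : Set (Fin (n + 1))) ⊆ insert α (c '' (X \ {y})) := by
    intro δ _
    by_cases hδ : δ = α
    · exact Or.inl hδ
    · obtain ⟨u, hu, rfl⟩ := h δ hδ
      right
      by_cases huy : u = y
      · subst huy
        exact ⟨x, ⟨hx, hxy⟩, hc⟩
      · exact ⟨u, ⟨hu, huy⟩, rfl⟩
  have h2 := Set.ncard_le_ncard h1 (((hX.sdiff).image c).insert α)
  have h3 := Set.ncard_image_le (f := c) (hX.sdiff (t := {y}))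
  have h4 := Set.ncard_insert_le α (c '' (X \ {y}))
  rw [Set.ncard_sdiff_singleton_of_mem hy] at h3
  have h5 : 0 < X.ncard := (Set.ncard_pos hX).2 ⟨x, hx⟩
  rw [Set.ncard_univ, Nat.card_eq_fintype_card, Fintype.card_fin] at h2
  omega

lemma lift_step_of_eq [Finite V] {G : SimpleGraph V} {U : Set V} {v : V} {k : ℕ}
    {c c' e : V → Fin (k + 1)}
    {α β : Fin (k + 1)} {C : Set V} (hdeg : (U ∩ G.neighborSet v).ncard ≤ k)
    (hC : KempeClosed (within G (U \ {v})) c α β C)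
    (h1 : ∀ u ∈ C, c' u = Equiv.swap α β (c u)) (h2 : ∀ u ∉ C, c' u = c u)
    (he : ∀ u, u ≠ v → e u = c u) (hp : Proper (within G U) e) (hv : v ∈ U) (hα : e v = α) :
    ∃ e', Relation.ReflTransGen (SetStep (within G U)) e e' ∧ ∀ u, u ≠ v → e' u = c' u := by
  classical
  by_cases hαβ : α = β
  · refine ⟨e, Relation.ReflTransGen.refl, fun u hu => ?_⟩
    by_cases huC : u ∈ C
    · rw [h1 u huC, he u hu, hαβ, Equiv.swap_self, Equiv.refl_apply]
    · rw [h2 u huC, he u hu]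
  have hCe : ∀ x y, x ≠ v → y ≠ v → x ∈ C → (kempeGraph (within G U) e α β).Adj x y → y ∈ C := by
    intro x y hxv hyv hx hxy
    obtain ⟨⟨h, hxU, hyU⟩, ex, ey⟩ := kempeGraph_adj.1 hxy
    rw [he x hxv] at ex
    rw [he y hyv] at ey
    exact hC x y hx (kempeGraph_adj.2 ⟨⟨h, ⟨hxU, hxv⟩, hyU, hyv⟩, ex, ey⟩)
  have finish : ∀ D : Set V, (∀ u, u ≠ v → (u ∈ D ↔ u ∈ C)) →
      KempeClosed (within G U) e α β D → ∃ e', Relation.ReflTransGen (SetStep (within G U)) e e' ∧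
        ∀ u, u ≠ v → e' u = c' u := by
    intro D hD hcl
    refine ⟨fun u => if u ∈ D then Equiv.swap α β (e u) else e u,
      Relation.ReflTransGen.single ⟨α, β, D, hcl, fun u hu => by simp [hu],
        fun u hu => by simp [hu]⟩, fun u hu => ?_⟩
    by_cases huC : u ∈ C
    · simp [(hD u hu).2 huC, h1 u huC, he u hu]
    · have huD : u ∉ D := mt (hD u hu).1 huC
      simp [huD, h2 u huC, he u hu]
  by_cases hout : ∀ u, (within G U).Adj v u → e u = β → u ∉ C
  · refine finish (C \ {v}) (fun u hu => by simp [hu]) ?_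
    rintro x y ⟨hx, hxv⟩ hxy
    have hyv : y ≠ v := by
      rintro rfl
      obtain ⟨h, ex, -⟩ := kempeGraph_adj.1 hxy
      refine hout x h.symm (ex.resolve_left fun h' => hp h ?_) hx
      rw [h', hα]
    exact ⟨hCe x y hxv hyv hx hxy, hyv⟩
  by_cases hin : ∀ u, (within G U).Adj v u → e u = β → u ∈ C
  · refine finish (insert v C) (fun u hu => by simp [hu]) ?_
    intro x y hx hxy
    by_cases hyv : y = v
    · exact Or.inl hyv
    by_cases hxv : x = v
    · subst hxv
      obtain ⟨h, -, ey⟩ := kempeGraph_adj.1 hxy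
      exact Or.inr (hin y h (ey.resolve_left fun h' => hp h (by rw [h', hα])))
    · exact Or.inr (hCe x y hxv hyv (hx.resolve_left hxv) hxy)
  push Not at hout hin
  obtain ⟨x, hx, ex, hxC⟩ := hout
  obtain ⟨y, hy, ey, hyC⟩ := hin
  obtain ⟨δ, hδα, hδ⟩ := exists_recoloring (Set.toFinite _) hdeg (α := α) (c := e)
    (x := x) (y := y) ⟨hx.2.2, hx.1⟩ ⟨hy.2.2, hy.1⟩ (by rintro rfl; exact hyC hxC) (ex.trans ey.symm)
  have hδβ : δ ≠ β := fun h => hδ x ⟨hx.2.2, hx.1⟩ (ex.trans h.symm)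
  have hs : SetStep (within G U) e (Function.update e v δ) :=
    setStep_update (fun u hu => (hp hu).symm) fun u hu => hδ u ⟨hu.2.2, hu.1⟩
  obtain ⟨e', hs', he'⟩ := lift_step_of_ne (e := Function.update e v δ) hC h1 h2
    (fun u hu => by rw [Function.update_of_ne hu, he u hu])
    (by simpa using hδα) (by simpa using hδβ)
  exact ⟨e', (Relation.ReflTransGen.single hs).tail hs', he'⟩

lemma proper_of_setSteps {G : SimpleGraph V} {k : ℕ} {c₁ c₂ : V → Fin k}
    (h : Relation.ReflTransGen (SetStep G) c₁ c₂) (hc : Proper G c₁) : Proper G c₂ := by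
  induction h with
  | refl => exact hc
  | tail _ hs ih => exact hs.proper ih

lemma lift_setSteps [Finite V] {G : SimpleGraph V} {U : Set V} {v : V} {k : ℕ}
    {c₁ c₂ : V → Fin (k + 1)} (hv : v ∈ U) (hdeg : (U ∩ G.neighborSet v).ncard ≤ k)
    (hp : Proper (within G U) c₁)
    (h : Relation.ReflTransGen (SetStep (within G (U \ {v}))) c₁ c₂) :
    ∃ e, Relation.ReflTransGen (SetStep (within G U)) c₁ e ∧ ∀ u, u ≠ v → e u = c₂ u := by
  induction h with
  | refl => exact ⟨c₁, Relation.ReflTransGen.refl, fun _ _ => rfl⟩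
  | @tail d d' _ hs ih =>
    obtain ⟨e, hce, he⟩ := ih
    obtain ⟨α, β, C, hC, h1, h2⟩ := hs
    have hpe := proper_of_setSteps hce hp
    by_cases hα : e v = α
    · obtain ⟨e', hee', he'⟩ := lift_step_of_eq hdeg hC h1 h2 he hpe hv hα
      exact ⟨e', hce.trans hee', he'⟩
    by_cases hβ : e v = β
    · have hC' : KempeClosed (within G (U \ {v})) d β α C := by
        intro x y hx hxy
        refine hC x y hx (kempeGraph_adj.2 ?_)
        obtain ⟨h, h3, h4⟩ := kempeGraph_adj.1 hxy
        exact ⟨h, h3.symm, h4.symm⟩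
      obtain ⟨e', hee', he'⟩ := lift_step_of_eq hdeg hC'
        (fun u hu => by rw [Equiv.swap_comm]; exact h1 u hu) h2 he hpe hv hβ
      exact ⟨e', hce.trans hee', he'⟩
    · obtain ⟨e', hee', he'⟩ := lift_step_of_ne hC h1 h2 he hα hβ
      exact ⟨e', hce.tail hee', he'⟩

lemma setSteps_of_forall_not_adj [Finite V] {G : SimpleGraph V} (hG : ∀ u v, ¬ G.Adj u v) {k : ℕ}
    (c₁ c₂ : V → Fin k) : Relation.ReflTransGen (SetStep G) c₁ c₂ := by
  classical
  suffices h : ∀ (n : ℕ) (c : V → Fin k), {v | c v ≠ c₂ v}.ncard = n →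
      Relation.ReflTransGen (SetStep G) c c₂ from h _ c₁ rfl
  intro n
  induction n with
  | zero =>
    intro c hc
    have h0 := (Set.ncard_eq_zero (Set.toFinite _)).1 hc
    have : c = c₂ := funext fun v => by
      by_contra hv
      exact (h0 ▸ hv : v ∈ (∅ : Set V))
    rw [this]
  | succ n ih =>
    intro c hc
    obtain ⟨v, hv⟩ := Set.nonempty_of_ncard_ne_zero (s := {v | c v ≠ c₂ v}) (by omega)
    refine Relation.ReflTransGen.head (setStep_update (v := v) (δ := c₂ v)
      (fun u hu => (hG _ _ hu).elim) (fun u hu => (hG _ _ hu).elim)) (ih _ ?_)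
    have : {u | Function.update c v (c₂ v) u ≠ c₂ u} = {u | c u ≠ c₂ u} \ {v} := by
      ext u
      by_cases huv : u = v
      · subst huv
        simp
      · simp [huv]
    rw [this, Set.ncard_sdiff_singleton_of_mem hv]
    omega

/-- All `(d + 1)`-colorings of a finite `d`-degenerate graph are related by swaps
(Las Vergnas and Meyniel). -/
lemma Degenerate.setSteps [Finite V] {G : SimpleGraph V} {d : ℕ} (hG : Degenerate G d)
    {c₁ c₂ : V → Fin (d + 1)} (h₁ : Proper G c₁) (h₂ : Proper G c₂) :
    Relation.ReflTransGen (SetStep G) c₁ c₂ := by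
  classical
  suffices h : ∀ (n : ℕ) (U : Set V), U.ncard = n →
      Relation.ReflTransGen (SetStep (within G U)) c₁ c₂ by
    have hU : within G Set.univ = G := by
      ext u v
      simp [within]
    rw [← hU]
    exact h _ Set.univ rfl
  intro n
  induction n with
  | zero =>
    intro U hU
    have : U = ∅ := (Set.ncard_eq_zero (Set.toFinite U)).1 hU
    subst this
    exact setSteps_of_forall_not_adj (fun u v (huv : G.Adj u v ∧ u ∈ (∅ : Set V) ∧ v ∈ (∅ : Set V)) =>
      huv.2.1.elim) c₁ c₂
  | succ n ih =>
    intro U hU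
    have hne : U.Nonempty := Set.nonempty_of_ncard_ne_zero (by omega)
    obtain ⟨v, hv, hdeg⟩ := hG U (Set.toFinite U) hne
    have hp₁ : Proper (within G U) c₁ := fun x y hxy => h₁ hxy.1
    obtain ⟨e, hce, he⟩ := lift_setSteps hv hdeg hp₁
      (ih (U \ {v}) (by rw [Set.ncard_sdiff_singleton_of_mem hv]; omega))
    have hpe := proper_of_setSteps hce hp₁
    have hlast : Function.update e v (c₂ v) = c₂ := by
      ext1 u
      by_cases huv : u = v
      · subst huv
        simp
      · simp [huv, he]
    have hs : SetStep (within G U) e (Function.update e v (c₂ v)) :=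
      setStep_update (fun u hu => (hpe hu).symm) fun u hu => by
        rw [he u hu.1.ne']
        exact h₂ hu.1.symm
    rw [hlast] at hs
    exact hce.tail hs

/-! ### Quotients of graphs -/

/-- The quotient of `G` by the relation `r`. -/
def quotGraph (G : SimpleGraph V) (r : V → V → Prop) : SimpleGraph (Quot r) :=
  SimpleGraph.fromRel (fun x y => ∃ u v : V, Quot.mk r u = x ∧ Quot.mk r v = y ∧ G.Adj u v)

lemma quotGraph_adj {G : SimpleGraph V} {r : V → V → Prop} {x y : Quot r} :
    (quotGraph G r).Adj x y ↔
      x ≠ y ∧ ∃ u v : V, Quot.mk r u = x ∧ Quot.mk r v = y ∧ G.Adj u v := by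
  simp only [quotGraph, SimpleGraph.fromRel_adj]
  refine and_congr_right fun _ => ⟨?_, Or.inl⟩
  rintro (h | ⟨u, v, hu, hv, h⟩)
  · exact h
  · exact ⟨v, u, hv, hu, h.symm⟩

lemma proper_lift {G : SimpleGraph V} {r : V → V → Prop} {k : ℕ} {c : V → Fin k}
    (hc : Proper G c) (hr : ∀ u v, r u v → c u = c v) :
    Proper (quotGraph G r) (Quot.lift c hr) := by
  intro x y hxy
  obtain ⟨-, u, v, rfl, rfl, h⟩ := quotGraph_adj.1 hxy
  exact hc h

lemma setSteps_comp_mk {G : SimpleGraph V} {r : V → V → Prop} {k : ℕ}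
    {c₁ c₂ : Quot r → Fin k} (h : Relation.ReflTransGen (SetStep (quotGraph G r)) c₁ c₂)
    (hG : ∀ u v, G.Adj u v → Quot.mk r u ≠ Quot.mk r v) :
    Relation.ReflTransGen (SetStep G) (c₁ ∘ Quot.mk r) (c₂ ∘ Quot.mk r) := by
  induction h with
  | refl => exact Relation.ReflTransGen.refl
  | tail _ hs ih =>
    refine ih.tail ?_
    obtain ⟨α, β, C, hC, h1, h2⟩ := hs
    refine ⟨α, β, Quot.mk r ⁻¹' C, ?_, fun v hv => h1 _ hv, fun v hv => h2 _ hv⟩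
    intro u v hu huv
    obtain ⟨h, hu', hv'⟩ := kempeGraph_adj.1 huv
    exact hC _ _ hu (kempeGraph_adj.2
      ⟨quotGraph_adj.2 ⟨hG u v h, u, v, rfl, rfl, h⟩, hu', hv'⟩)

lemma kempeEquiv_of_degenerate_quot [Finite V] {G : SimpleGraph V} {r : V → V → Prop} {d : ℕ}
    (hd : Degenerate (quotGraph G r) d) {c₁ c₂ : V → Fin (d + 1)}
    (h₁ : Proper G c₁) (h₂ : Proper G c₂) (hr₁ : ∀ u v, r u v → c₁ u = c₁ v)
    (hr₂ : ∀ u v, r u v → c₂ u = c₂ v) : KempeEquiv G c₁ c₂ := by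
  have : Finite (Quot r) := Quot.finite r
  refine kempeEquiv_of_setSteps (setSteps_comp_mk
    (hd.setSteps (proper_lift h₁ hr₁) (proper_lift h₂ hr₂)) ?_)
  intro u v huv h
  exact h₁ huv (congrArg (Quot.lift c₁ hr₁) h)

lemma exists_coloring_of_degenerate_quot [Finite V] {G : SimpleGraph V} {r : V → V → Prop} {d : ℕ}
    (hd : Degenerate (quotGraph G r) d) (hG : ∀ u v, G.Adj u v → Quot.mk r u ≠ Quot.mk r v) :
    ∃ c : V → Fin (d + 1), Proper G c ∧ ∀ u v, r u v → c u = c v := by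
  have : Finite (Quot r) := Quot.finite r
  obtain ⟨c, hc⟩ := hd.exists_coloring
  refine ⟨c ∘ Quot.mk r, fun u v huv => hc (quotGraph_adj.2 ⟨hG u v huv, u, v, rfl, rfl, huv⟩),
    fun u v huv => congrArg c (Quot.sound huv)⟩

/-- If repeatedly removing classes with at most `d` remaining neighboring classes exhausts the
graph, then the quotient is `d`-degenerate. -/
lemma degenerate_quot_of_peeling [Finite V] {G : SimpleGraph V} {r : V → V → Prop} {d : ℕ}
    (h : ∀ Z : Set V, (∀ u v, r u v → (u ∈ Z ↔ v ∈ Z)) →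
      (∀ (v : V) (N : Finset V), N.card ≤ d → (∀ u q, Quot.mk r u = Quot.mk r v → G.Adj u q →
        q ∉ Z → ∃ n ∈ N, Quot.mk r q = Quot.mk r n) → v ∈ Z) → Z = Set.univ) :
    Degenerate (quotGraph G r) d := by
  intro X _ hX
  by_contra! hcon
  obtain ⟨x, hx⟩ := hX
  obtain ⟨v, rfl⟩ := Quot.exists_rep x
  have huniv := h {v | Quot.mk r v ∉ X}
    (fun u v huv => by simp only [Set.mem_ofPred_eq, Quot.sound huv]) ?_
  · exact (huniv ▸ Set.mem_univ v : v ∈ {v | Quot.mk r v ∉ X}) hx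
  · intro v N hN hv hvX
    have hsub : X ∩ (quotGraph G r).neighborSet (Quot.mk r v) ⊆ Quot.mk r '' (N : Set V) := by
      rintro y ⟨hy, hadj⟩
      obtain ⟨-, u, q, hu, rfl, huq⟩ := quotGraph_adj.1 hadj
      obtain ⟨n, hn, hqn⟩ := hv u q hu huq (fun h => h hy)
      exact ⟨n, hn, hqn.symm⟩
    have h1 := Set.ncard_le_ncard hsub ((Finset.finite_toSet N).image _)
    have h2 := Set.ncard_image_le (f := Quot.mk r) (Finset.finite_toSet N)
    rw [Set.ncard_coe_finset] at h2
    have := hcon _ hvX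
    omega

/-! ### Cells of the torus and bit masks

Cells of a `16`-column array are numbered row by row, and sets of cells are stored as the binary
digits of natural numbers. -/

section Torus

variable {a b : ℕ}

/-- The vertex of the torus at the cell `i`, where `o` is the vertex at the cell `0`. -/
def pt (o : ZMod a × ZMod b) (i : ℕ) : ZMod a × ZMod b :=
  o + (((i % 16 : ℕ) : ZMod a), ((i / 16 : ℕ) : ZMod b))

/-- The six differences of adjacent vertices. -/
def hexDirs (a b : ℕ) : Finset (ZMod a × ZMod b) :=
  {(0, 1), (0, -1), (1, 0), (-1, 0), (1, -1), (-1, 1)}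

lemma neg_mem_hexDirs {d : ZMod a × ZMod b} (hd : d ∈ hexDirs a b) : -d ∈ hexDirs a b := by
  simp only [hexDirs, Finset.mem_insert, Finset.mem_singleton] at hd ⊢
  rcases hd with rfl | rfl | rfl | rfl | rfl | rfl <;> simp

lemma sub_mem_of_adj {u v : ZMod a × ZMod b} (h : (triGrid a b).Adj u v) :
    v - u ∈ hexDirs a b := by
  have key : ∀ d : ZMod a × ZMod b,
      d ∈ ({(0,1), (0,-1), (1,0), (-1,0), (1,-1), (-1,1)} : Set (ZMod a × ZMod b)) →
      d ∈ hexDirs a b := by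
    intro d hd
    simpa [hexDirs] using hd
  rw [triGrid, SimpleGraph.fromRel_adj] at h
  rcases h.2 with h | h
  · rw [← neg_sub]
    exact neg_mem_hexDirs (key _ h)
  · exact key _ h

lemma adj_of_sub_mem (ha : 7 ≤ a) (hb : 7 ≤ b) {u v : ZMod a × ZMod b}
    (h : v - u ∈ hexDirs a b) : (triGrid a b).Adj u v := by
  have : Fact (1 < a) := ⟨by omega⟩
  have : Fact (1 < b) := ⟨by omega⟩
  rw [triGrid, SimpleGraph.fromRel_adj]
  refine ⟨?_, Or.inr (by simpa [hexDirs] using h)⟩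
  rintro rfl
  rw [sub_self] at h
  simp [hexDirs, Prod.ext_iff] at h

/-- The cells adjacent to some cell of `m`. -/
def around (m : ℕ) : ℕ :=
  m <<< 1 ||| m >>> 1 ||| m <<< 16 ||| m >>> 16 ||| m <<< 15 ||| m >>> 15

/-- Cells whose six neighbors are again cells of the array. -/
def Interior (i : ℕ) : Prop := 1 ≤ i % 16 ∧ i % 16 ≤ 14 ∧ 16 ≤ i

lemma pt_add_dir {o : ZMod a × ZMod b} {i : ℕ} (hi : Interior i) {d : ZMod a × ZMod b}
    (hd : d ∈ hexDirs a b) : ∃ j, pt o i + d = pt o j ∧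
      (j = i + 1 ∨ i = j + 1 ∨ j = i + 16 ∨ i = j + 16 ∨ j = i + 15 ∨ i = j + 15) := by
  obtain ⟨h1, h2, h3⟩ := hi
  obtain ⟨x, hx⟩ : ∃ x, i % 16 = x + 1 := ⟨i % 16 - 1, by omega⟩
  obtain ⟨y, hy⟩ : ∃ y, i / 16 = y + 1 := ⟨i / 16 - 1, by omega⟩
  simp only [hexDirs, Finset.mem_insert, Finset.mem_singleton] at hd
  rcases hd with rfl | rfl | rfl | rfl | rfl | rfl
  · refine ⟨i + 16, ?_, by omega⟩
    rw [pt, pt, hx, hy, show (i + 16) % 16 = x + 1 by omega, show (i + 16) / 16 = y + 2 by omega]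
    ext <;> push_cast <;> simp only [Prod.fst_add, Prod.snd_add] <;> ring
  · refine ⟨i - 16, ?_, by omega⟩
    rw [pt, pt, hx, hy, show (i - 16) % 16 = x + 1 by omega, show (i - 16) / 16 = y by omega]
    ext <;> push_cast <;> simp only [Prod.fst_add, Prod.snd_add] <;> ring
  · refine ⟨i + 1, ?_, by omega⟩
    rw [pt, pt, hx, hy, show (i + 1) % 16 = x + 2 by omega, show (i + 1) / 16 = y + 1 by omega]
    ext <;> push_cast <;> simp only [Prod.fst_add, Prod.snd_add] <;> ring
  · refine ⟨i - 1, ?_, by omega⟩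
    rw [pt, pt, hx, hy, show (i - 1) % 16 = x by omega, show (i - 1) / 16 = y + 1 by omega]
    ext <;> push_cast <;> simp only [Prod.fst_add, Prod.snd_add] <;> ring
  · refine ⟨i - 15, ?_, by omega⟩
    rw [pt, pt, hx, hy, show (i - 15) % 16 = x + 2 by omega, show (i - 15) / 16 = y by omega]
    ext <;> push_cast <;> simp only [Prod.fst_add, Prod.snd_add] <;> ring
  · refine ⟨i + 15, ?_, by omega⟩
    rw [pt, pt, hx, hy, show (i + 15) % 16 = x by omega, show (i + 15) / 16 = y + 2 by omega]
    ext <;> push_cast <;> simp only [Prod.fst_add, Prod.snd_add] <;> ring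

lemma testBit_around {m i j : ℕ} (hi : m.testBit i)
    (hij : j = i + 1 ∨ i = j + 1 ∨ j = i + 16 ∨ i = j + 16 ∨ j = i + 15 ∨ i = j + 15) :
    (around m).testBit j := by
  simp only [around, Nat.testBit_or, Nat.testBit_shiftLeft, Nat.testBit_shiftRight,
    Bool.or_eq_true, Bool.and_eq_true, decide_eq_true_eq]
  rcases hij with rfl | rfl | rfl | rfl | rfl | rfl <;> simp_all [Nat.add_comm]

lemma exists_of_testBit_around {m j : ℕ} (h : (around m).testBit j) : ∃ i, m.testBit i ∧
    (j = i + 1 ∨ i = j + 1 ∨ j = i + 16 ∨ i = j + 16 ∨ j = i + 15 ∨ i = j + 15) := by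
  simp only [around, Nat.testBit_or, Nat.testBit_shiftLeft, Nat.testBit_shiftRight,
    Bool.or_eq_true, Bool.and_eq_true, decide_eq_true_eq] at h
  rcases h with ((((h | h) | h) | h) | h) | h
  · exact ⟨_, h.2, by omega⟩
  · exact ⟨_, h, by omega⟩
  · exact ⟨_, h.2, by omega⟩
  · exact ⟨_, h, by omega⟩
  · exact ⟨_, h.2, by omega⟩
  · exact ⟨_, h, by omega⟩

lemma adj_pt (ha : 7 ≤ a) (hb : 7 ≤ b) {o : ZMod a × ZMod b} {i j : ℕ} (hi : Interior i)
    (hij : j = i + 1 ∨ i = j + 1 ∨ j = i + 16 ∨ i = j + 16 ∨ j = i + 15 ∨ i = j + 15) :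
    (triGrid a b).Adj (pt o i) (pt o j) := by
  obtain ⟨h1, h2, h3⟩ := hi
  apply adj_of_sub_mem ha hb
  obtain ⟨x, hx⟩ : ∃ x, i % 16 = x + 1 := ⟨i % 16 - 1, by omega⟩
  obtain ⟨y, hy⟩ : ∃ y, i / 16 = y + 1 := ⟨i / 16 - 1, by omega⟩
  simp only [hexDirs, Finset.mem_insert, Finset.mem_singleton]
  rcases hij with h | h | h | h | h | h
  · rw [pt, pt, hx, hy, show j % 16 = x + 2 by omega, show j / 16 = y + 1 by omega]
    refine Or.inr (Or.inr (Or.inl ?_))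
    ext <;> push_cast <;> simp only [Prod.fst_add, Prod.snd_add, Prod.fst_sub, Prod.snd_sub] <;> ring
  · rw [pt, pt, hx, hy, show j % 16 = x by omega, show j / 16 = y + 1 by omega]
    refine Or.inr (Or.inr (Or.inr (Or.inl ?_)))
    ext <;> push_cast <;> simp only [Prod.fst_add, Prod.snd_add, Prod.fst_sub, Prod.snd_sub] <;> ring
  · rw [pt, pt, hx, hy, show j % 16 = x + 1 by omega, show j / 16 = y + 2 by omega]
    refine Or.inl ?_
    ext <;> push_cast <;> simp only [Prod.fst_add, Prod.snd_add, Prod.fst_sub, Prod.snd_sub] <;> ring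
  · rw [pt, pt, hx, hy, show j % 16 = x + 1 by omega, show j / 16 = y by omega]
    refine Or.inr (Or.inl ?_)
    ext <;> push_cast <;> simp only [Prod.fst_add, Prod.snd_add, Prod.fst_sub, Prod.snd_sub] <;> ring
  · rw [pt, pt, hx, hy, show j % 16 = x by omega, show j / 16 = y + 2 by omega]
    refine Or.inr (Or.inr (Or.inr (Or.inr (Or.inr ?_))))
    ext <;> push_cast <;> simp only [Prod.fst_add, Prod.snd_add, Prod.fst_sub, Prod.snd_sub] <;> ring
  · rw [pt, pt, hx, hy, show j % 16 = x + 2 by omega, show j / 16 = y by omega]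
    refine Or.inr (Or.inr (Or.inr (Or.inr (Or.inl ?_))))
    ext <;> push_cast <;> simp only [Prod.fst_add, Prod.snd_add, Prod.fst_sub, Prod.snd_sub] <;> ring

/-- The `7 × 7` box with corner cell `k`. -/
def box (k : ℕ) : ℕ := 10062130175233434177513893855359 <<< k

/-- The corner cells whose boxes consist of interior cells. -/
def Corner (k : ℕ) : Prop := 1 ≤ k % 16 ∧ k % 16 ≤ 8 ∧ 16 ≤ k

lemma testBit_box {k i : ℕ} (hk : Corner k) (h : (box k).testBit i) :
    k % 16 ≤ i % 16 ∧ i % 16 < k % 16 + 7 ∧ k / 16 ≤ i / 16 ∧ i / 16 < k / 16 + 7 := by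
  have key : ∀ j < 112, Nat.testBit 10062130175233434177513893855359 j → j % 16 < 7 := by decide
  rw [box, Nat.testBit_shiftLeft, Bool.and_eq_true, decide_eq_true_eq] at h
  have hlt : i - k < 112 := by
    by_contra hge
    have : Nat.testBit 10062130175233434177513893855359 (i - k) = false :=
      Nat.testBit_lt_two_pow (lt_of_lt_of_le (by norm_num)
        (Nat.pow_le_pow_right (by norm_num) (not_lt.1 hge)))
    rw [this] at h
    exact absurd h.2 (by decide)
  have h7 := key _ hlt h.2
  obtain ⟨h1, h2, h3⟩ := hk
  have := h.1
  omega

lemma interior_of_testBit_box {k i : ℕ} (hk : Corner k) (h : (box k).testBit i) : Interior i := by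
  have := testBit_box hk h
  obtain ⟨h1, h2, h3⟩ := hk
  refine ⟨?_, ?_, ?_⟩ <;> omega

lemma eq_of_natCast_eq {n x y c : ℕ} (hn : 7 ≤ n) (hx : c ≤ x) (hx' : x < c + 7) (hy : c ≤ y)
    (hy' : y < c + 7) (h : (x : ZMod n) = y) : x = y := by
  rw [ZMod.natCast_eq_natCast_iff] at h
  rcases le_total x y with hxy | hxy
  · have := (Nat.modEq_iff_dvd' hxy).1 h
    have := Nat.eq_zero_of_dvd_of_lt this (by omega)
    omega
  · have := (Nat.modEq_iff_dvd' hxy).1 h.symm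
    have := Nat.eq_zero_of_dvd_of_lt this (by omega)
    omega

lemma pt_injOn (ha : 7 ≤ a) (hb : 7 ≤ b) {o : ZMod a × ZMod b} {k i j : ℕ} (hk : Corner k)
    (hi : (box k).testBit i) (hj : (box k).testBit j) (h : pt o i = pt o j) : i = j := by
  have h1 := testBit_box hk hi
  have h2 := testBit_box hk hj
  rw [pt, pt, add_right_inj, Prod.mk.injEq] at h
  have hx := eq_of_natCast_eq ha h1.1 h1.2.1 h2.1 h2.2.1 h.1
  have hy := eq_of_natCast_eq hb h1.2.2.1 h1.2.2.2 h2.2.2.1 h2.2.2.2 h.2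
  omega

/-! ### Removing classes of cells -/

/-- The relation identifying the vertices within each of the cell sets of `T`. -/
def cellRel (o : ZMod a × ZMod b) (T : List ℕ) (u v : ZMod a × ZMod b) : Prop :=
  u = v ∨ ∃ m ∈ T, ∃ i j, m.testBit i ∧ m.testBit j ∧ pt o i = u ∧ pt o j = v

/-- The cell sets of `T` are disjoint and contained in the box with corner `k`. -/
def DisjointIn (k : ℕ) (T : List ℕ) : Prop :=
  Corner k ∧ (∀ m ∈ T, m &&& box k = m) ∧ T.Pairwise fun m n => m &&& n = 0

lemma testBit_of_land_eq {m n i : ℕ} (h : m &&& n = m) (hi : m.testBit i) : n.testBit i := by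
  rw [← h, Nat.testBit_and, Bool.and_eq_true] at hi
  exact hi.2

lemma not_testBit_of_land_eq_zero {m n i : ℕ} (h : m &&& n = 0) (hi : m.testBit i) :
    ¬ n.testBit i := by
  intro hn
  have : (m &&& n).testBit i := by rw [Nat.testBit_and, hi, hn]; rfl
  rw [h, Nat.zero_testBit] at this
  exact absurd this (by decide)

lemma DisjointIn.eq_of_testBit {k : ℕ} {T : List ℕ} (hT : DisjointIn k T) {m n i : ℕ}
    (hm : m ∈ T) (hn : n ∈ T) (him : m.testBit i) (hin : n.testBit i) : m = n := by
  by_contra hne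
  have hsymm : Std.Symm fun m n : ℕ => m &&& n = 0 := ⟨fun x y h => by rw [Nat.land_comm]; exact h⟩
  exact not_testBit_of_land_eq_zero (hT.2.2.forall hm hn hne) him hin

lemma cellRel_symm {o : ZMod a × ZMod b} {T : List ℕ} {u v : ZMod a × ZMod b}
    (h : cellRel o T u v) : cellRel o T v u := by
  rcases h with rfl | ⟨m, hm, i, j, hi, hj, rfl, rfl⟩
  · exact Or.inl rfl
  · exact Or.inr ⟨m, hm, j, i, hj, hi, rfl, rfl⟩

lemma DisjointIn.equivalence (ha : 7 ≤ a) (hb : 7 ≤ b) {k : ℕ} {T : List ℕ}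
    (hT : DisjointIn k T) (o : ZMod a × ZMod b) : Equivalence (cellRel o T) := by
  refine ⟨fun u => Or.inl rfl, cellRel_symm, ?_⟩
  rintro u v w h (rfl | ⟨n, hn, i', j', hi', hj', rfl, rfl⟩)
  · exact h
  rcases h with rfl | ⟨m, hm, i, j, hi, hj, rfl, hij⟩
  · exact Or.inr ⟨n, hn, i', j', hi', hj', rfl, rfl⟩
  · have hji := pt_injOn ha hb hT.1 (testBit_of_land_eq (hT.2.1 m hm) hj)
      (testBit_of_land_eq (hT.2.1 n hn) hi') hij
    subst hji
    obtain rfl := hT.eq_of_testBit hm hn hj hi'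
    exact Or.inr ⟨m, hm, i, j', hi, hj', rfl, rfl⟩

/-- The set of cells of `T` containing `i`, or `{i}` if there is none. -/
def classOf : List ℕ → ℕ → ℕ
  | [], i => 1 <<< i
  | m :: T, i => bif m.testBit i then m else classOf T i

/-- At most `n` binary digits of `m` are nonzero. -/
def fewBits : ℕ → ℕ → Bool
  | 0, m => Nat.beq m 0
  | n + 1, m => Nat.beq m 0 || fewBits n (m &&& (m - 1))

/-- The cells of `m` meet at most `n` classes of `T`, where other cells form singleton classes. -/
def fewClasses : List ℕ → ℕ → ℕ → Bool
  | [], n, m => fewBits n m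
  | t :: T, n, m => bif Nat.beq (m &&& t) 0 then fewClasses T n m else
      bif Nat.beq n 0 then false else fewClasses T (n - 1) (m ^^^ (m &&& t))

/-- The classes of the cells in the list can be removed successively from the box `B`, each having
at most four remaining neighboring classes; in the end, all of `T` and two adjacent cells are
removed. Here `Z` is the set of removed cells. -/
def peels (T : List ℕ) (B : ℕ) : List ℕ → ℕ → Bool
  | [], Z => T.all (fun m => Nat.beq (m &&& Z) m) && !Nat.beq (Z &&& Z >>> 1) 0
  | i :: l, Z => B.testBit i &&
      (fewClasses T 4 (around (classOf T i) ^^^ (around (classOf T i) &&& Z)) &&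
      peels T B l (Z ||| classOf T i))

lemma one_shiftLeft_testBit {i j : ℕ} : (1 <<< i).testBit j ↔ i = j := by
  rw [Nat.one_shiftLeft, Nat.testBit_two_pow]
  simp

lemma exists_testBit_land_sub_one {m : ℕ} :
    ∃ k, ∀ j, m.testBit j → j = k ∨ (m &&& (m - 1)).testBit j := by
  induction m using Nat.strong_induction_on with
  | _ m ih =>
    rcases Nat.mod_two_eq_zero_or_one m with h | h
    · rcases Nat.eq_zero_or_pos m with rfl | hm
      · exact ⟨0, by simp⟩
      · obtain ⟨k, hk⟩ := ih (m / 2) (by omega)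
        refine ⟨k + 1, fun j hj => ?_⟩
        cases j with
        | zero => simp [Nat.testBit_zero, h] at hj
        | succ j =>
          have h1 : (m - 1) / 2 = m / 2 - 1 := by omega
          rw [Nat.testBit_succ] at hj
          rw [Nat.testBit_and, Nat.testBit_succ, Nat.testBit_succ, h1, ← Nat.testBit_and]
          exact (hk j hj).imp (congrArg _) id
    · refine ⟨0, fun j hj => ?_⟩
      cases j with
      | zero => exact Or.inl rfl
      | succ j =>
        have h1 : (m - 1) / 2 = m / 2 := by omega
        rw [Nat.testBit_and, Nat.testBit_succ, Nat.testBit_succ, h1, ← Nat.testBit_succ, hj]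
        exact Or.inr rfl

lemma exists_finset_of_fewBits (o : ZMod a × ZMod b) {n : ℕ} :
    ∀ {m : ℕ}, fewBits n m → ∃ N : Finset (ZMod a × ZMod b), N.card ≤ n ∧
      ∀ j, m.testBit j → pt o j ∈ N := by
  classical
  induction n with
  | zero =>
    intro m hm
    obtain rfl : m = 0 := Nat.eq_of_beq_eq_true hm
    exact ⟨∅, le_rfl, fun j hj => by simp at hj⟩
  | succ n ih =>
    intro m hm
    rw [fewBits, Bool.or_eq_true] at hm
    rcases hm with hm | hm
    · obtain rfl : m = 0 := Nat.eq_of_beq_eq_true hm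
      exact ⟨∅, Nat.zero_le _, fun j hj => by simp at hj⟩
    · obtain ⟨N, hN, h⟩ := ih hm
      obtain ⟨k, hk⟩ := exists_testBit_land_sub_one (m := m)
      refine ⟨insert (pt o k) N, (Finset.card_insert_le _ _).trans (by omega), fun j hj => ?_⟩
      rcases hk j hj with rfl | hjk
      · exact Finset.mem_insert_self _ _
      · exact Finset.mem_insert_of_mem (h j hjk)

lemma exists_finset_of_fewClasses {o : ZMod a × ZMod b} {r : ZMod a × ZMod b → ZMod a × ZMod b →
    Prop} (hr : ∀ u, r u u) {T : List ℕ} :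
    ∀ {n m : ℕ}, (∀ t ∈ T, ∀ i j, t.testBit i → t.testBit j → r (pt o i) (pt o j)) →
      fewClasses T n m → ∃ N : Finset (ZMod a × ZMod b), N.card ≤ n ∧
      ∀ j, m.testBit j → ∃ x ∈ N, r (pt o j) x := by
  classical
  induction T with
  | nil =>
    intro n m _ hm
    obtain ⟨N, hN, h⟩ := exists_finset_of_fewBits o hm
    exact ⟨N, hN, fun j hj => ⟨_, h j hj, hr _⟩⟩
  | cons t T ih =>
    intro n m hT hm
    have hT' := fun s hs => hT s (List.mem_cons_of_mem t hs)
    rw [fewClasses] at hm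
    by_cases h0 : m &&& t = 0
    · rw [h0] at hm
      exact ih hT' hm
    · obtain ⟨k, hk⟩ := Nat.exists_testBit_of_ne_zero h0
      rw [Nat.testBit_and, Bool.and_eq_true] at hk
      have hb : Nat.beq (m &&& t) 0 = false := by
        rw [← Bool.not_eq_true]
        exact fun h => h0 (Nat.eq_of_beq_eq_true h)
      rw [hb, cond_false] at hm
      cases n with
      | zero => exact absurd hm (by simp)
      | succ n =>
        obtain ⟨N, hN, h⟩ := ih hT' (show fewClasses T n _ = true from hm)
        refine ⟨insert (pt o k) N, (Finset.card_insert_le _ _).trans (by omega), fun j hj => ?_⟩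
        by_cases hjt : t.testBit j
        · exact ⟨_, Finset.mem_insert_self _ _, hT t List.mem_cons_self j k hjt hk.2⟩
        · obtain ⟨x, hx, hjx⟩ := h j (by
            rw [Nat.testBit_xor, Nat.testBit_and, hj]
            simpa using hjt)
          exact ⟨x, Finset.mem_insert_of_mem hx, hjx⟩

lemma classOf_cases (T : List ℕ) (i : ℕ) :
    (classOf T i ∈ T) ∨ (classOf T i = 1 <<< i ∧ ∀ m ∈ T, ¬ m.testBit i) := by
  induction T with
  | nil => exact Or.inr ⟨rfl, by simp⟩
  | cons m T ih =>
    rw [classOf]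
    by_cases h : m.testBit i
    · rw [h]
      exact Or.inl List.mem_cons_self
    · rw [Bool.not_eq_true] at h
      rw [h, cond_false]
      rcases ih with ih | ⟨h1, h2⟩
      · exact Or.inl (List.mem_cons_of_mem m ih)
      · refine Or.inr ⟨h1, fun n hn => ?_⟩
        rcases List.mem_cons.1 hn with rfl | hn
        · simp [h]
        · exact h2 n hn

lemma exists_cell_of_cellRel (ha : 7 ≤ a) (hb : 7 ≤ b) {o : ZMod a × ZMod b} {k i j : ℕ}
    {T : List ℕ} (hT : DisjointIn k T) (hi : (box k).testBit i) (hj : (classOf T i).testBit j)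
    {u : ZMod a × ZMod b} (hu : cellRel o T u (pt o j)) :
    ∃ j', (classOf T i).testBit j' ∧ pt o j' = u := by
  rcases hu with rfl | ⟨m, hm, i', j', hi', hj', rfl, hjj⟩
  · exact ⟨j, hj, rfl⟩
  refine ⟨i', ?_, rfl⟩
  have hm' := testBit_of_land_eq (hT.2.1 m hm) hj'
  rcases classOf_cases T i with h | ⟨h, h'⟩
  · have hj2 := testBit_of_land_eq (hT.2.1 _ h) hj
    obtain rfl := pt_injOn ha hb hT.1 hm' hj2 hjj
    rw [← hT.eq_of_testBit hm h hj' hj]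
    exact hi'
  · rw [h, one_shiftLeft_testBit] at hj
    subst hj
    obtain rfl := pt_injOn ha hb hT.1 hm' hi hjj
    exact absurd hj' (h' m hm)

lemma exists_removed_of_peels (ha : 7 ≤ a) (hb : 7 ≤ b) {o : ZMod a × ZMod b} {k : ℕ}
    {T : List ℕ} (hT : DisjointIn k T) {Y : Set (ZMod a × ZMod b)}
    (hY : ∀ (v : ZMod a × ZMod b) (N : Finset (ZMod a × ZMod b)), N.card ≤ 4 →
      (∀ u q, cellRel o T u v → (triGrid a b).Adj u q → q ∉ Y → ∃ n ∈ N, cellRel o T q n) → v ∈ Y)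
    {l : List ℕ} : ∀ {Z : ℕ}, peels T (box k) l Z →
      (∀ j, Z.testBit j → pt o j ∈ Y ∧ (box k).testBit j) →
      ∃ W : ℕ, (∀ m ∈ T, m &&& W = m) ∧ W &&& W >>> 1 ≠ 0 ∧
        ∀ j, W.testBit j → pt o j ∈ Y ∧ (box k).testBit j := by
  induction l with
  | nil =>
    intro Z h hZ
    rw [peels, Bool.and_eq_true, List.all_eq_true, Bool.not_eq_true'] at h
    exact ⟨Z, fun m hm => Nat.eq_of_beq_eq_true (h.1 m hm),
      fun h0 => by rw [h0] at h; exact absurd h.2 (by decide), hZ⟩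
  | cons i l ih =>
    intro Z h hZ
    rw [peels, Bool.and_eq_true, Bool.and_eq_true] at h
    obtain ⟨hi, h1, h2⟩ := h
    refine ih h2 fun j hj => ?_
    rw [Nat.testBit_or, Bool.or_eq_true] at hj
    rcases hj with hj | hj
    · exact hZ j hj
    have hbox : ∀ j, (classOf T i).testBit j → (box k).testBit j := by
      intro j hj
      rcases classOf_cases T i with h | ⟨h, -⟩
      · exact testBit_of_land_eq (hT.2.1 _ h) hj
      · rw [h, one_shiftLeft_testBit] at hj
        exact hj ▸ hi
    refine ⟨?_, hbox j hj⟩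
    obtain ⟨N, hN, hN'⟩ := exists_finset_of_fewClasses (o := o) (r := cellRel o T)
      (fun u => Or.inl rfl)
      (fun t ht i j hi hj => Or.inr ⟨t, ht, i, j, hi, hj, rfl, rfl⟩) h1
    refine hY _ N hN fun u q hu huq hq => ?_
    obtain ⟨j', hj', rfl⟩ := exists_cell_of_cellRel ha hb hT hi hj hu
    obtain ⟨q', hq', hadj⟩ := pt_add_dir (o := o)
      (interior_of_testBit_box hT.1 (hbox j' hj')) (sub_mem_of_adj huq)
    rw [add_sub_cancel] at hq'
    subst hq'
    refine hN' q' ?_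
    have hZq : Z.testBit q' = false := by
      rw [← Bool.not_eq_true]
      exact fun h => hq (hZ _ h).1
    rw [Nat.testBit_xor, Nat.testBit_and, hZq, testBit_around hj' hadj]
    rfl

lemma eq_univ_of_spreading (ha : 7 ≤ a) (hb : 7 ≤ b) {Y : Set (ZMod a × ZMod b)}
    (hY : ∀ v, ∀ d ∈ hexDirs a b, ∀ e ∈ hexDirs a b, d ≠ e → v + d ∈ Y → v + e ∈ Y → v ∈ Y)
    {p : ZMod a × ZMod b} (hp : p ∈ Y) (hp' : p + (1, 0) ∈ Y) : Y = Set.univ := by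
  have : Fact (1 < a) := ⟨by omega⟩
  have : Fact (1 < b) := ⟨by omega⟩
  have : NeZero a := ⟨by omega⟩
  have : NeZero b := ⟨by omega⟩
  have step : ∀ q : ZMod a × ZMod b, q ∈ Y → q + (1, 0) ∈ Y → q + (1, 0) + (1, 0) ∈ Y := by
    intro q h0 h1
    have h2 : q + (1, -1) ∈ Y := by
      refine hY _ (-1, 1) (by simp [hexDirs]) (0, 1) (by simp [hexDirs]) (by simp) ?_ ?_
      · convert h0 using 1; ext <;> simp
      · convert h1 using 1; ext <;> simp
    have h3 : q + (2, -1) ∈ Y := by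
      refine hY _ (-1, 0) (by simp [hexDirs]) (-1, 1) (by simp [hexDirs]) (by simp) ?_ ?_
      · convert h2 using 1; ext <;> simp; ring
      · convert h1 using 1; ext <;> simp; ring
    refine hY _ (-1, 0) (by simp [hexDirs]) (0, -1) (by simp [hexDirs]) (by simp) ?_ ?_
    · convert h1 using 1; ext <;> simp
    · convert h3 using 1; ext <;> simp; ring
  have row : ∀ q : ZMod a × ZMod b, q ∈ Y → q + (1, 0) ∈ Y → ∀ n : ℕ,
      q + ((n : ZMod a), 0) ∈ Y ∧ q + ((n : ZMod a), 0) + (1, 0) ∈ Y := by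
    intro q h0 h1 n
    induction n with
    | zero => simpa [Prod.mk_zero_zero] using And.intro h0 h1
    | succ n ih =>
      have e : q + (((n + 1 : ℕ) : ZMod a), 0) = q + ((n : ZMod a), 0) + (1, 0) := by
        ext <;> push_cast <;> simp only [Prod.fst_add, Prod.snd_add] <;> ring
      rw [e]
      exact ⟨ih.2, step _ ih.1 ih.2⟩
  have up : ∀ q : ZMod a × ZMod b, q ∈ Y → q + (1, 0) ∈ Y → q + (0, 1) ∈ Y := by
    intro q h0 h1
    refine hY _ (0, -1) (by simp [hexDirs]) (1, -1) (by simp [hexDirs]) (by simp) ?_ ?_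
    · convert h0 using 1; ext <;> simp
    · convert h1 using 1; ext <;> simp
  have rows : ∀ n : ℕ, p + (0, (n : ZMod b)) ∈ Y ∧ p + (0, (n : ZMod b)) + (1, 0) ∈ Y := by
    intro n
    induction n with
    | zero => simpa [Prod.mk_zero_zero] using And.intro hp hp'
    | succ n ih =>
      have e : p + (0, ((n + 1 : ℕ) : ZMod b)) = p + (0, (n : ZMod b)) + (0, 1) := by
        ext <;> push_cast <;> simp only [Prod.fst_add, Prod.snd_add] <;> ring
      rw [e]
      refine ⟨up _ ih.1 ih.2, ?_⟩
      rw [add_right_comm]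
      exact up _ ih.2 (step _ ih.1 ih.2)
  ext v
  refine ⟨fun _ => trivial, fun _ => ?_⟩
  have h := rows (v.2 - p.2).val
  have h' := (row _ h.1 h.2 (v.1 - p.1).val).1
  convert h' using 1
  ext <;> simp

/-- Boolean form of `DisjointIn` together with `peels`. -/
def peelable (T : List ℕ) (k : ℕ) (l : List ℕ) : Bool :=
  Nat.ble 1 (k % 16) && Nat.ble (k % 16) 8 && Nat.ble 16 k &&
    T.all (fun m => Nat.beq (m &&& box k) m) && pairwiseDisjoint T && peels T (box k) l 0
where
  /-- The cell sets in the list are pairwise disjoint. -/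
  pairwiseDisjoint : List ℕ → Bool
    | [] => true
    | m :: T => T.all (fun n => Nat.beq (m &&& n) 0) && pairwiseDisjoint T

lemma pairwise_of_pairwiseDisjoint {T : List ℕ} (h : peelable.pairwiseDisjoint T) :
    T.Pairwise fun m n => m &&& n = 0 := by
  induction T with
  | nil => exact List.Pairwise.nil
  | cons m T ih =>
    rw [peelable.pairwiseDisjoint, Bool.and_eq_true, List.all_eq_true] at h
    exact List.Pairwise.cons (fun n hn => Nat.eq_of_beq_eq_true (h.1 n hn)) (ih h.2)

lemma disjointIn_of_peelable {T : List ℕ} {k : ℕ} {l : List ℕ} (h : peelable T k l) :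
    DisjointIn k T ∧ peels T (box k) l 0 := by
  simp only [peelable, Bool.and_eq_true, List.all_eq_true] at h
  obtain ⟨⟨⟨⟨⟨h1, h2⟩, h3⟩, h4⟩, h5⟩, h6⟩ := h
  exact ⟨⟨⟨Nat.le_of_ble_eq_true h1, Nat.le_of_ble_eq_true h2, Nat.le_of_ble_eq_true h3⟩,
    fun m hm => Nat.eq_of_beq_eq_true (h4 m hm), pairwise_of_pairwiseDisjoint h5⟩, h6⟩

lemma degenerate_of_peelable (ha : 7 ≤ a) (hb : 7 ≤ b) (o : ZMod a × ZMod b) {T : List ℕ} {k : ℕ}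
    {l : List ℕ} (h : peelable T k l) : Degenerate (quotGraph (triGrid a b) (cellRel o T)) 4 := by
  classical
  have : NeZero a := ⟨by omega⟩
  have : NeZero b := ⟨by omega⟩
  obtain ⟨hT, hl⟩ := disjointIn_of_peelable h
  have hmk : ∀ u v, Quot.mk (cellRel o T) u = Quot.mk (cellRel o T) v ↔ cellRel o T u v :=
    fun u v => (hT.equivalence ha hb o).quot_mk_eq_iff u v
  refine degenerate_quot_of_peeling fun Y _ hY => ?_
  simp only [hmk] at hY
  obtain ⟨W, hWT, hW, hWY⟩ := exists_removed_of_peels ha hb hT hY hl (by simp)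
  obtain ⟨i, hi⟩ := Nat.exists_testBit_of_ne_zero hW
  rw [Nat.testBit_and, Nat.testBit_shiftRight, Bool.and_eq_true, Nat.add_comm] at hi
  have hi1 := hWY i hi.1
  have hi2 := hWY (i + 1) hi.2
  have hin := interior_of_testBit_box hT.1 hi1.2
  refine eq_univ_of_spreading ha hb (p := pt o i) ?_ hi1.1 ?_
  · intro v d hd e he hde hvd hve
    by_cases hv : ∃ m ∈ T, ∃ j, m.testBit j ∧ pt o j = v
    · obtain ⟨m, hm, j, hj, rfl⟩ := hv
      exact (hWY j (testBit_of_land_eq (hWT m hm) hj)).1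
    · have hcard : (((hexDirs a b).erase d).erase e).card ≤ 4 := by
        rw [Finset.card_erase_of_mem (Finset.mem_erase.2 ⟨hde.symm, he⟩),
          Finset.card_erase_of_mem hd]
        have : (hexDirs a b).card ≤ 6 := Finset.card_le_six
        omega
      refine hY v ((((hexDirs a b).erase d).erase e).image (v + ·))
        (Finset.card_image_le.trans hcard) fun u q hu huq hq => ?_
      have huv : u = v := by
        rcases hu with hu | ⟨m, hm, i, j, -, hj, -, hjv⟩
        · exact hu
        · exact absurd ⟨m, hm, j, hj, hjv⟩ hv
      subst huv
      refine ⟨q, Finset.mem_image.2 ⟨q - u, ?_, add_sub_cancel u q⟩, Or.inl rfl⟩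
      refine Finset.mem_erase.2 ⟨?_, Finset.mem_erase.2 ⟨?_, sub_mem_of_adj huq⟩⟩
      · rintro rfl
        exact hq (by simpa using hve)
      · rintro rfl
        exact hq (by simpa using hvd)
  · have h1 := hin.2.1
    have : pt o i + (1, 0) = pt o (i + 1) := by
      rw [pt, pt, show (i + 1) % 16 = i % 16 + 1 by omega, show (i + 1) / 16 = i / 16 by omega]
      ext <;> push_cast <;> simp only [Prod.fst_add, Prod.snd_add] <;> ring
    rw [this]
    exact hi2.1

/-! ### Coarser templates -/

/-- No two cells of `m` lie in opposite outer rows or columns of the box with corner `k`, and no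
two cells of `m` are adjacent. -/
def independent (k m : ℕ) : Bool :=
  Nat.beq (around m &&& m) 0 &&
  (Nat.beq (m &&& 79229371458530977775699951617 <<< k) 0 ||
    Nat.beq (m &&& 5070679773345982577644796903488 <<< k) 0) &&
  (Nat.beq (m &&& 127 <<< k) 0 || Nat.beq (m &&& 10061976639311570874380081692672 <<< k) 0)

lemma testBit_shiftLeft_of_box {k i c : ℕ} {p : ℕ → Prop} (hk : Corner k)
    (hi : (box k).testBit i) (hc : ∀ j < 112, j % 16 < 7 → p j → c.testBit j)
    (hp : p (i - k)) : (c <<< k).testBit i := by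
  have h := testBit_box hk hi
  obtain ⟨h1, h2, h3⟩ := hk
  rw [Nat.testBit_shiftLeft, Bool.and_eq_true, decide_eq_true_eq]
  exact ⟨by omega, hc _ (by omega) (by omega) hp⟩

lemma beq_land_false_of_testBit {m n i : ℕ} (hm : m.testBit i) (hn : n.testBit i) :
    ¬ Nat.beq (m &&& n) 0 = true :=
  fun h => not_testBit_of_land_eq_zero (Nat.eq_of_beq_eq_true h) hm hn

lemma columns_of_independent {k m i j : ℕ} (hk : Corner k) (hm : m &&& box k = m)
    (h : independent k m) (hi : m.testBit i) (hj : m.testBit j) :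
    j % 16 < i % 16 + 6 ∧ j / 16 < i / 16 + 6 := by
  have hib := testBit_of_land_eq hm hi
  have hjb := testBit_of_land_eq hm hj
  have h1 := testBit_box hk hib
  have h2 := testBit_box hk hjb
  rw [independent, Bool.and_eq_true, Bool.and_eq_true, Bool.or_eq_true, Bool.or_eq_true] at h
  have hk' := hk
  obtain ⟨h3, h4, h5⟩ := hk'
  constructor
  · by_contra hc
    rcases h.1.2 with h0 | h0
    · refine beq_land_false_of_testBit hi (testBit_shiftLeft_of_box (p := fun j => j % 16 = 0)
        hk hib (by decide) ?_) h0
      omega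
    · refine beq_land_false_of_testBit hj (testBit_shiftLeft_of_box (p := fun j => j % 16 = 6)
        hk hjb (by decide) ?_) h0
      omega
  · by_contra hc
    rcases h.2 with h0 | h0
    · refine beq_land_false_of_testBit hi (testBit_shiftLeft_of_box (p := fun j => j / 16 = 0)
        hk hib (by decide) ?_) h0
      omega
    · refine beq_land_false_of_testBit hj (testBit_shiftLeft_of_box (p := fun j => j / 16 = 6)
        hk hjb (by decide) ?_) h0
      omega

lemma eq_of_intCast_eq {n : ℕ} (hn : 7 ≤ n) {x y : ℕ} {e : ℤ} (hxy : x < y + 6) (hyx : y < x + 6)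
    (he : -1 ≤ e) (he' : e ≤ 1) (h : (x : ZMod n) - y = e) : (x : ℤ) - y = e := by
  have h0 : (((x : ℤ) - y - e : ℤ) : ZMod n) = 0 := by
    push_cast
    rw [h, sub_self]
  have := Int.eq_zero_of_abs_lt_dvd ((ZMod.intCast_zmod_eq_zero_iff_dvd _ _).1 h0)
    (abs_lt.2 ⟨by omega, by omega⟩)
  omega

lemma not_adj_of_independent (ha : 7 ≤ a) (hb : 7 ≤ b) {o : ZMod a × ZMod b} {k m i j : ℕ}
    (hk : Corner k) (hm : m &&& box k = m) (h : independent k m) (hi : m.testBit i)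
    (hj : m.testBit j) : ¬ (triGrid a b).Adj (pt o i) (pt o j) := by
  intro hadj
  have hij := columns_of_independent hk hm h hi hj
  have hji := columns_of_independent hk hm h hj hi
  have key : ∀ x y : ℤ, -1 ≤ x → x ≤ 1 → -1 ≤ y → y ≤ 1 →
      pt o j - pt o i = ((x : ZMod a), (y : ZMod b)) →
      ((j % 16 : ℕ) : ℤ) - (i % 16 : ℕ) = x ∧ ((j / 16 : ℕ) : ℤ) - (i / 16 : ℕ) = y := by
    intro x y hx hx' hy hy' he
    rw [pt, pt, add_sub_add_left_eq_sub, Prod.mk_sub_mk, Prod.mk.injEq] at he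
    exact ⟨eq_of_intCast_eq ha hij.1 hji.1 hx hx' he.1, eq_of_intCast_eq hb hij.2 hji.2 hy hy' he.2⟩
  have hnb : j = i + 1 ∨ i = j + 1 ∨ j = i + 16 ∨ i = j + 16 ∨ j = i + 15 ∨ i = j + 15 := by
    have hd := sub_mem_of_adj hadj
    simp only [hexDirs, Finset.mem_insert, Finset.mem_singleton] at hd
    rcases hd with h | h | h | h | h | h
    · have := key 0 1 (by simp) (by simp) (by simp) (by simp) (by rw [h]; simp)
      omega
    · have := key 0 (-1) (by simp) (by simp) (by simp) (by simp) (by rw [h]; simp)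
      omega
    · have := key 1 0 (by simp) (by simp) (by simp) (by simp) (by rw [h]; simp)
      omega
    · have := key (-1) 0 (by simp) (by simp) (by simp) (by simp) (by rw [h]; simp)
      omega
    · have := key 1 (-1) (by simp) (by simp) (by simp) (by simp) (by rw [h]; simp)
      omega
    · have := key (-1) 1 (by simp) (by simp) (by simp) (by simp) (by rw [h]; simp)
      omega
  rw [independent, Bool.and_eq_true, Bool.and_eq_true] at h
  exact beq_land_false_of_testBit (testBit_around hi hnb) hj h.1.1

/-- The set of cells in a list. -/
def cellMask : List ℕ → ℕ
  | [] => 0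
  | i :: l => 1 <<< i ||| cellMask l

lemma testBit_cellMask {l : List ℕ} {i : ℕ} : (cellMask l).testBit i ↔ i ∈ l := by
  induction l with
  | nil => simp [cellMask]
  | cons j l ih =>
    rw [cellMask, Nat.testBit_or, Bool.or_eq_true, one_shiftLeft_testBit, ih, List.mem_cons,
      eq_comm]

/-- Merge the set `s` with all members of `T` that meet it. -/
def mergeInto (T : List ℕ) (s : ℕ) : List ℕ :=
  T.foldr (fun m s => bif Nat.beq (m &&& s) 0 then s else m ||| s) s ::
    T.filter fun m => Nat.beq (m &&& s) 0

/-- A witness that colorings containing a template are nice: the classes of the template, a good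
template with four cells, and for the template, for its merger with the four cells, and for the
four cells alone, the corner of a box and the cells of the classes to remove. Lists of cells
are packed in base `256`. -/
structure Witness where
  classes : List ℕ
  cells : ℕ
  corner : ℕ
  order : ℕ
  mergedCorner : ℕ
  mergedOrder : ℕ
  cellsCorner : ℕ
  cellsOrder : ℕ

/-- The list of the nonzero base `256` digits of a number, up to the first zero digit. -/
def unpack : ℕ → ℕ → List ℕ
  | 0, _ => []
  | n + 1, m => bif Nat.beq (m % 256) 0 then [] else m % 256 :: unpack n (m / 256)

/-- The cell sets of the template. -/
def Witness.template (w : Witness) : List ℕ := w.classes.map fun c => cellMask (unpack 64 c)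

/-- All conditions on a witness. -/
def Witness.valid (w : Witness) : Bool :=
  go w.template (unpack 64 w.cells)
where
  /-- All conditions on a witness, for a given template and four cells. -/
  go (T c : List ℕ) : Bool :=
    Nat.beq c.length 4 && decide c.Nodup &&
    peelable T w.corner (unpack 64 w.order) &&
    peelable (mergeInto T (cellMask c)) w.mergedCorner (unpack 64 w.mergedOrder) &&
    peelable [cellMask c] w.cellsCorner (unpack 64 w.cellsOrder) &&
    (mergeInto T (cellMask c)).all (independent w.mergedCorner) &&
    (cellMask c :: T).all fun m =>
      (mergeInto T (cellMask c)).any fun n => Nat.beq (m &&& n) m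

lemma identifyRel_eq_cellRel (o : ZMod a × ZMod b) (s : ℕ) :
    identifyRel {u | ∃ i, s.testBit i ∧ pt o i = u} = cellRel o [s] := by
  ext u v
  constructor
  · rintro (h | ⟨⟨i, hi, rfl⟩, j, hj, rfl⟩)
    · exact Or.inl h
    · exact Or.inr ⟨s, List.mem_singleton_self s, i, j, hi, hj, rfl, rfl⟩
  · rintro (h | ⟨m, hm, i, j, hi, hj, rfl, rfl⟩)
    · exact Or.inl h
    · obtain rfl := List.mem_singleton.1 hm
      exact Or.inr ⟨⟨i, hi, rfl⟩, j, hj, rfl⟩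

lemma goodFourTemplate_of_peelable (ha : 7 ≤ a) (hb : 7 ≤ b) (o : ZMod a × ZMod b) {c : List ℕ}
    {k : ℕ} {l : List ℕ} (hc : c.length = 4) (hc' : c.Nodup) (h : peelable [cellMask c] k l)
    (hi : ∀ i ∈ c, ∀ j ∈ c, ¬ (triGrid a b).Adj (pt o i) (pt o j)) :
    GoodFourTemplate (triGrid a b) {u | ∃ i, (cellMask c).testBit i ∧ pt o i = u} := by
  classical
  refine ⟨?_, ?_, ?_⟩
  · rintro u ⟨i, hi', rfl⟩ v ⟨j, hj', rfl⟩
    exact hi i (testBit_cellMask.1 hi') j (testBit_cellMask.1 hj')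
  · have hT := (disjointIn_of_peelable h).1
    have himg : {u | ∃ i, (cellMask c).testBit i ∧ pt o i = u} =
        pt o '' (c.toFinset : Set ℕ) := by
      ext u
      simp [testBit_cellMask]
    have hbox : ∀ i ∈ c, (box k).testBit i := fun i hi =>
      testBit_of_land_eq (hT.2.1 _ (List.mem_singleton_self _)) (testBit_cellMask.2 hi)
    rw [himg, Set.InjOn.ncard_image, Set.ncard_coe_finset, List.toFinset_card_of_nodup hc', hc]
    intro i hi j hj hij
    exact pt_injOn ha hb hT.1 (hbox i (by simpa using hi)) (hbox j (by simpa using hj)) hij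
  · have := degenerate_of_peelable ha hb o h
    rw [← identifyRel_eq_cellRel] at this
    exact this

lemma Witness.nice (ha : 7 ≤ a) (hb : 7 ≤ b) {w : Witness} (hw : w.valid) (o : ZMod a × ZMod b)
    {φ : ZMod a × ZMod b → Fin 5} (hφ : Proper (triGrid a b) φ)
    (hT : ∀ m ∈ w.template, ∀ i j, m.testBit i → m.testBit j → φ (pt o i) = φ (pt o j)) :
    Nice a b φ := by
  have : NeZero a := ⟨by omega⟩
  have : NeZero b := ⟨by omega⟩
  rw [Witness.valid] at hw
  generalize w.template = T at hw hT
  generalize unpack 64 w.cells = c at hw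
  simp only [Witness.valid.go, Bool.and_eq_true, List.all_eq_true, List.any_eq_true,
    decide_eq_true_eq] at hw
  obtain ⟨⟨⟨⟨⟨⟨h1, h2⟩, h3⟩, h4⟩, h5⟩, h6⟩, h7⟩ := hw
  have hM := (disjointIn_of_peelable h4).1
  have hind : ∀ m ∈ mergeInto T (cellMask c), ∀ i j, m.testBit i → m.testBit j →
      ¬ (triGrid a b).Adj (pt o i) (pt o j) := fun m hm i j hi hj =>
    not_adj_of_independent ha hb hM.1 (hM.2.1 m hm) (h6 m hm) hi hj
  have hmk : ∀ u v, (triGrid a b).Adj u v → Quot.mk (cellRel o (mergeInto T (cellMask c))) u ≠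
      Quot.mk (cellRel o (mergeInto T (cellMask c))) v := by
    intro u v huv h
    rw [(hM.equivalence ha hb o).quot_mk_eq_iff] at h
    rcases h with rfl | ⟨m, hm, i, j, hi, hj, rfl, rfl⟩
    · exact huv.ne rfl
    · exact hind m hm i j hi hj huv
  have hsub : ∀ m ∈ cellMask c :: T, ∃ n ∈ mergeInto T (cellMask c),
      ∀ i, m.testBit i → n.testBit i := by
    intro m hm
    obtain ⟨n, hn, hmn⟩ := h7 m hm
    exact ⟨n, hn, fun i hi => testBit_of_land_eq (Nat.eq_of_beq_eq_true hmn) hi⟩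
  obtain ⟨ψ, hψ, hψM⟩ := exists_coloring_of_degenerate_quot
    (degenerate_of_peelable ha hb o h4) hmk
  have hψT : ∀ m ∈ cellMask c :: T, ∀ i j, m.testBit i → m.testBit j →
      ψ (pt o i) = ψ (pt o j) := by
    intro m hm i j hi hj
    obtain ⟨n, hn, hmn⟩ := hsub m hm
    exact hψM _ _ (Or.inr ⟨n, hn, i, j, hmn i hi, hmn j hj, rfl, rfl⟩)
  refine ⟨ψ, hψ, kempeEquiv_of_degenerate_quot (degenerate_of_peelable ha hb o h3) hφ hψ ?_ ?_,
    {u | ∃ i, (cellMask c).testBit i ∧ pt o i = u},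
    goodFourTemplate_of_peelable ha hb o (Nat.eq_of_beq_eq_true h1) h2 h5 ?_, ?_⟩
  · rintro u v (rfl | ⟨m, hm, i, j, hi, hj, rfl, rfl⟩)
    · rfl
    · exact hT m hm i j hi hj
  · rintro u v (rfl | ⟨m, hm, i, j, hi, hj, rfl, rfl⟩)
    · rfl
    · exact hψT m (List.mem_cons_of_mem _ hm) i j hi hj
  · intro i hi j hj
    obtain ⟨n, hn, hmn⟩ := hsub _ List.mem_cons_self
    exact hind n hn i j (hmn i (testBit_cellMask.2 hi)) (hmn j (testBit_cellMask.2 hj))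
  · rintro u ⟨i, hi, rfl⟩ v ⟨j, hj, rfl⟩
    exact hψT _ List.mem_cons_self i j hi hj

/-! ### The case distinction -/

/-- The color classes in `s` are nonempty parts of different color classes of `c`. -/
def Fits (c : ℕ → Fin 5) (s : List ℕ) : Prop :=
  ∃ cs : List (Fin 5), cs.Nodup ∧ List.Forall₂ (fun m x => ∀ i, m.testBit i → c i = x) s cs

/-- All ways to add the cell `i` to one of the color classes in the list, or to a new class if
there are fewer than `n` classes. -/
def extensions (i : ℕ) : ℕ → List ℕ → List (List ℕ)
  | n, [] => bif Nat.beq n 0 then [] else [[1 <<< i]]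
  | n, m :: s =>
    bif Nat.beq (around (1 <<< i) &&& m) 0 then
      ((m ||| 1 <<< i) :: s) :: (extensions i (n - 1) s).map (m :: ·)
    else (extensions i (n - 1) s).map (m :: ·)

lemma exists_extension_of_mem {c : ℕ → Fin 5} {i : ℕ}
    (hc : ∀ j, (around (1 <<< i)).testBit j → c j ≠ c i) {s : List ℕ} {cs : List (Fin 5)}
    (h : List.Forall₂ (fun m x => ∀ i, m.testBit i → c i = x) s cs) (hi : c i ∈ cs) :
    ∀ n, ∃ t ∈ extensions i n s,
      List.Forall₂ (fun m x => ∀ i, m.testBit i → c i = x) t cs := by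
  induction h with
  | nil => simp at hi
  | @cons m x s cs hmx hs ih =>
    intro n
    rw [extensions]
    by_cases hx : c i = x
    · have h0 : Nat.beq (around (1 <<< i) &&& m) 0 = true := by
        rw [Nat.beq_eq]
        by_contra hne
        obtain ⟨j, hj⟩ := Nat.exists_testBit_of_ne_zero hne
        rw [Nat.testBit_and, Bool.and_eq_true] at hj
        exact hc j hj.1 ((hmx j hj.2).trans hx.symm)
      rw [h0, cond_true]
      refine ⟨_, List.mem_cons_self, List.Forall₂.cons (fun j hj => ?_) hs⟩
      rw [Nat.testBit_or, Bool.or_eq_true, one_shiftLeft_testBit] at hj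
      rcases hj with hj | rfl
      · exact hmx j hj
      · exact hx
    · obtain ⟨t, ht, hts⟩ := ih ((List.mem_cons.1 hi).resolve_left hx) (n - 1)
      refine ⟨m :: t, ?_, List.Forall₂.cons hmx hts⟩
      have := List.mem_map_of_mem (f := (m :: ·)) ht
      cases Nat.beq (around (1 <<< i) &&& m) 0
      · exact this
      · exact List.mem_cons_of_mem _ this

lemma exists_extension_of_notMem {c : ℕ → Fin 5} {i : ℕ} {s : List ℕ} {cs : List (Fin 5)}
    (h : List.Forall₂ (fun m x => ∀ i, m.testBit i → c i = x) s cs) :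
    ∀ n, cs.length < n → ∃ t ∈ extensions i n s,
      List.Forall₂ (fun m x => ∀ i, m.testBit i → c i = x) t (cs ++ [c i]) := by
  induction h with
  | nil =>
    intro n hn
    refine ⟨[1 <<< i], ?_, List.Forall₂.cons (fun j hj => ?_) List.Forall₂.nil⟩
    · obtain ⟨n, rfl⟩ := Nat.exists_eq_succ_of_ne_zero (Nat.ne_of_gt hn)
      exact List.mem_singleton_self _
    · rw [one_shiftLeft_testBit] at hj
      rw [hj]
  | @cons m x s cs hmx hs ih =>
    intro n hn
    obtain ⟨t, ht, hts⟩ := ih (n - 1) (by rw [List.length_cons] at hn; omega)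
    refine ⟨m :: t, ?_, List.Forall₂.cons hmx hts⟩
    rw [extensions]
    have := List.mem_map_of_mem (f := (m :: ·)) ht
    cases Nat.beq (around (1 <<< i) &&& m) 0
    · exact this
    · exact List.mem_cons_of_mem _ this

lemma Fits.exists_extension {c : ℕ → Fin 5} {i : ℕ}
    (hc : ∀ j, (around (1 <<< i)).testBit j → c j ≠ c i) {s : List ℕ} (h : Fits c s) :
    ∃ t ∈ extensions i 5 s, Fits c t := by
  obtain ⟨cs, hcs, hs⟩ := h
  by_cases hi : c i ∈ cs
  · obtain ⟨t, ht, hts⟩ := exists_extension_of_mem hc hs hi 5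
    exact ⟨t, ht, cs, hcs, hts⟩
  · have hnd : (cs ++ [c i]).Nodup := by
      rw [List.nodup_append]
      refine ⟨hcs, List.nodup_singleton _, ?_⟩
      rintro x hx y hy rfl
      exact hi (List.mem_singleton.1 hy ▸ hx)
    have hlen := hnd.length_le_card
    rw [List.length_append, List.length_singleton, Fintype.card_fin] at hlen
    obtain ⟨t, ht, hts⟩ := exists_extension_of_notMem (i := i) hs 5 (by omega)
    exact ⟨t, ht, _, hnd, hts⟩

/-- Each class of the template `T` lies in one of the color classes in `s`. -/
def covered (s T : List ℕ) : Bool :=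
  T.all fun m => s.any fun l => Nat.beq (m &&& l) m

lemma Fits.mono_of_covered {c : ℕ → Fin 5} {s T : List ℕ} (h : Fits c s) (hT : covered s T)
    {m i j : ℕ} (hm : m ∈ T) (hi : m.testBit i) (hj : m.testBit j) : c i = c j := by
  obtain ⟨cs, -, hs⟩ := h
  simp only [covered, List.all_eq_true, List.any_eq_true] at hT
  obtain ⟨l, hl, hml⟩ := hT m hm
  obtain ⟨n, hn, rfl⟩ := List.mem_iff_getElem.1 hl
  have hn' : n < cs.length := hs.length_eq ▸ hn
  have key := List.forall₂_iff_get.1 hs |>.2 n hn hn'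
  have hml' := Nat.eq_of_beq_eq_true hml
  rw [key i (testBit_of_land_eq hml' hi), key j (testBit_of_land_eq hml' hj)]

/-- A depth first search through the colorings that fit one of the lists on the stack, directed by
a list of instructions: a number `i < 256` distinguishes the color of the cell `i`, and
`256 + n` announces that the `n`-th template is contained. -/
def search (Ts : List (List ℕ)) : List ℕ → List (List ℕ) → Bool
  | [], [] => true
  | [], _ :: _ => false
  | _ :: _, [] => false
  | i :: is, s :: st =>
    bif Nat.ble 256 i then (Ts[i - 256]?).any (covered s) && search Ts is st
    else Nat.ble 1 (i % 16) && Nat.ble (i % 16) 14 && Nat.ble 16 i &&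
      search Ts is (extensions i 5 s ++ st)

lemma exists_template_of_search {Ts : List (List ℕ)} {c : ℕ → Fin 5}
    (hc : ∀ i j, Interior i → (around (1 <<< i)).testBit j → c j ≠ c i) {is : List ℕ} :
    ∀ {st : List (List ℕ)}, search Ts is st → ∀ s ∈ st, Fits c s →
      ∃ T ∈ Ts, ∀ m ∈ T, ∀ i j, m.testBit i → m.testBit j → c i = c j := by
  induction is with
  | nil =>
    intro st h s hs
    cases st with
    | nil => simp at hs
    | cons s' st => simp [search] at h
  | cons i is ih =>
    intro st h s hs hf
    cases st with
    | nil => simp at hs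
    | cons s' st =>
      rw [search] at h
      cases hi : Nat.ble 256 i with
      | true =>
        rw [hi, cond_true, Bool.and_eq_true] at h
        rcases List.mem_cons.1 hs with rfl | hs
        · obtain ⟨T, hT, hsT⟩ := (Option.any_eq_true _ _).1 h.1
          exact ⟨T, List.mem_of_getElem? hT, fun m hm _ _ => hf.mono_of_covered hsT hm⟩
        · exact ih h.2 s hs hf
      | false =>
        rw [hi, cond_false, Bool.and_eq_true, Bool.and_eq_true, Bool.and_eq_true] at h
        obtain ⟨⟨⟨h1, h2⟩, h3⟩, h4⟩ := h
        rcases List.mem_cons.1 hs with rfl | hs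
        · obtain ⟨t, ht, hft⟩ := hf.exists_extension (i := i) (hc i · ⟨Nat.le_of_ble_eq_true h1,
            Nat.le_of_ble_eq_true h2, Nat.le_of_ble_eq_true h3⟩)
          exact ih h4 t (List.mem_append_left _ ht) hft
        · exact ih h4 s (List.mem_append_right _ hs) hf

end Torus

/-- The list of `n` base `1024` digits of a number. -/
def instructions : ℕ → ℕ → List ℕ
  | 0, _ => []
  | n + 1, m => m % 1024 :: instructions n (m / 1024)


/-- The witnesses for the templates in the case distinction. -/
def witnesses : List Witness :=
  [⟨[35192, 10913657], 3063384440, 99, 687787689360714250874563844680996696202776450952, 115, 756230561893292761492940632755768641439813324172146038511752, 83, 2685271740738268255169408888679918022605379720⟩,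
   ⟨[34681, 853249853816], 2593687417, 102, 12686644752577885566338641089350694054577335188560058145782269319304, 102, 831431950504944308475567726325612202192377718830940140554365583972997000, 69, 177798814612067903450035191289487879019394917435784⟩,
   ⟨[34681, 11110776, 13084566], 2256038503, 99, 12713748969853413009747889040586640419756124896637257723421180598152, 101, 11972928745070801441774498571801627078671999659671505024713388014591749161191543, 36, 2308602638548959587466277155908665620923189111⟩,
   ⟨[34681, 35192, 12167322], 3063384440, 100, 14802077584326282742841611336771590513834548717553363336, 116, 3247985531567396252365714219819461688459645623260622188799627336718472, 83, 2685271740738268255169408888679918022605379720⟩,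
   ⟨[34681, 35192, 43159, 50872], 2543159672, 99, 45074854009943815688492731026082177588857332956633224, 99, 1274490239633478127992684324198080620671332945372543046746450580049860744, 67, 176331582912699951376972485421210481437079970093192⟩,
   ⟨[34681, 35192, 46743, 47014], 2543159672, 85, 62329519674574173245444373437725416276723159346489224, 115, 212859979797210543210401164397309275315989397959606341249391913802276509832, 67, 176331582912699951376972485421210481437079970093192⟩,
   ⟨[34681, 35192, 11901078], 2256828519, 115, 756230561893292761498065990844319913015990660896605272971144, 83, 182594955972921744548169102076513234754530539213483945604906489412471720055, 50, 151388621635585874906296264276185917901618721359735⟩,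
   ⟨[34681, 35192, 11184025], 2543159672, 103, 762138716059365276861513862220863153659736759627264853317768, 101, 54488724308292030201285786939183750555883204915171999803769162143315572332680, 67, 176331582912699951376972485421210481437079970093192⟩,
   ⟨[34681, 3047655800], 2845345657, 115, 2957091444761047080628120367164425264817849908234120829064, 99, 837954816187811922556268817934806199565923033282618693049010606869747592, 68, 2707572507288134479374344721393193184394709384⟩,
   ⟨[34681, 43146, 11110776], 3080226681, 102, 2978450909853334200050678338337113569628883966869397608840, 117, 54942832531164114428484742858077639796009566259552736999605666071767854716808, 83, 2707572507288134479396388765897630089012021640⟩,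
   ⟨[34681, 728661461368], 3080226681, 85, 12713463426412226391778931301494443129427701462839846040963789723784, 85, 833183009751268218271681569034130300780063001531030100610857038776932232, 83, 2707572507288134479396388765897630089012021640⟩,
   ⟨[34681, 35192, 43162, 47274], 3080226681, 86, 693474642473899681948276296920414209801440569736, 100, 70254487675595025518560261236642083335068649452790792726960904072, 83, 2707572507288134479396388765897630089012021640⟩,
   ⟨[35192, 9996153, 46760], 2559015801, 83, 63080565641988987028498295062094707574748412625000328, 85, 12812171026270869922258463606187569678707221509980821510927751288712, 69, 177443471837635181240290983625330886217908908165512⟩,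
   ⟨[35192, 3063449465], 2559015801, 84, 2981617666566104850596177273533511023736226913029659793288, 85, 3276836267642071172619673163474323816763942275313521793029819901384584, 69, 177443471837635181240290983625330886217908908165512⟩,
   ⟨[34681, 35192, 13088424], 3063384440, 99, 16148623251461887685482610134008993165871773879039997832, 115, 49560326104238834417201449887693482019758924103315485144852830344, 83, 2685271740738268255169408888679918022605379720⟩,
   ⟨[35192, 3080226681], 2559015801, 83, 11658587970860682817526016015379041352846557230609700744, 85, 838870084929353297565196830663711154823248011328467747260703208559318920, 69, 177443471837635181240290983625330886217908908165512⟩,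
   ⟨[34681, 2844494200, 43658], 2542368886, 103, 837980380285543018762781838502682942101362563669768019658151953006434952, 101, 898514238377574334773512782650552753509096712517617687936297351702855248847134365832, 52, 173156063140394928166243378428982357709674618919048⟩,
   ⟨[34681, 861839788408], 2795014006, 100, 12701049451549456795749400453389488661761297867654643034177196890248, 100, 234293008700261990947251926717997054474604567662279069393879424734116796741755973572488, 82, 2640517805508835235262278687866477517583460247⟩,
   ⟨[34681, 35192, 12105368, 50856], 2777053287, 101, 17755292528299971782342186029781685128725652041440077577456615667592, 101, 201473421191392385076527467541586047175222561250824075553917503822427458940485984815223, 66, 2304672356016678953553865963493385986236647287⟩,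
   ⟨[34681, 35192, 13019030], 2778171768, 99, 11539162626545605220126849045376392319080457968838809480, 99, 193595023851043310700217096758967489466193389030859664477558920, 83, 2691825639018313508213589999404799651974060168⟩,
   ⟨[34681, 43162, 11110776], 3080226681, 84, 3787614540090591388782555273869667640262432151910397548936, 117, 212860927307179397356345129899722064625062245284380221796884548589245273992, 83, 2707572507288134479396388765897630089012021640⟩,
   ⟨[34681, 35192, 12167065], 2542368886, 118, 49970114260005916079520388273770016702123347530180639430221011080, 100, 76359442555507186992405381485106344770271238859156017190661652237173661407934970855987336, 52, 173156063140394928166243378428982357709674618919048⟩,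
   ⟨[34681, 35192, 12101526], 2543159672, 83, 45074854011424656649586703936431445277909907404265352, 101, 3247781056661389515792789309189756020437143554912402622179444376770696, 67, 176331582912699951376972485421210481437079970093192⟩,
   ⟨[34681, 35192, 12039575, 50854], 2777118312, 101, 17544224297775698474818921034262062800691175977718740964146753812104, 99, 10994627374673314957698315776740338148701856916058190084426877666935, 98, 152861938759712074132096587545825954621069382285431⟩,
   ⟨[34681, 35192, 12101272], 2593687417, 99, 957071951281472628046397787835881192782671900321859127187336, 101, 3273374029348041096633767940737641339386985727542408988285281348589448, 69, 177798814612067903450035191289487879019394917435784⟩,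
   ⟨[34681, 3063384440], 2543159672, 115, 11539162626545604881178925253379422529258542333375781000, 83, 193494220976760549782104330469052680728485953588553171123804296, 67, 176331582912699951376972485421210481437079970093192⟩,
   ⟨[34681, 35192, 39062, 12953766], 2491840615, 116, 49560326104238834417200128152326512838480273140635943010451298184, 99, 183113075931600264885185365876263010636041666116438595472540835091708348535, 66, 2311226254296724206598047074218267615605327735⟩,
   ⟨[34681, 35192, 47001, 12105368], 3063449465, 115, 49611955345983843804422915941100512949100907787213705462222923912, 115, 831487897763336269120051766904131903933980244629650832830090969300309896, 115, 177804900036826150602772808690850518156530631018888⟩,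
   ⟨[34681, 35192, 47017, 47257], 2778171768, 115, 193595023844711006275379860688925481263237206052881829056784520, 115, 3247985531567396257624037324537469368460997759216437821426648148908168, 83, 2691825639018313508213589999404799651974060168⟩,
   ⟨[35192, 9078649, 13019287], 2863175561, 100, 243712262574781719034420307955851484036466171294479745307613320, 117, 3600724841562080111380236988540456084725294685263634802976749721115629890100107400, 85, 201274542872881151893024575896569821170417269184920⟩,
   ⟨[34681, 35192, 11118486, 51129], 2778171768, 100, 76298182053909677309578064919234550137126008604252155622372972424, 115, 212859979803794174703871818414037238310657146214131919982902409997448550536, 83, 2691825639018313508213589999404799651974060168⟩,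
   ⟨[34681, 35192, 42905, 47514], 2542368886, 100, 970068956566407265834867840562933989321936663112651528247432, 100, 58984363754447471317185379773438262256676133528708002121822874353569870977109274967709832, 52, 173156063140394928166243378428982357709674618919048⟩,
   ⟨[34681, 35192, 47258, 12171161], 2845345657, 116, 69869261324163646219025934357293131882122067338893576757372396672832953166216, 117, 13950053718172962176755072578028118436239609393406529873800038516065691687753608, 68, 2707572507288134479374344721393193184394709384⟩,
   ⟨[34681, 3080161656], 2543159672, 85, 2956808894024716540690989103704857923136864995415473756296, 115, 212859979797210543210401164397306477195437256283470151555239186434047318152, 67, 176331582912699951376972485421210481437079970093192⟩,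
   ⟨[34681, 35192, 11118486, 50872], 2778171768, 99, 296621143848108121943343817982441727925564680599500450310952840, 115, 831484296108570994936999290812250441058800156757005988694994538910357640, 83, 2691825639018313508213589999404799651974060168⟩,
   ⟨[34681, 35192, 11905175], 2543159672, 101, 950819370228869004716114876305514486606998515708454431594632, 115, 831484296082853684415629548426989057648833965093513718468129993873004680, 67, 176331582912699951376972485421210481437079970093192⟩,
   ⟨[34681, 10979704, 12036761], 2559936377, 101, 50018310899875287939593945826816532634705993452875387128739567752, 117, 922170800150045374314898876119444950188540521252337047766368725195084575591001134984, 67, 2712727121773619497548612552657882438159534472⟩,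
   ⟨[34681, 11110776, 13084823], 2256038503, 116, 3251461743417247396031504337687900715229414008239384848387966286534792, 101, 182692394181309011522204002262991582349298099323071393378671234069963507831, 36, 2308602638548959587466277155908665620923189111⟩,
   ⟨[34681, 35192, 47001, 47274, 47514], 2845345657, 116, 831484296115419314967202280995100685298561540155407145690552868031474056, 117, 13950053718172962176755072578028118436239609393406529873800038516065691687753608, 68, 2707572507288134479374344721393193184394709384⟩,
   ⟨[34681, 35192, 12171161, 51113], 2777053287, 101, 5027422306528742406501470791923283909615280829869131976392563295231893347349608584, 101, 784657874527538611789113889704624179078306657064403418655431482005188294410642163831, 66, 2304672356016678953553865963493385986236647287⟩,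
   ⟨[34681, 35192, 11052439], 2778171768, 101, 756230855207987774785135180832742668919639011218407729633416, 99, 193595023844682947255627909673353805307038395305676303419152520, 83, 2691825639018313508213589999404799651974060168⟩,
   ⟨[34681, 35192, 3115755671], 2543159672, 101, 762483443001044112650556174212285226575048391050634281326728, 101, 54488724308292030200260862481415948180143092676004165844986122080045529405576, 67, 176331582912699951376972485421210481437079970093192⟩,
   ⟨[34681, 35192, 12036504], 2778171768, 99, 45074854009943769078180719254452017327614015403763848, 99, 756230561893292762717296522160192059188983532666389203036296, 83, 2691825639018313508213589999404799651974060168⟩,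
   ⟨[34681, 35192, 43162, 43402], 3080226681, 102, 45447554166463250715773746306061455126478245364013448, 116, 831486311884118537361471499446604404233407457174583358567159748250670984, 83, 2707572507288134479396388765897630089012021640⟩,
   ⟨[34681, 35192, 42902, 50615], 2593622392, 99, 45074854011685719789955435220894644647798109455816584, 100, 49532907796071507972493947270523630436970864955110613353059948680, 68, 2689202023270548889041997488638539836404897928⟩,
   ⟨[34681, 35192, 46742, 12039575], 2543159672, 115, 12687443482685141610802902061418399555112045343125688438697388123784, 115, 13949991635989990159836850709942055652228667138822684118321528383438744461940872, 67, 176331582912699951376972485421210481437079970093192⟩,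
   ⟨[34681, 35192, 47000, 47257], 2778171768, 99, 57420072370054672719966349570268495450806285735929992, 99, 63134037238614535440445130496968758243110300643410465503723497608, 83, 2691825639018313508213589999404799651974060168⟩,
   ⟨[34681, 11110776, 3098974872], 2307291242, 116, 213075309228652988091254606420887354934445308250580562473372980605193066888, 102, 48215101564429071510938215972788811087192263725093316133449777862842113366408, 52, 2376904135254570113770192324552118876657711737⟩,
   ⟨[34681, 35192, 12032150], 2256828519, 83, 3689528440077089047357727815962102239757647288165175105416, 83, 1038054357447341181650999867061860745373372852043575303544819493417486455, 50, 151388621635585874906296264276185917901618721359735⟩,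
   ⟨[34681, 35192, 11118232], 3063384440, 102, 11634573866859976559806974040157167311334241053358659464, 115, 49560326104238834416910140576108618541614708114048387443218491272, 83, 2685271740738268255169408888679918022605379720⟩,
   ⟨[34681, 10979704, 13154201], 2559936377, 117, 12804687590368073712530681047649044506894203685253858196155391318152, 101, 837953103987404548091686842139100759436747211693674398256968835978925960, 67, 2712727121773619497548612552657882438159534472⟩,
   ⟨[34681, 47029, 3316091256], 3131676810, 101, 833110351681334514159276945290713498403166305559562868802071097287022728, 117, 3570967207634603850399708978334682643417952803607329984074588492388099202303564168, 85, 3088171892009723780989887646579725220763441817⟩,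
   ⟨[35192, 10979193, 12036761], 2543159672, 101, 12786660588989533740267717081117597709289179476905679462822204446600, 101, 3570973036269821674559303955295459395691955853946381512435948791105981806484691080, 67, 176331582912699951376972485421210481437079970093192⟩,
   ⟨[35192, 3097986937], 2543159672, 117, 2981340887468361681731393276214775024895016719935027582856, 101, 212846579329360823314151509482481703347870716564889476977966170913718704264, 67, 176331582912699951376972485421210481437079970093192⟩,
   ⟨[34681, 35192, 11184266, 47258], 3080226681, 116, 3733370299976456526709490156166993781670595483578305510670653887981960, 117, 3571206490007315889444152750353503584638759757505506933462941375603538139780978568, 83, 2707572507288134479396388765897630089012021640⟩,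
   ⟨[34681, 35192, 46760, 50872], 2593687417, 99, 45074854009943815834201877934231445416314896734730120, 100, 3276730030958043760249846848904591017829596854519042917341764403042184, 69, 177798814612067903450035191289487879019394917435784⟩,
   ⟨[34681, 10127736, 42902], 2543159672, 86, 45447554166469008916218287469410472705772806775281544, 85, 831807723294515710557845958695203602550079730537832943975600818382018696, 67, 176331582912699951376972485421210481437079970093192⟩,
   ⟨[34681, 35192, 11966871], 2256828519, 115, 2954025632395674849902065409313066086174785834969194797192, 84, 46856056306180679686953814264774400042939781123172157632500781194085523818615, 50, 151388621635585874906296264276185917901618721359735⟩,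
   ⟨[34681, 35192, 12102297], 2543159672, 102, 2978450909853334118335058373624912578313864506109790366088, 101, 3247781056659938704982840818925192143133023855706753415228038780065928, 67, 176331582912699951376972485421210481437079970093192⟩,
   ⟨[34681, 10979704, 50615, 50869], 3080226681, 115, 193795944923859983254436390512576790261294353403298691916667016, 115, 831487897735911220785935928144678433462254120327695461242425022055094152, 83, 2707572507288134479396388765897630089012021640⟩,
   ⟨[34681, 3097987448], 2559936377, 85, 2953828415834072009570136246824916506875201555428807317640, 115, 831484296113386414603534997012327980913705297557513315581489642988803976, 67, 2712727121773619497548612552657882438159534472⟩,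
   ⟨[34681, 35192, 47001, 12097686], 2256037718, 117, 12687443482685141610734794623629023922202596266779177788507255510920, 85, 152988252256169238084505664369116180672642700519176456679593719782455085175, 50, 1924095434268196549868315534574181919712905079⟩,
   ⟨[34681, 9931128, 47014], 2543159672, 85, 62327886612073890680831367169518135053458613069125768, 99, 3247985531573647204748552923542905823593779372948818192252860323305608, 67, 176331582912699951376972485421210481437079970093192⟩,
   ⟨[34681, 35192, 10852759, 46742], 2256037718, 115, 12687443482685142357625154069540641770891518231140061597044364974216, 84, 10026234351346360190027374629051402345560400002894129884788875541053354966288503, 50, 1924095434268196549868315534574181919712905079⟩,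
   ⟨[34681, 35192, 43159, 12105366], 2491840615, 85, 61998316073595026795494668477340893640976543615088509489099806856, 99, 46774581867536463777986522196151782949738000423402139458964688128091901954167, 66, 2311226254296724206598047074218267615605327735⟩,
   ⟨[34681, 3316091256, 50869], 3131676810, 101, 19111210868889309417124279529675304823424096770088518411061227329672, 117, 914167605267427210180469778262936548618141275821089566484480423794356825172706236808, 85, 3088171892009723780989887646579725220763441817⟩,
   ⟨[34681, 10918552, 11110776], 3063384440, 102, 195195761408268393622926006125912539671350355102853977123428232, 116, 212859979796800899624805750318290445589072624857934808498379425774590990728, 83, 2685271740738268255169408888679918022605379720⟩,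
   ⟨[35192, 853249853305], 2777053287, 102, 12791908835737416698369232687464150144054400587953055458213515270024, 101, 784747237443002385051000217284657058125766017752865865087795492546971162077736437879, 66, 2304672356016678953553865963493385986236647287⟩,
   ⟨[34681, 35192, 39050, 13084826], 3063384440, 102, 762486204232088054393837083813746580793359554864159033760136, 117, 838362366574624955064333178652322372092977651970897994389656735197010312, 83, 2685271740738268255169408888679918022605379720⟩,
   ⟨[34681, 35192, 3350632598], 2778171768, 115, 12687443482685141610803571171249530120455229672616798781595921586056, 115, 212859979796800881139664594679912694258733067838211652515395328435489842824, 83, 2691825639018313508213589999404799651974060168⟩,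
   ⟨[34681, 35192, 11118486, 50597], 2256828519, 117, 1142819341091046316925067880268315430247755359840843458653461375696279432, 100, 201351885316364730962786517397766470559678249954940806212998315617559269436870484265079, 50, 151388621635585874906296264276185917901618721359735⟩,
   ⟨[34681, 35192, 42905, 12105370], 3063383672, 116, 12687443483204939028659176195125503379583851797827097903738818959496, 116, 54493935503911799979937823811788061982972024745160007679307677330497908283528, 82, 2685184308186864520477827417357245851578566791⟩,
   ⟨[34681, 35192, 11970968, 47001], 2559015275, 115, 193790447982456345965443742211472556825525057414364997364459656, 85, 12473757585807425388533619330810674594139724951886457143393718143355347486087048, 53, 2399292334355840072688753155574847280636201352⟩,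
   ⟨[34681, 35192, 47274, 12171161], 2845345657, 116, 54549047755158171136793548119200944140814646137937611668071387064336451676552, 117, 13950053718172962176755072578028118436239609393406529873800038516065691687753608, 68, 2707572507288134479374344721393193184394709384⟩,
   ⟨[34681, 2593622392], 2543159672, 86, 11539142004731855893829462033143026109271850996257626248, 85, 12686644752577885566339221948963760496850908584005808532430320670856, 67, 176331582912699951376972485421210481437079970093192⟩,
   ⟨[34681, 10979704, 12098457], 2256037718, 87, 3247979727042851524753426862852406527448645433156104100456605640333448, 85, 1163618756350143155866332675125890932450378777505659175394118502915152726918728026231, 50, 1924095434268196549868315534574181919712905079⟩,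
   ⟨[9799545, 10979704], 2845345657, 99, 2954025632395988280625975459370325840792237432641643059336, 99, 837954782786092252483088379582856632440877307561010640842899581914486664, 68, 2707572507288134479374344721393193184394709384⟩,
   ⟨[34681, 35192, 42902, 43658, 12163993], 3620322218, 118, 838359400483198730463307241821746446840137319517848669822154189961729928, 118, 235977194456237942112171481636087486090179032283869959469987965491021671214913204819848, 133, 3811235594081811454141657426424011523646802618⟩,
   ⟨[34681, 35192, 12102282, 47528], 3080226681, 100, 56966709899543098561549101850852427167509926632915131786466077064, 85, 244988581806591772516691903723371070103348735347762162105360334418891741064, 83, 2707572507288134479396388765897630089012021640⟩,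
   ⟨[34681, 35192, 3316230038], 2256828519, 99, 4056784320272238330646584459396704705244397355765136119577543481792392, 100, 51462099355670574624033880314607100377145265973349662408847917641897904912098674804754551, 50, 151388621635585874906296264276185917901618721359735⟩,
   ⟨[34681, 35192, 11184266, 47514], 3080226681, 116, 14583477734283033231756565979881065903895837188266950718412595767688, 117, 914228861441872867697703104090477583463470234082112709696576788108375266864172341128, 83, 2707572507288134479396388765897630089012021640⟩,
   ⟨[34681, 35192, 47017, 51129], 2778171768, 102, 45447554166463270722014405799333462232581438198823048, 115, 3247985531567396257624276656223813501729920792907491518968581316974728, 83, 2691825639018313508213589999404799651974060168⟩,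
   ⟨[34681, 9931128, 43402], 2543159672, 84, 51810920831069869164570308489945116338684610230196360, 101, 49557206064757365493512585737994608101606376280144578374062938248, 67, 176331582912699951376972485421210481437079970093192⟩,
   ⟨[34681, 39818, 10979704, 47257], 3080226681, 86, 49560237534223198314719037824291507553624756488830876433424881800, 117, 244656379235498290924531758337559858262585625745744038219819300608860002184, 83, 2707572507288134479396388765897630089012021640⟩,
   ⟨[34681, 35192, 42374, 42645], 3063384440, 99, 45074854009943789160970684198396754710892830554297992, 115, 12687443482685141631344497478810813450565311109649785259884667246216, 83, 2685271740738268255169408888679918022605379720⟩,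
   ⟨[35192, 10979193, 12167306], 2543159672, 101, 50018310899875287598374179309925330677038929617053556517096691592, 101, 3570973036269821649972689179901336531476695598569772611596064572026389084140837000, 67, 176331582912699951376972485421210481437079970093192⟩,
   ⟨[35192, 3047655289], 2593622392, 83, 2984502365424611526521865643104520663011126812606792767368, 85, 3279591973152837225733555062349917138355733320339728837085997347477640, 68, 2689202023270548889041997488638539836404897928⟩,
   ⟨[34681, 35192, 12097943], 2256828519, 118, 2978450909916153998970302966991818569483534157570644678792, 84, 68543779913850368687284402816856664469720199054589307289823858474424624253047, 50, 151388621635585874906296264276185917901618721359735⟩,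
   ⟨[34681, 10918026, 11110776], 3063384440, 102, 49947604939341806877081928121404957360950776880862170822131423112, 116, 54492154827981007806817652455618491435960617081606620584703019703883019032968, 83, 2685271740738268255169408888679918022605379720⟩,
   ⟨[34681, 11110776, 12032138], 3080226681, 116, 955692477679626496926622960093494167363339284171438643993223705532078472, 116, 838413122556326217759340070133696941433633811092788019191677822923544456, 83, 2707572507288134479396388765897630089012021640⟩,
   ⟨[35192, 10979193, 47274, 47528], 2778171768, 85, 70205062461483183416194539978017221436764032047572054421844563848, 85, 1177845497207906034776124540062637184511211971248540728147044374223100040, 83, 2691825639018313508213589999404799651974060168⟩,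
   ⟨[35192, 47286, 3349645177], 2777053287, 101, 840035562017990447685585633526854290810697295817545280938827694007162760, 101, 3065418896261735982281039216262203865939929656123381699340128617030572965772101751, 66, 2304672356016678953553865963493385986236647287⟩,
   ⟨[34681, 35192, 39050, 13150362], 2559015275, 102, 763316935414451404334089093531406148550554526835151469123976, 101, 11332062256015302118923179147107950512138850413932752521917417159546, 53, 2399292334355840072688753155574847280636201352⟩,
   ⟨[34681, 35192, 39319, 13084838], 2324134248, 115, 193595023844707906293107781747906891320177331537499657173702792, 100, 11016001245116581571454435977532941366053265367201073137309922597000, 52, 2330990837650229546345015911992392037469620344⟩,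
   ⟨[34681, 35192, 3334056087], 2543159672, 100, 243410127826807557194871262887335448261321549609944642461603976, 101, 914582243003411378086107482409931746173850985608551514893706260788783057400227272840, 67, 176331582912699951376972485421210481437079970093192⟩,
   ⟨[34681, 35192, 13019287, 51113], 2542369656, 116, 69770905199701955541106832344022160466066557935770438952238422152, 101, 3246189464786124309230261784264123458237462650462881061213824249075848, 53, 2689202023270548889081820081095197657291921544⟩,
   ⟨[34681, 35192, 13019033], 2778171768, 102, 45447554167682781356977648949037853947542333758675080, 99, 63134037238614535440445130496968758227944250404090702340161050760, 83, 2691825639018313508213589999404799651974060168⟩,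
   ⟨[34681, 35192, 51113, 13153960], 2777053287, 101, 1279909448140068686648477231750352047491757161577280451820589119516180031278589393032, 101, 786997916485654532973851571128875811561618879510109338678293906007200620279221487735, 66, 2304672356016678953553865963493385986236647287⟩,
   ⟨[34681, 10979704, 47543, 13150888], 3401165708, 118, 214827009540833348201096432409129168882300276796822402318482034688278435976, 118, 236204794950389583825911601026995856428936475522138287818786911588439149720728533244040, 103, 3139589621043748338005501258486134569966353338⟩,
   ⟨[2593687417], 2559015275, 69, 177798814612067903450035191289487879019394917435784, 69, 2639882451397038731383095185586333361111941378320767617416, 53, 2399292334355840072688753155574847280636201352⟩,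
   ⟨[35192, 728661460857], 2778171768, 85, 12818775718080783578562797620063437854912139971008124094200602466184, 85, 215063369077723993017937231335858578673225263445494029679062657601523718280, 83, 2691825639018313508213589999404799651974060168⟩,
   ⟨[34681, 35192, 39818, 11184267], 3080226681, 102, 49970114259916847911235840769940965167195527044340947398758603400, 85, 246549190018419579536919399965009534209692349440084638655672597404968458120, 83, 2707572507288134479396388765897630089012021640⟩,
   ⟨[34681, 35192, 43403, 11184266], 3080226681, 102, 49970114259910510834785496387131518870425063379530566195375348360, 117, 3571206490007315889444152754849221463724163569677270828957335990952053955532330888, 83, 2707572507288134479396388765897630089012021640⟩,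
   ⟨[34681, 35192, 3064502935], 2543159672, 86, 950819370228869004715775850534166998264640633413066664024200, 85, 831807704347203414805433095697529184026374306339153162117249723809765512, 67, 176331582912699951376972485421210481437079970093192⟩,
   ⟨[34681, 35192, 3097992089], 2542368871, 102, 12792349250831323530668848808826636472218242365320300251518249506952, 101, 183044948227747447619424892405873007259601623353270467334136409289577240712, 67, 2304694818989785851483858459760713956081637512⟩,
   ⟨[34681, 35192, 42905, 51126], 2543159672, 101, 45447554767204541369251038303642798193643006668085384, 115, 54492154828085899061862698085710458162031786707440928186451350759378854123656, 67, 176331582912699951376972485421210481437079970093192⟩,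
   ⟨[34681, 35192, 47014, 50869], 2543159672, 99, 45074854009943769228754699058759772296625831937422984, 99, 3247985531573647204748552923542905823593779683571898803906308150368392, 67, 176331582912699951376972485421210481437079970093192⟩,
   ⟨[34681, 35192, 47017, 12097686], 2256037718, 84, 4572091429154962351282679494340748863635288422094945561084163168704392, 85, 10026266376342582273214952594315090891363478001296116188353263192993566685628535, 50, 1924095434268196549868315534574181919712905079⟩,
   ⟨[34681, 39818, 2844494200], 2542368871, 103, 3273360860490402417042116155336394739684694805303281511990381864655496, 101, 3065072444268984593674822585701046431723161194336171216137811505225524830608660616, 67, 2304694818989785851483858459760713956081637512⟩,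
   ⟨[34681, 2845280632], 2543159672, 84, 2954116530323754139878273054753800691328865761160477644936, 99, 212749145871407036758302214508686746580390637792332793164614257194701527176, 67, 176331582912699951376972485421210481437079970093192⟩,
   ⟨[34681, 35192, 39062, 12105127], 2778171768, 117, 3247986791344418770668570346777606308863355473053776124545613171169160, 115, 54492154827981025571041515775331653779321190488715797689837739817840745555592, 83, 2691825639018313508213589999404799651974060168⟩,
   ⟨[34681, 35192, 43673, 12167319], 2542368886, 118, 2978450909853334118334798069333605213425903166162827974792, 84, 13732915065613399629507786666865329895580534618783032051823481804976766293874824, 52, 173156063140394928166243378428982357709674618919048⟩,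
   ⟨[34681, 35192, 46757, 12039575], 2543159672, 115, 12687443482685141632639791759819585735303820675702964025353411470984, 115, 13949991635989990159836850709942055652233771374326498195273478999169222729701512, 67, 176331582912699951376972485421210481437079970093192⟩,
   ⟨[34681, 11110776, 12032664], 2559015801, 84, 245326243877981656995665284798759598249514706008307376203536776, 85, 839308079185668484451762217812315226128613082176910575588175336022054792, 69, 177443471837635181240290983625330886217908908165512⟩,
   ⟨[35192, 10848121, 42645], 3063384440, 99, 2954025632395674854364439539697222878361437201759158638216, 115, 831484296082854101355811263399978084916348698524737426545147902734931592, 83, 2685271740738268255169408888679918022605379720⟩,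
   ⟨[34681, 35192, 43658, 3115817355], 2307291239, 101, 4138356114489471911327358076139331632036907516283266210872596339811456626056600200, 101, 4138356079117942169617816746464310174525628807574883364555197806795772874871965815, 51, 2308602638548959587426454563452007800036165495⟩,
   ⟨[35192, 47001, 3097003897], 2559015275, 115, 12687498439984422972502199014637236629293660057223603699131729090440, 85, 190113608685339997599955338631520592555424244911144251626011514536305661832, 53, 2399292334355840072688753155574847280636201352⟩,
   ⟨[10127736, 10979193], 2543159672, 85, 2978348367786364792466450988822441987838023929784159475592, 85, 212942858043234510913327574811523372952225019781548908751298347699071981704, 67, 176331582912699951376972485421210481437079970093192⟩,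
   ⟨[34681, 35192, 3064502150], 3063384440, 83, 55371020420242094783151257443334612394794940718111925036862904456, 99, 193595023838693827034757778261594129876001835812617469533198472, 83, 2685271740738268255169408888679918022605379720⟩,
   ⟨[34681, 35192, 39050, 12232858], 3063384440, 116, 4166414443317563658977535511699243127672176264822728850715241666419080, 116, 273050136957259851954746177137619426148373869845121161855691306856962693512, 83, 2685271740738268255169408888679918022605379720⟩,
   ⟨[34681, 35192, 39818, 12101529], 2542368886, 102, 195195761408248092832004739534271574191358171802016906085963912, 86, 1164557902877880930172833635803780547109565384409106617998184533156541539991308245128, 52, 173156063140394928166243378428982357709674618919048⟩,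
   ⟨[34681, 35192, 43402, 13084566], 2845345657, 100, 222526210545090325804276922366940952441431009337119335220025224, 100, 12819088585770248482349722149141756230792137338204980241377544214408, 68, 2707572507288134479374344721393193184394709384⟩,
   ⟨[34681, 35192, 3064502165], 2543159672, 100, 193595023844682947009445213328681243055600746028434182849927304, 99, 12687443482709559393549167275068322683778962657450871285716790909064, 67, 176331582912699951376972485421210481437079970093192⟩,
   ⟨[34681, 35192, 39319, 12170920], 2256037718, 118, 49970114261059857530254759783896574661436234442074545820975732872, 85, 21479214455222961582099440183688113123881068290200775689487726454441353564332395342784399479, 50, 1924095434268196549868315534574181919712905079⟩,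
   ⟨[34681, 35192, 47257, 47514], 2542368886, 100, 970068956566407265834914441102726046901029324299553567582600, 100, 58984363754447471317185379773438262256676133528708002122209432546727929836886755140737160, 52, 173156063140394928166243378428982357709674618919048⟩,
   ⟨[34681, 35192, 12105368, 51112], 2777053287, 100, 17755240904210740834049974949211153607950435231023217829820901078920, 101, 787003706093547427744229193693368821648582835582061150791625288914506686388258703479, 66, 2304672356016678953553865963493385986236647287⟩,
   ⟨[34681, 35192, 47017, 12105368], 3063449465, 115, 17847389247332148395752569594481403574842372030480013507440778127496, 115, 831487897763336269120051766904131903933980244629650832830090969300309896, 115, 177804900036826150602772808690850518156530631018888⟩,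
   ⟨[34681, 35192, 13154217], 2778171768, 118, 11634573866614586692275419547565791189549222166441605256, 115, 3247985531567396257624276656227852697907655564065323037414769860057224, 83, 2691825639018313508213589999404799651974060168⟩,
   ⟨[34681, 10979704, 12097931], 2256037718, 117, 195384026952637842203449883206119953433747884293970446640519304, 85, 16134323902992990071112042093345956668704955470885854335644044366645372089043063, 50, 1924095434268196549868315534574181919712905079⟩,
   ⟨[34681, 47286, 857511135608], 2239195494, 101, 212742653373951081028669813513540000166462484040843626460671252574636578952, 100, 13036560351696058165871092212919003527872270114760997304219113117399689933915090276789552758, 35, 2286214439447689628547715807368281383489734262⟩,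
   ⟨[34681, 39818, 10979704, 12032395], 2256037718, 87, 831482810122969990320414756596591626798030861084297756907292253841168520, 85, 270687703209608425862542409808744492979580530224828795999132756463589840452798383687799, 50, 1924095434268196549868315534574181919712905079⟩,
   ⟨[34681, 50872, 857511135608], 2239195494, 101, 831025989741996410268241031288050775756968282859008272166476406979008648, 100, 777039548855384719128431935278192989181915672863241750525579616850812087304016397942, 35, 2286214439447689628547715807368281383489734262⟩,
   ⟨[34681, 10979704, 43658, 12032395], 2256037722, 117, 838362348860882801544339820464014553689826523075988533665097462627080328, 85, 4138356056044998052281178246220997558295174684719230353733336470087213750632876151, 52, 132314950634880659206401881890139546837257258829687⟩,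
   ⟨[35192, 9078649, 13084823], 3063384440, 100, 763248063615672215803412293940468971827491314017710658525320, 116, 3275051203415110340837397694013696543177843658910511140638786252806280, 83, 2685271740738268255169408888679918022605379720⟩,
   ⟨[35192, 10061689, 13084823], 3114833801, 117, 3274848015746953373122877383783202525092947072191934934203002622810248, 117, 3571206489757420753962098199619485395244676773530982881006554637644293729528813704, 84, 3065783692908453822071326298039340983329986968⟩,
   ⟨[35192, 857510348665], 2777053287, 101, 12811317615765782728537055746195364340235044764413284898961461122952, 101, 11974292563522375258345605621113695681930166066813022847544420117474141686696055, 66, 2304672356016678953553865963493385986236647287⟩,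
   ⟨[35192, 861839787897], 2542368886, 100, 3283398107462057889245982209170448680900536264986028598044483877640072, 100, 15505409172596447708198082016173538303538052837673083730000359139741863086975829563046140040, 52, 173156063140394928166243378428982357709674618919048⟩,
   ⟨[34681, 35192, 39050, 12168090], 2543159672, 101, 762483443000969112184633392966574785573998205323210982599304, 101, 212846579329265742973772605071936991605482515705154142425295176638435863176, 67, 176331582912699951376972485421210481437079970093192⟩,
   ⟨[34681, 35192, 43159, 46486], 2543159672, 115, 2954025632395674849623170996598599893937122318670331615368, 115, 831484296082853684415629548426973383614685279956923133280241220272625800, 67, 176331582912699951376972485421210481437079970093192⟩,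
   ⟨[34681, 35192, 3332938391], 2543159672, 100, 62313105734661720225277576663853775907400922371880186180710013064, 101, 13955417526297170686128349020066174294984136670179572338880881418643371409905800, 67, 176331582912699951376972485421210481437079970093192⟩,
   ⟨[34681, 35192, 12167319, 50854], 2777118312, 101, 1150154038221272608987909420055007501476939794624862427868497685560924296, 99, 184460156206415619260537430991704577389008477121284426858050104966456575607, 98, 152861938759712074132096587545825954621069382285431⟩,
   ⟨[34681, 35192, 3097994649], 2559015286, 99, 16162313533085321072753953407224002110072462660894263355015822874760, 84, 271283343496828135540804947393342739122977592809862570481855935645145798536, 67, 2641714895784518939339611325123675820760992136⟩,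
   ⟨[34681, 35192, 47258, 12167306], 3080226681, 118, 195195758828148293512139274457805141573267393283623328113338760, 117, 3571206490006855773485545609462265724485134615847687601644531182916821751268087688, 83, 2707572507288134479396388765897630089012021640⟩,
   ⟨[34681, 10979704, 43673, 47514], 2559936377, 118, 49970114260005914618041051688065629121580050532170304350656764040, 117, 922170800150045374314898875313442114012471407201206813480944241842539497359715964808, 67, 2712727121773619497548612552657882438159534472⟩,
   ⟨[35192, 10848121, 42630], 3063384440, 99, 2954025632395674854364439539697222878361437201759158638216, 115, 3247985531573648738015858022796420488027897862197956575039004161382024, 83, 2685271740738268255169408888679918022605379720⟩,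
   ⟨[34681, 10979704, 51129, 13150888], 3401165708, 118, 214827009540833360362981044720823148814142284261676083516795708337345304712, 118, 922674980275358049523273088609955600011186730808449098139302886997422907510740261000, 103, 3139589621043748338005501258486134569966353338⟩,
   ⟨[35192, 2778236793], 2559015258, 85, 2978348367786364792466450642664370099636669500574773188488, 85, 9514959004398637703571452876310551081247070130128828967543780054920, 53, 2020179665980250392077433831466922698293610888⟩,
   ⟨[34681, 35192, 39062, 13084838], 2307291239, 99, 267715064303880424917478777615495832971371339483053137852864392, 100, 17544947124183642291279305295131681702170129452036490080100973774967, 51, 2308602638548959587426454563452007800036165495⟩,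
   ⟨[34681, 35192, 11901335, 46742], 2491840615, 115, 12687443482685142357544914686817358652736227550836114738874329503880, 99, 46774581548846577277818559836961535463118380311753804744883636869220288465015, 66, 2311226254296724206598047074218267615605327735⟩,
   ⟨[34681, 35192, 46760, 47000], 2559015801, 115, 11539162626991533717807204433308198349138678335667677064, 85, 840086620845232986197139686997111044700093036635133408482707349931792264, 69, 177443471837635181240290983625330886217908908165512⟩,
   ⟨[34681, 35192, 11904921], 2778171768, 83, 14699538526733996216312011456540901058722975128536782984, 115, 193595023844682947255627909450633862866274035351214054737090696, 83, 2691825639018313508213589999404799651974060168⟩,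
   ⟨[34681, 35192, 11114646, 47001], 2256037718, 115, 12687443483101974408798845512848573039374921319766285880249371105160, 85, 39170272440601951646473540268843389857453304994590393756461068084128398149751, 50, 1924095434268196549868315534574181919712905079⟩,
   ⟨[34681, 35192, 11114646, 47257], 2256037718, 84, 16169747523477511429784216915353391245348535070371319798270265956232, 85, 153008875033612276572085163416814769352704090789762286381216927695899166839, 50, 1924095434268196549868315534574181919712905079⟩,
   ⟨[34681, 35192, 12039575, 50598], 2777053287, 101, 68532031635887267024747971815280253951384007973051842899674117768, 101, 46769252910439377920608123508657739390867516258983414462923073170353096657015, 66, 2304672356016678953553865963493385986236647287⟩,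
   ⟨[34681, 9931128, 11970714], 2778171768, 86, 193594677868059368411655033165379990479196796945883012164851848, 101, 3250940425409995420583869458218173065883876736410277359673830603856008, 83, 2691825639018313508213589999404799651974060168⟩,
   ⟨[34681, 2845542776, 43658], 2542368886, 85, 12694469046561466922238193300711351819945196054128912701043917822600, 101, 898514238377560827939809600772416004849391967526196081934705809798709982778149673096, 52, 173156063140394928166243378428982357709674618919048⟩,
   ⟨[34681, 35192, 11966614, 13023656], 2491840615, 116, 212859979796800880795039447110061922739763182991605774174817730410047772552, 100, 3069240487506844551328050467609621620401112884486213776873012425839124200832862327, 66, 2311226254296724206598047074218267615605327735⟩,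
   ⟨[34681, 11110776, 12098200, 51126], 2307291242, 101, 4112601094915771298904867542970710883589969069464559636473672752470408, 102, 188547318236535440226315224909015853220617395464627774749527332057220946312, 52, 2376904135254570113770192324552118876657711737⟩,
   ⟨[35192, 10979193, 43658, 12163993], 2324134251, 118, 214620006523698874998606599836160076662580027056152098781756229450089404296, 87, 12443763257397185234139799562142184681829236939407006331871055310384164613159802, 53, 2399292334355840072688753673092503114091166586⟩,
   ⟨[34681, 35192, 47001, 3350899111], 3063384440, 117, 3274852925237826114549254634621303733344779943205950645048443328309384, 117, 3600738946635177725467257242707466408563915085266921584219309353226113449386875016, 83, 2685271740738268255169408888679918022605379720⟩,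
   ⟨[34681, 35192, 12102282, 51386], 2542368871, 116, 955742796793972865862578325408875098004661073101819266017066798079916424, 101, 5533419262380698688745041795156495565081337403442486963944615732880811710215723144, 67, 2304694818989785851483858459760713956081637512⟩,
   ⟨[34681, 35192, 10983819, 43658], 2543159672, 102, 49970114260010382519912178583643393463489846753780183876826208392, 101, 3570973036268226491271465330270362109788286386146501089224288934984548056529803400, 67, 176331582912699951376972485421210481437079970093192⟩,
   ⟨[34681, 35192, 11905447, 47001], 2559015275, 115, 12700684672250209016565718747777007290755860422950585707846331574408, 85, 4968143456945028138701642322126728960287582263291638249191167565728818977837586312, 53, 2399292334355840072688753155574847280636201352⟩,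
   ⟨[34681, 43688, 3097135480], 2559015275, 118, 195195758828173053070437462127428919461428314038694993555204488, 102, 742541958583252430637494050829539727443785343220130925014820928258414472, 53, 2399292334355840072688753155574847280636201352⟩,
   ⟨[34681, 10979704, 47514, 47771], 2593687417, 101, 763218855283741572502063153598300459333250676666086994909320, 101, 275251822899105922335007141183369763842608849693496450431522169459281926024, 69, 177798814612067903450035191289487879019394917435784⟩,
   ⟨[34681, 35192, 46744, 51113, 13158056], 2777053287, 101, 327656818723857583782010171328090124157889833363783795666085631130168297087343386933384, 101, 786623566371841123987576232321931974840284937957490898711045550221321583152837724279, 66, 2304672356016678953553865963493385986236647287⟩,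
   ⟨[34681, 10979704, 43930, 12163993], 2610530426, 118, 54942721670171812914731267671956172441110365333806839045145515081869921261704, 117, 3630724102572139338793904081751852752411946012285673940793043346117366527658928792, 70, 179266047628368731477722027827430500403833814420105⟩,
   ⟨[11110776, 792833197945], 2559015275, 84, 50074867292057942016406452809014687288193007118090792199660345224, 85, 11325894846332832745640737051560100197942904583269892611350366550906, 53, 2399292334355840072688753155574847280636201352⟩,
   ⟨[34681, 10979704, 12163993, 47770], 2610530426, 118, 14065336747563984106284164592542037471709088933940387009178106956980488533350536, 117, 60907476864868717353112511351607241148801974668699012049515278099318015876589997590686360, 70, 179266047628368731477722027827430500403833814420105⟩,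
   ⟨[34681, 35192, 43402, 3098974872], 2508683638, 116, 62632248413719414583609988712666712682087796417072447114993476859870864513416, 116, 899079318780975660180053953579320045289663842824701310635996925514046880739432499334, 51, 2644425625068008971244697384014429182425011846⟩,
   ⟨[35192, 10979193, 13154201], 2542368886, 117, 12804761222236906610553161366166838356522547544024272000050420815752, 116, 15081584505825927862658223299124948908197450106421286292987397899272007269967890356592220296, 52, 173156063140394928166243378428982357709674618919048⟩,
   ⟨[35192, 2845345657, 47257], 2559015275, 84, 963376740456373291099887169889323189089735512401919951280008, 85, 2900890650075728739550682421000836399946411732546821747750179917305736, 53, 2399292334355840072688753155574847280636201352⟩,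
   ⟨[34681, 728660278136], 2559015275, 87, 12687420808761138748106741245989281044307855229496026356643456981128, 101, 189883660223665633871896883920211579639814318698197536167445751876509403258, 53, 2399292334355840072688753155574847280636201352⟩,
   ⟨[34681, 35192, 11114634, 46743], 2543159672, 101, 45447554767193955397838768710969851010307056167721352, 101, 12686644752577885566338641103997560758869313082042856866153341032840, 67, 176331582912699951376972485421210481437079970093192⟩,
   ⟨[34681, 35192, 10918552, 43402], 3063384440, 102, 195196445295211309633891075618389654834760457895542872711206792, 116, 54492154827981007819394938744403161854653735031978818261425180924484948302216, 83, 2685271740738268255169408888679918022605379720⟩,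
   ⟨[34681, 35192, 42902, 13085066], 2845345657, 101, 3738439717091146233046953080403831619808357746707202797177833134790536, 101, 12812971186521811836048016790585701222690552125714693962631090902920, 68, 2707572507288134479374344721393193184394709384⟩,
   ⟨[34681, 35192, 3384322698], 2542368871, 101, 244898426053382145349670345530851593494865276769913916332763420081790826888, 101, 62693997069658038855134546326512497124646225519983622911818615835684721236104, 67, 2304694818989785851483858459760713956081637512⟩,
   ⟨[34681, 35192, 3349649814], 2778171768, 115, 3247985531674105448599976626288690191145285510398316951882179957790600, 115, 212859979803794174703871818414037238350528772235831866951192083350535182472, 83, 2691825639018313508213589999404799651974060168⟩,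
   ⟨[34681, 35192, 46742, 12101541], 2543159672, 85, 68168864007023518653364345375089609919665561575882802208580281992, 85, 1143683743990551048942393722368015203931018324653296758509657435775867016, 67, 176331582912699951376972485421210481437079970093192⟩,
   ⟨[34681, 35192, 3081410967], 3063449465, 118, 3274841408212795553899614343919093479172434557481318393854989980637320, 117, 838362348885256392294693201165301296826938226958329193887178772139517832, 115, 177804900036826150602772808690850518156530631018888⟩,
   ⟨[34681, 35192, 42648, 47257], 2845345657, 118, 11634573866859976559806629159692677447568567960024356744, 116, 838359082489405387941793924471496720221432014929363088189344472917055368, 68, 2707572507288134479374344721393193184394709384⟩,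
   ⟨[34681, 35192, 10984345, 43658], 2542368871, 102, 3274841408212818823851076505871957501939128521981890377301453193255048, 101, 4547333771984365628240477842224097380057738842889569358447248736243253057437735048, 67, 2304694818989785851483858459760713956081637512⟩,
   ⟨[34681, 35192, 42905, 51369], 2543159672, 118, 11634573866614586692274158230306926039102930049005295752, 115, 13949991635989990159836849278817466276923392751035384071478624245903282846341256, 67, 176331582912699951376972485421210481437079970093192⟩,
   ⟨[34681, 35192, 3132663705], 2542368886, 102, 12786586670650379534161303263369665917346834232343704020144165001352, 86, 298614391086484375622716333969008705620098814909407793471476829981826423137326024136840, 52, 173156063140394928166243378428982357709674618919048⟩,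
   ⟨[34681, 35192, 47001, 12953494], 3636045978, 115, 3251382394438470658257618888743810598120285141266049993860321396692872, 116, 4581021126561531304374400675266533027359314536145920935479856167906716401884764040, 116, 3446383077630043123708913267730309924316031657⟩,
   ⟨[34681, 35192, 43419, 11184266], 3080226681, 102, 49970114260005917661670457729631855416304782335053705471780821640, 117, 3571206490007315889444152754849221463724163569677270828957335990952053955532330888, 83, 2707572507288134479396388765897630089012021640⟩,
   ⟨[34681, 35192, 12171161, 51369], 2777053287, 101, 19638340004463865121869647443410605281490470443595043534936178946515949196982408, 101, 3065069822372764651550055204320275996805879376085200099001256391431575235099920503, 66, 2304672356016678953553865963493385986236647287⟩,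
   ⟨[34681, 10127736, 12167319], 2542368886, 84, 243403873893151098083178010915218158009363172848841222377805960, 100, 898543763994508298353798322574442890655623142484344133655589748883536283379955243144, 52, 173156063140394928166243378428982357709674618919048⟩,
   ⟨[34681, 10127736, 43146], 2256037733, 102, 2978450909853714799050837304499008698810551451345458076040, 85, 11734200887407078484873452412465575218860259263565291853296046241388889420433527, 35, 148213101863280851695567157283957794174213370185591⟩,
   ⟨[34681, 10127736, 43402], 2543159672, 84, 3395289671928459763864129740068032774157072478286764349832, 101, 831431950504944308475569279127812156325661962854562854525391823233980552, 67, 176331582912699951376972485421210481437079970093192⟩,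
   ⟨[35192, 10848121, 12101529], 2559015286, 99, 16162313533085321072753953407224002110072521893240752658692151220360, 84, 1059700560534484904456269325755245074615728760942884157539338774754400136, 67, 2641714895784518939339611325123675820760992136⟩,
   ⟨[34681, 10979704, 47800, 13150888], 3333990281, 118, 14078902897268060864014276371018797738855407065139638474756224351857673722501256, 102, 54488724308292030704333978201839977642618928172295695986271468788789680773256, 132, 201177470451077455699392756326195466888995154741175⟩,
   ⟨[34681, 10979704, 43658, 12163467], 2777053287, 118, 3274841408143747819821073919283178549898799174677186999717101785749640, 85, 4141960652332430164185241339357263484043968886425993055448880021827123237445208183, 66, 2304672356016678953553865963493385986236647287⟩,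
   ⟨[34681, 35192, 11971240, 12163479], 2272684122, 118, 214620006528633769420359885913887100442851450080577490258293900188108429448, 85, 19521530501949902501050724802313202125307639391216256382948658784000365089483369, 36, 2018692949634250771073210230388315244267468919⟩,
   ⟨[35192, 10979193, 51129, 13150888], 3367413911, 118, 214828251389937831106631480204630945756371431150258290699466994669697144712, 102, 17559955362868023619540429327592339292083867531386507720349205254682641457256584, 115, 221563289920382486304212151389170739256635405416359⟩,
   ⟨[35192, 2559215481, 12105366], 2559015275, 102, 4058152996024274249295174787890350524407067402962352838125036113401736, 85, 1040159140403075700845024340085727694358332735802276102520280958305336186, 53, 2399292334355840072688753155574847280636201352⟩,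
   ⟨[8878454, 35192, 10917239], 3063384440, 69, 192063385047702849070809670714322535850127611712462045878585478, 85, 3220919835231916359361534306311249408234549855773784958236044413012102, 83, 2685271740738268255169408888679918022605379720⟩,
   ⟨[35192, 9996153, 12953766], 2559015275, 101, 68530241949564382224362922494393147779351085105864321085557151624, 101, 2902264252749829983857803443693927082126675926721727996507367418599304, 53, 2399292334355840072688753155574847280636201352⟩,
   ⟨[35192, 10979193, 43402, 47531], 3063384440, 86, 195189038631358204039128906454901790726453375069078620542113672, 86, 54543496998447417431479491262708622785351642656694637156575715249224941148296, 83, 2685271740738268255169408888679918022605379720⟩,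
   ⟨[35192, 10979193, 11250058], 3063384440, 86, 957420948185814658245017792632606633342551267574513498540191347532928904, 86, 13957798023160263099413780065600431254515018660013536657654847307436739100514440, 83, 2685271740738268255169408888679918022605379720⟩,
   ⟨[35192, 2845345657, 47001], 2559015275, 85, 63135958914661671680963079551522428148016152084604719508348245896, 85, 190113202700260769081051338326628204528239046828054655340864029479708170120, 53, 2399292334355840072688753155574847280636201352⟩,
   ⟨[34681, 35192, 39050, 43162, 47771], 2543159672, 102, 11634573866972438842679972175164328639522471745824594312, 101, 3247781056659938705044137652114712970859460865372037957141804211607944, 67, 176331582912699951376972485421210481437079970093192⟩,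
   ⟨[34681, 35192, 39050, 43162, 51383], 2543159672, 102, 762138739627792142263569361775958668159931726285896036227464, 101, 3247781056661389493431387749675200430768212628213851269648590855313800, 67, 176331582912699951376972485421210481437079970093192⟩,
   ⟨[34681, 35192, 39050, 13089192], 3063384440, 117, 762486114455039718332516344139995617029584391713266986432648, 117, 12792394509500502854375201090275988506012809789723814629159811463304, 83, 2685271740738268255169408888679918022605379720⟩,
   ⟨[34681, 35192, 43402, 13019287], 2324134248, 101, 4085542422601405371715523833161383266461556547975067359587958250903688, 101, 11014892753286291547442883800103410056416215345153438541734552901768, 52, 2330990837650229546345015911992392037469620344⟩,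
   ⟨[34681, 35192, 3064567958], 2778171768, 115, 12687443483101974408593658696394914039610110955038612152654536021896, 115, 831484296108570994936999290679832962129870127674497253892104073106663048, 83, 2691825639018313508213589999404799651974060168⟩,
   ⟨[34681, 35192, 10983830, 51129], 2778171768, 100, 76298182053909677309578064919234550137126008605405077126979819400, 115, 831484296108570994936999290679832962150984110790163661393567988903745672, 83, 2691825639018313508213589999404799651974060168⟩,
   ⟨[34681, 35192, 42902, 47274, 47528], 2778171768, 118, 763224800131578056684798952191791855873829171017442005653384, 85, 1177845497208087652253424199455095616496563848408182155676379022646220936, 83, 2691825639018313508213589999404799651974060168⟩,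
   ⟨[34681, 35192, 3081083287], 2559936377, 115, 12687443482685142357625151809770554089050585933120973844790358022280, 115, 12687443482686487783879442617717188200826518223510638160267851503240, 67, 2712727121773619497548612552657882438159534472⟩,
   ⟨[34681, 35192, 11970968, 47257], 2559015275, 99, 246818592722906984785966598176624698199862778703609740113979528, 85, 12473702930473594445499963823036057557583160753664334703345291132782880582244232, 53, 2399292334355840072688753155574847280636201352⟩,
   ⟨[34681, 35192, 12036761, 47514], 2559936377, 100, 273154148327404096117113319531212036232920087816326591894288710445853878664, 117, 922170800150045374314898875313442114012475588230705539565109890395109372626423355272, 67, 2712727121773619497548612552657882438159534472⟩,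
   ⟨[34681, 9931128, 13084838], 2543159672, 99, 267715064400009245048775940911064011437105712688691473484847240, 99, 294355826238610833813028875887539673179716173766758668020298944638416820360, 67, 176331582912699951376972485421210481437079970093192⟩,
   ⟨[34681, 9931128, 47271], 2543159672, 85, 16040472045064549019958049249731038700314334166574995592, 101, 12686644752577907307546254907318630347692128385317254152779591096456, 67, 176331582912699951376972485421210481437079970093192⟩,
   ⟨[35192, 848954886009, 50854], 2239195494, 101, 4934793628214481918243633402802494433845667656276181353389420151799134005556189064, 100, 198922124506978495867444720644782921203077622149124245043007355976112879597496409032310, 35, 2286214439447689628547715807368281383489734262⟩,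
   ⟨[34681, 35192, 42902, 47543, 13085352], 2491840615, 118, 12804787234578490015703377588109627693578107282690229134121061881736, 100, 3072743254861035897327018859615828292673242153805539968510074526229406948877895799, 66, 2311226254296724206598047074218267615605327735⟩,
   ⟨[34681, 737285736824, 47515], 2272881512, 87, 54492596184759960501359405689613417152712201843665797783485264768288230578312, 87, 792750705822906118081515108207020659329665318439169778077397187241868925603277281416, 37, 2330990837650229546384838504449049858356643960⟩,
   ⟨[34681, 47515, 801710246264], 2559936377, 87, 54488516824542040921722857770208719212166276786612279969355690686387972577416, 117, 60435385558633486949765065759262385019121298465516704100644713340648032974258463581050760, 67, 2712727121773619497548612552657882438159534472⟩,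
   ⟨[35192, 10979193, 12233098], 3063384440, 117, 12804761222236906610468952373371008582868350588636780808120022112136, 116, 4104884055617687108791074947213721120935461967528439146935938016227949124339210376, 83, 2685271740738268255169408888679918022605379720⟩,
   ⟨[34681, 35192, 43146, 47274, 47514], 3080226681, 118, 12792349250561514545776010094494950436692315157410741130806664210824, 117, 3571206490007285447635553322783993230038083991211548693633765423290739340056434568, 83, 2707572507288134479396388765897630089012021640⟩,
   ⟨[34681, 35192, 39062, 12170920], 3063384440, 115, 12687443482685141610802944213216037476005619814541805134020719646600, 116, 3247985531567396252365714219830291993218477542816820054483628459534216, 83, 2685271740738268255169408888679918022605379720⟩,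
   ⟨[34681, 35192, 42902, 12039573], 2543159672, 115, 49560326104238834589165202017593821893331659771975309813901465480, 115, 212859979797210543210401164397309198816504471610445510834002871166093924488, 67, 176331582912699951376972485421210481437079970093192⟩,
   ⟨[34681, 35192, 47017, 12953494], 2845345657, 99, 272819085247221442448626481446575305125529902586431733874857864, 99, 12786175782914246515324520318524091554006658202051591826809075177352, 68, 2707572507288134479374344721393193184394709384⟩,
   ⟨[34681, 35192, 39319, 13019559], 2777053287, 118, 49970114261059502470390757492231737315960387314535662859621800072, 101, 200872411708716551391782248227121054532012979957812828825340254381322924411208460699767, 66, 2304672356016678953553865963493385986236647287⟩,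
   ⟨[34681, 35192, 11180439, 47014], 3080226681, 102, 49970114261059857530010931852232418637229344167824870294113720456, 101, 12792349251200176403297241135949006617346848741750760333790098794376, 83, 2707572507288134479396388765897630089012021640⟩,
   ⟨[34681, 35192, 43159, 13088421], 2543159672, 99, 193595023852165744314756046463631748865410977844197338569480328, 115, 831484296082853684423464687226055520059079491987002391302186695441094792, 67, 176331582912699951376972485421210481437079970093192⟩,
   ⟨[34681, 35192, 43159, 50615], 2543159672, 115, 2954025632396097257375313377954968154218231754093045979272, 115, 212859979797210543749751625736483924429166048319836706554291487265286363272, 67, 176331582912699951376972485421210481437079970093192⟩,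
   ⟨[34681, 35192, 12167319, 50869], 2543159672, 100, 756230561893292764193381463499605430083565890190979092682888, 101, 54488724308292030200258948358510317860896406197851560286075147107587329726600, 67, 176331582912699951376972485421210481437079970093192⟩,
   ⟨[34681, 35192, 47000, 47274, 47513], 2845345657, 100, 1177438025850895058072150034929170917060863158071363853874620352558573960, 85, 1177434557593407388540719901384125694435005988210750121089318395968984968, 68, 2707572507288134479374344721393193184394709384⟩,
   ⟨[34681, 35192, 42905, 12102554], 3063384440, 102, 12792394239210253000104975795672660272146706022818179777153420793992, 117, 54942916049614615335980821063502550899941971350003476069839201803799303329928, 83, 2685271740738268255169408888679918022605379720⟩,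
   ⟨[34681, 35192, 42905, 47515, 47770], 3063384440, 118, 214620006530692175163084772283124852152633976802370381190715709732103428232, 117, 3600726254971282314469179433156935742518793738971377482855133245133827152395409544, 83, 2685271740738268255169408888679918022605379720⟩,
   ⟨[34681, 35192, 47258, 12163479], 2272684122, 118, 12792349250831323527677069006302196897362601503787893006036885936264, 86, 2685287143018014123251450433281505707345790727560214929814941857886205326172580457, 36, 2018692949634250771073210230388315244267468919⟩,
   ⟨[34681, 35192, 12957606], 2778171768, 101, 15955940348604917213329900359427316774099644696706332296, 115, 49560326104238834497440744876279294071480838724350380050963994760, 83, 2691825639018313508213589999404799651974060168⟩,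
   ⟨[34681, 35192, 47286, 13084566], 2256828519, 118, 195384031550173122171261700365167826194377214221881697965217672, 100, 3067380151559620308978590482538467758342493377126384935625870897137770735777319031, 50, 151388621635585874906296264276185917901618721359735⟩,
   ⟨[34681, 9931128, 12167306], 2543159672, 86, 56963489326641710197565630331519383932812067400103416038476585096, 101, 54488724308292123578030578834463237370070088474652537639449344851485287618696, 67, 176331582912699951376972485421210481437079970093192⟩,
   ⟨[34681, 3097135480, 47528], 3080226681, 118, 195195758828173053070605901899054784000842684469373718819875208, 116, 831511488021466078039629906644762730347248145071725173315770183210997640, 83, 2707572507288134479396388765897630089012021640⟩,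
   ⟨[34681, 42902, 3349776760], 2862189420, 101, 3253160677277784988328111648298931635256897670561780760861039021037448, 102, 54463899948020537600107276466168966799511628921887418433148581832211513776008, 71, 2423167249803109652611538105193838972095798170⟩,
   ⟨[11110776, 3332867961], 2777053287, 102, 12791908835737416698369232687464150144054400588819976148794987812744, 101, 784747237443002385051000217284657058125766017752865864840191013056074951759052114039, 66, 2304672356016678953553865963493385986236647287⟩,
   ⟨[34681, 35192, 11905447, 12097686], 2778171768, 115, 54492154827981025483234506362121115670157505618073306465979931386211188774792, 115, 3576525261279769755531248125138537532058450106040345896146484726741821322670155400, 83, 2691825639018313508213589999404799651974060168⟩,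
   ⟨[35192, 10979193, 47543, 13150888], 3367413911, 118, 214828251389934717664170728410972083204817520147715903931166540508578748296, 102, 17559955362868023768404169762358254588707278341075230582650339150677642688632968, 115, 221563289920382486304212151389170739256635405416359⟩,
   ⟨[34681, 35192, 46743, 3349850278], 2593687417, 102, 4496265340179187176247393362115812084605847806513535765494104394803080, 102, 19311312590208133502062960037479590511752466663121897239763505830355053319792520, 69, 177798814612067903450035191289487879019394917435784⟩,
   ⟨[34681, 10000010, 3081341304], 2307291239, 84, 3251468659597053349064942094909849665420861264093973494422076273563528, 84, 183051849974119954681397602215608667483645700110835885842931757010981980279, 51, 2308602638548959587426454563452007800036165495⟩,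
   ⟨[34681, 35706, 801710246264], 3080226681, 86, 831428784554169325559004148447252723270720928256447273270048282482677896, 117, 237927390410978839163423781785062964078318025980610683611708556831184534401875230365576, 83, 2707572507288134479396388765897630089012021640⟩,
   ⟨[35192, 10979193, 43673, 47514], 2542368886, 117, 49970114260005914618041051688065629121580050532170304350957639560, 100, 19682830714774935767326195132425371144890654527893792429563513477273093671630050767854475400, 52, 173156063140394928166243378428982357709674618919048⟩,
   ⟨[34681, 35192, 38790, 12953237], 3063384440, 99, 756233717450707282253895455141436472043598292462096114620040, 99, 193595023838693621864770986960743946453107262863337111349139080, 83, 2685271740738268255169408888679918022605379720⟩,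
   ⟨[34681, 35192, 2828769162], 2777053287, 86, 195196445289973208441955297119237275208135624070612096629971080, 85, 16026111053740654667568858660355060048728794270205171218886702941239513548621943, 66, 2304672356016678953553865963493385986236647287⟩,
   ⟨[34681, 35192, 3064567946], 2542368886, 102, 2978450931684201467086137091973718014807233645167454624136, 116, 3511455027811678094476979062688696573099618449749847599856035909111836000227334536, 52, 173156063140394928166243378428982357709674618919048⟩,
   ⟨[34681, 35192, 11115402], 2542368886, 86, 2978450909848028183910100555910501077460967315795507583624, 86, 13731551038918553782965332126280708338953519456249004503317822450528554101348488, 52, 173156063140394928166243378428982357709674618919048⟩,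
   ⟨[34681, 35192, 43402, 12032664], 2307291239, 116, 955692267055043159812249564257438800022474646381247842895001196910123400, 86, 714992388918798361887063252689533399116794376697545661941298879159437431, 51, 2308602638548959587426454563452007800036165495⟩,
   ⟨[34681, 35192, 42902, 11180427], 2543159672, 101, 11634573866615641595614281348430105623814995964017022856, 101, 831431950504945729204857805552686500554539612312957309987112744811927688, 67, 176331582912699951376972485421210481437079970093192⟩,
   ⟨[34681, 35192, 42902, 50872, 51112], 2777053287, 100, 1164473569428015771201006848130557144777720720809191832465586318646744968, 100, 76314939846034441581010434618087366459382169511896101678800584363713844709495, 66, 2304672356016678953553865963493385986236647287⟩,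
   ⟨[34681, 35192, 46742, 12035479], 2778171768, 115, 193595023844682946963187224533032285487795855688650197018584712, 115, 831484296081253441951814822968408961947851467628707197497352162394937480, 83, 2691825639018313508213589999404799651974060168⟩,
   ⟨[34681, 35192, 11969943], 2778171768, 99, 176073648476342847941202515551642389316784672450184, 99, 756230561893292762717296522163756962393836990809340010469512, 83, 2691825639018313508213589999404799651974060168⟩,
   ⟨[34681, 35192, 46744, 50872, 51112], 2777053287, 101, 1164474839347859004375481420030114890891272031470431315513714364469720968, 101, 201473895461768202817582664448767593794997326903074353812062897389038488539206759450743, 66, 2304672356016678953553865963493385986236647287⟩,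
   ⟨[34681, 35192, 43416, 12105369], 2559015275, 99, 246818592722906984785966598176624698199862778703609739846592648, 85, 17800057760425159629305068301750667144581851984024544370688266403261556617418632, 53, 2399292334355840072688753155574847280636201352⟩,
   ⟨[34681, 35192, 47257, 13019559], 2777053287, 101, 75807750806262764197457923089581843579016213954472677284982623959192924825736, 101, 11973017226426058812748523652095063622300907938614091037213342094895123245074551, 66, 2304672356016678953553865963493385986236647287⟩,
   ⟨[34681, 35192, 47271, 51126], 2778171768, 99, 45074854009943769144685473627521382889022545853855624, 101, 49605414206085135203070972007845378793470639794662569443991263368, 83, 2691825639018313508213589999404799651974060168⟩,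
   ⟨[34681, 35192, 47274, 12163479], 2777053287, 118, 12792349250831323527677069006302196897362601503787893006036885936264, 85, 1294547637921763882225539440312350349709699384296131757270232348160716814792716224631, 66, 2304672356016678953553865963493385986236647287⟩,
   ⟨[34681, 9931128, 43403, 43658], 2543159672, 101, 831484618584102158799975869969438467086852485931086933866240004079655048, 101, 54488724308292030200254806534484193798841677453964358319646951464112664254600, 67, 176331582912699951376972485421210481437079970093192⟩,
   ⟨[34681, 9931128, 13019559], 2778171768, 117, 49970289996819310891918941391239284360259225477459835399405344904, 99, 4514991517809951151750350283467619368657474416412459880293747636344968, 83, 2691825639018313508213589999404799651974060168⟩,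
   ⟨[34681, 39818, 10979704, 43673], 3080226681, 86, 193594677868059368411649612745913447206112602264889572816754824, 117, 244656379235498290924531758337559858262356236604981755357389114877266270088, 83, 2707572507288134479396388765897630089012021640⟩,
   ⟨[34681, 11045240], 2778171768, 83, 687429565632984028979622715004843336262410147976, 99, 193595023844682947255627909673353805307038395305676303419152520, 83, 2691825639018313508213589999404799651974060168⟩,
   ⟨[34681, 2845542776, 43659], 2542368886, 102, 12792349457729039164722556570138538890718373614887490429975390689928, 101, 898514238425251167178411613208321231263708609080213614675546442136178302873060874376, 52, 173156063140394928166243378428982357709674618919048⟩,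
   ⟨[35192, 10979193, 43658, 12163467], 2542368871, 117, 3274841408143747819821073919283178549898799174677186999717178843371400, 101, 4138356079118102237743043812198340746654426451645622027404612044517251809051056264, 67, 2304694818989785851483858459760713956081637512⟩,
   ⟨[34681, 10979704, 13150888, 51640], 3620124853, 118, 54995714442453362750055754750556779133116169658089605239317721509717079595144, 117, 21056903078276723089701604889002279369369762038279694012226408597231270972987528, 130, 4052171439164526351208976283167882779068647623⟩,
   ⟨[34681, 10979704, 43659, 12163993], 2610530426, 118, 214620006524108644199892642356423276996127023519795260545170841546033633416, 117, 929374341810130574846144503368661471509404823363721895578603639462302660349437516440, 70, 179266047628368731477722027827430500403833814420105⟩,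
   ⟨[34681, 10131606, 3081341304], 2307291239, 84, 3251047410430379120318150422799114983691585683712371297977059029653384, 84, 183024242988732792426247863192159559381835895674947204296711106914086783095, 51, 2308602638548959587426454563452007800036165495⟩,
   ⟨[34681, 35192, 39319, 11971240, 47514], 2272684122, 118, 214620009360979472376795979318666979351703081678113964603319995521783273608, 86, 687435470293436056084156391077035117972454519579485018308025035316293535666290518633, 36, 2018692949634250771073210230388315244267468919⟩,
   ⟨[35192, 10979193, 47800, 13150888], 3367413911, 118, 14078984283092440071487560511129955550497104496039595566369586623711395783939976, 102, 1150809234660918795930201676804953919984811600332583016620495567761824518438777362568, 115, 221563289920382486304212151389170739256635405416359⟩,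
   ⟨[35192, 2559215481, 47286, 50856], 2845345657, 101, 69404819579999487533036248057556258539543275549589840920046966664, 116, 3280107018194638814491739196463706023353673951302718436299426301056904, 68, 2707572507288134479374344721393193184394709384⟩,
   ⟨[8881529, 38263, 10979704], 2845345657, 99, 12687443482291091933848354465039429416429260755332739260249164777606, 99, 3598988387593049981420059412479252383116467744859925770732265855463588383222630534, 68, 2707572507288134479374344721393193184394709384⟩,
   ⟨[35192, 2845345657, 46742], 2559015275, 101, 61922500549686801899640476466911663530902758804064304724644894600, 101, 4055315729951960422056417614343987705942922022419750061581447161354120, 53, 2399292334355840072688753155574847280636201352⟩,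
   ⟨[35192, 10979193, 12097931], 3080161656, 117, 195384026952637842203449883206119953433747884293970523932104584, 117, 3274852994337585626701723450006414368560375664739518236366029837605000, 115, 176062567804865704791782056648091404151191201355912⟩,
   ⟨[35192, 10979193, 12098457], 2542369656, 87, 3274728661948778674870122655485162554094966540351606994780656842086280, 87, 54940940502096062631094580674894693521057913745846991615998552087101071464584, 53, 2689202023270548889081820081095197657291921544⟩,
   ⟨[35192, 47017, 3097003897], 2559015801, 84, 69717977488656201787694984578654329942239584735928761620711905160, 85, 55057892380263534519836466456568342901548002900579184523239391290650993923976, 69, 177443471837635181240290983625330886217908908165512⟩,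
   ⟨[10127736, 2845345657], 3063384440, 102, 11634573866616073412608006699373235663302558774583728008, 116, 3248091668124099031344241217654338931475382930920456499210463339911560, 83, 2685271740738268255169408888679918022605379720⟩,
   ⟨[34681, 35192, 10983816, 51383], 2542368886, 117, 762486114454880156491112895189476663089045734818079288371352, 116, 3511455027811678094476979062694348205636401537049047403396055068781140324218611864, 52, 173156063140394928166243378428982357709674618919048⟩,
   ⟨[34681, 35192, 39050, 11249818], 2543159672, 101, 49970114920511511736132127255727392315661168132112815609965287816, 101, 54488724308292030201285786898415869844198037257779052473934329803003981830536, 67, 176331582912699951376972485421210481437079970093192⟩,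
   ⟨[34681, 35192, 3349780618], 2542368871, 101, 3738439717091146233046953080403831619808357707875459765324003931756936, 101, 3738439717091144419213728245965095648858128780839696736296173087398280, 67, 2304694818989785851483858459760713956081637512⟩,
   ⟨[34681, 35192, 43402, 43659], 2543159672, 102, 11634573866618766705085481631104796409161377677152328328, 101, 3247781056659938705044137650727757932832402456550229062850659382565000, 67, 176331582912699951376972485421210481437079970093192⟩,
   ⟨[34681, 35192, 3097991563], 2543159672, 101, 2978450949222557905843834464258640553275571444233213089928, 101, 212846579329265742973772605077649655717894852395252088781990566380742154376, 67, 176331582912699951376972485421210481437079970093192⟩,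
   ⟨[34681, 35192, 39062, 13019045], 2812647816, 115, 49560539548787065635818601502736284440685631147956074637833967496, 115, 3247985531573647588996246907448777629207611230825551319056184824473239, 83, 199807311173513199819961870028292423588102321842328⟩,
   ⟨[34681, 35192, 2846333846], 2778171768, 85, 62003250689331779716448364368143885099913335980295230482955147144, 85, 1040241929516785694389180560836092035488434552036906090479287063699429512, 83, 2691825639018313508213589999404799651974060168⟩,
   ⟨[34681, 35192, 42902, 12036761], 2543159672, 101, 195195761430300616418162753559971392384039306680596229363636104, 101, 54488724308316299962347502417581253474876226523790345328877502980838272833672, 67, 176331582912699951376972485421210481437079970093192⟩,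
   ⟨[34681, 35192, 42902, 12236713], 2542368886, 101, 69764452314593169350967918574334894795685045889887404893167720328, 116, 898932487119789592186130649962460244607501203433954704650991896110230369063357945992, 52, 173156063140394928166243378428982357709674618919048⟩,
   ⟨[34681, 35192, 39319, 12953766], 2491840615, 101, 267696257711659994751199144852281466142574064750807626042284168, 99, 46774581545372541341793457476527572312300417502717199631162935298043852392567, 66, 2311226254296724206598047074218267615605327735⟩,
   ⟨[34681, 35192, 3366492823], 2543159672, 102, 195195761408266932121292079293056991929260544749750607389759624, 101, 54513349712098322992688863359781591200237346317993868182206243457238912571528, 67, 176331582912699951376972485421210481437079970093192⟩,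
   ⟨[34681, 35192, 3081149080], 2778171768, 102, 195195761408268393622926006266125862567182728376006160392099720, 101, 832240748904958827669425274752929704231372749475129848277048078920886152, 83, 2691825639018313508213589999404799651974060168⟩,
   ⟨[34681, 35192, 12171160, 51113], 2777053287, 101, 5027306514439882641067950447285707577862540816291169773240034032240670079185369224, 101, 784657874525771764724335593279467775090512910518464596899268208852187478020412967031, 66, 2304672356016678953553865963493385986236647287⟩,
   ⟨[34681, 35192, 42905, 47785, 51370], 2324134248, 117, 4574198063968166152337560685635964330392852056433444698631125015763080, 102, 184929965919719713154135620334590529376317950858439157513854729482695907464, 52, 2330990837650229546345015911992392037469620344⟩,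
   ⟨[34681, 35192, 13089177, 51383], 2845345657, 100, 271505064204492040847940742278896849364921482282497343615414201632156137608, 117, 13950053718172962176234056628259598825702150990088083431283700609285888411211656, 68, 2707572507288134479374344721393193184394709384⟩,
   ⟨[34681, 35192, 42902, 12036507], 2778171768, 86, 2981323676835542464258731473623097508584006234695523669896, 85, 4198008177513512349931150365039917275899957662790673865440403669817480, 83, 2691825639018313508213589999404799651974060168⟩,
   ⟨[34681, 35192, 50856, 13088408], 2307291239, 101, 62800297915036309670803859270534624294362962129908801750654498696, 101, 2792951408794944666053571246425886703014739201897755647889168213182583, 51, 2308602638548959587426454563452007800036165495⟩,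
   ⟨[34681, 35192, 47274, 12167306], 3080226681, 118, 49970114260005984976019724866879880454750648284823367685884193160, 85, 301320635489096354149734381071276151846254686778616857115557951123564763016, 83, 2707572507288134479396388765897630089012021640⟩,
   ⟨[34681, 35192, 47274, 12167319], 2778171768, 85, 4182919533195192486637541344284153337827897883680469129352, 101, 832240748904958827698681883584980518453261095225467816959237811775051912, 83, 2691825639018313508213589999404799651974060168⟩,
   ⟨[34681, 39546, 2844494200], 2542368886, 103, 12786565861290634441570767799462239165043687147564662614762729343624, 101, 13710239233512777789105985664711639769340330467452158826703143554986362858408584, 52, 173156063140394928166243378428982357709674618919048⟩,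
   ⟨[34681, 2811922808], 2559936377, 85, 2954020353211355108820342280484630414412769557840798521480, 101, 837953103987404546757160370717575738787637764095249239527135722090174344, 67, 2712727121773619497548612552657882438159534472⟩,
   ⟨[34681, 10127736, 42905, 51129], 2542368886, 100, 76378521080430498267406957844703169006138986848002904576041195656, 100, 1408934798606779547567301425246715777479978020999756496333131277629562489934000461960, 52, 173156063140394928166243378428982357709674618919048⟩,
   ⟨[35192, 10848121, 11048838], 2542368871, 99, 12687443482685141631343895358294342633604221796715298534820027078280, 99, 2787664705859847190186182846587922242806845491184251489129109474674807, 67, 2304694818989785851483858459760713956081637512⟩,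
   ⟨[35192, 10848121, 11048853], 2543159672, 99, 12687443482685141631343895358294342633604221796715298534820027078280, 99, 3247985531573647204748552590343515202235674357180175848247238671767176, 67, 176331582912699951376972485421210481437079970093192⟩,
   ⟨[10979193, 3366553976], 2542368886, 100, 12701049451549456795749400453389488661761297867654652603157922224008, 100, 58984363754447471317185379773438262256676133528707982260985539842313412256397873045411976, 52, 173156063140394928166243378428982357709674618919048⟩,
   ⟨[34681, 47286, 858014583160], 2508683638, 100, 212866502617159884414812305925396542857843652607007941727856874775868053640, 100, 914254673488622147644601423202447424194611961991580001705636918680752344948035455110, 51, 2644425625068008971244697384014429182425011846⟩,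
   ⟨[34681, 39062, 11110776, 13153960], 2508683638, 116, 54550814610641018217457429941043689671646213260116527809740019853030052042632, 116, 3512028589001989665187181895081233562908850001328821486107980484285010477674104966, 51, 2644425625068008971244697384014429182425011846⟩,
   ⟨[2559215481, 11110776, 46742], 2559015275, 102, 4058152996024274249294752674163619599650233122410491326649668946466696, 101, 4055315729951960434775867059555722854927910875460768731340329554836346, 53, 2399292334355840072688753155574847280636201352⟩,
   ⟨[34681, 35192, 12163479, 13153960], 2795804807, 116, 13949991635964941446061022860320439147305037472866996308768354328008673368447112, 116, 235992312285421478672290035060939118243396935504823078511653386493387384266573565372296, 82, 198340078157212371792275033490349802203663424858007⟩,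
   ⟨[34681, 10979704, 47543, 13085352], 2307291239, 118, 3278000023511249598011946106761950891395599176423745141811592354633864, 101, 76343193782190598923740524245939954997161648306312798979319942348542311958647, 51, 2308602638548959587426454563452007800036165495⟩,
   ⟨[35192, 2559215481, 46503], 2845345657, 85, 16058456016505490146873846282390654494057127285394675592, 84, 11629335741202452805685413791041452711607704581024880520, 68, 2707572507288134479374344721393193184394709384⟩,
   ⟨[35192, 2845345657, 46757], 2778171768, 99, 762115435269235833837044770985736766338446998938904485599112, 99, 3273260870258172861241397460719109414264180586113607368870280475158152, 83, 2691825639018313508213589999404799651974060168⟩,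
   ⟨[35192, 10979193, 12236713], 2542368886, 117, 12804687590368073712536051530884686139649853124924286620700945979272, 116, 15081584505825927862658223299124948908197450107116509029750014578012835455663774015248963720, 52, 173156063140394928166243378428982357709674618919048⟩,
   ⟨[34681, 35192, 3114833802], 2777053287, 102, 195196445289973208441940724808497923256738600507445909927860360, 85, 16026111053740654667568858660355060048714166105728252349398355587995030861154423, 66, 2304672356016678953553865963493385986236647287⟩,
   ⟨[34681, 35192, 3349714826], 2256038503, 100, 56966716150682558004976483574214207687812455645514063541352110216, 101, 46769252207778057838369604126099750425040477204397334150151863952216205854839, 36, 2308602638548959587466277155908665620923189111⟩,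
   ⟨[34681, 35192, 10918026, 47286], 3063384440, 102, 12687493222560727310785842081905803372688774876087964377859540621192, 116, 54492154827981007806817652455618496483390461425670672534422996987396671121288, 83, 2685271740738268255169408888679918022605379720⟩,
   ⟨[34681, 35192, 11114634, 47286], 2559015275, 100, 56963502251445745740386346034625157970493423125702920475330124168, 85, 19211146225782973734888439499474043942988016552338705968995454450554, 53, 2399292334355840072688753155574847280636201352⟩,
   ⟨[34681, 35192, 11114634, 51129], 2542368886, 100, 1165445472513423912890861877509283615191707729653417228540296, 100, 360687903044768813055236055785172077731469456408464032687810681670262547990297125230984, 52, 173156063140394928166243378428982357709674618919048⟩,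
   ⟨[34681, 35192, 42902, 43402, 50872], 2845345657, 116, 14582656576370110909538950410688820764612349600284082119074664454024, 116, 12793169083495565545967205425989327851853796979645434616833560385416, 68, 2707572507288134479374344721393193184394709384⟩,
   ⟨[34681, 35192, 39062, 46760, 51369], 2491840615, 115, 12687443482688495417906514361268557717456187414517331480492961666952, 100, 715452379765715114046576377924511764163019399288386004855369794835679351, 66, 2311226254296724206598047074218267615605327735⟩,
   ⟨[34681, 35192, 11114646, 46757], 2778171768, 99, 193595023851043310678003825323733311570736349018484301592172424, 99, 12687443483101974410049427653195693393142164955993754341194252920456, 83, 2691825639018313508213589999404799651974060168⟩,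
   ⟨[34681, 35192, 42902, 47017, 51626], 2542368886, 118, 195195758828148201031994221099689854728356560058238299958450056, 116, 13716621202389367556551065825843204412175392484302680066866607345736043171715208, 52, 173156063140394928166243378428982357709674618919048⟩,
   ⟨[34681, 35192, 42902, 13219753], 2491840615, 116, 17861351731123700618521899275779471353564697501754587510321148630920, 100, 3072851838325108324925086371354774231161728004944841729990528766867891716800088183, 66, 2311226254296724206598047074218267615605327735⟩,
   ⟨[34681, 35192, 11118486, 50869], 2778171768, 115, 49560326104238835872971697658716447521344800658384360310339835784, 115, 831484296108570994936999290679832962130212691391246756546332485652748424, 83, 2691825639018313508213589999404799651974060168⟩,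
   ⟨[34681, 35192, 3047794582], 2543159672, 115, 12687443482685141983480757311659761549208679497618045027516189022088, 115, 54492155690797997576249265858182438384136631602480046875633954136706054002824, 67, 176331582912699951376972485421210481437079970093192⟩,
   ⟨[34681, 35192, 3366561686], 2256038503, 100, 15846868600793791226275934558385581218905519470583124163388490946440, 101, 46769252910432818131459825487883266329312878216289621757830768086864820144247, 36, 2308602638548959587466277155908665620923189111⟩,
   ⟨[34681, 35192, 39319, 47274, 47514], 2256038503, 118, 195195758832265068476523240875538500809580529938147571724294280, 86, 46750073957172436649177179580274146569117635290222813050511362314043982907511, 36, 2308602638548959587466277155908665620923189111⟩,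
   ⟨[34681, 35192, 3317143959], 3366557834, 115, 12687443483129846723772358974673987743236855617281445475202030344328, 116, 54492154827981008222383512295047893602758647148173001499763910648899734907016, 100, 3088171892009723781011931691084162125380754073⟩,
   ⟨[34681, 35192, 3367475607], 3063449465, 117, 3278000023316262724931520799545429138605493490594775910182649625811080, 116, 3600724841562080122067906105371409721576419866114536225151792070102050361414559624, 115, 177804900036826150602772808690850518156530631018888⟩,
   ⟨[34681, 35192, 43159, 51129, 51369], 2542368871, 101, 17874181845806185408354873745996543655853278701331906247505706719368, 101, 299879009650369065483040791738681137634036375836553648719663709644991862920, 67, 2304694818989785851483858459760713956081637512⟩,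
   ⟨[34681, 35192, 11115416, 47271], 2778171768, 87, 2977126808632333072031306883750912221565527501067079100552, 85, 16076362121280541748333915240887887671408497548183138640867081300104, 83, 2691825639018313508213589999404799651974060168⟩,
   ⟨[34681, 35192, 47000, 47258, 47513], 2845345657, 116, 69869261324163646219025934357293131882121745437959508543080262013081059109256, 117, 13950053718172962176755072578028118436239609393406529873800038516065691704465288, 68, 2707572507288134479374344721393193184394709384⟩,
   ⟨[34681, 35192, 3317213081], 2845345657, 115, 12687443482685141615365142502791077544846338829156950690789688121480, 116, 14065364988945553084663094108038758669983359586404771996951023691772096766580616, 68, 2707572507288134479374344721393193184394709384⟩,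
   ⟨[34681, 35192, 47257, 13084566], 2845345657, 115, 12700737701965787279904609228450924791830020964166728823391145990024, 116, 54492397793148085408866372037012345280191929886379094477612668284454098605960, 68, 2707572507288134479374344721393193184394709384⟩,
   ⟨[34681, 35192, 43162, 47800, 51370], 2324134248, 117, 4978597263975425749257565911941258791758726810545378678439749851134344, 102, 184930368534783017598661586486832529800983529054459690866640863191838079368, 52, 2330990837650229546345015911992392037469620344⟩,
   ⟨[34681, 35192, 11180439, 47258], 2272684122, 118, 3274841408212818823086796898531598025736815633031217044944312118909064, 86, 10489402902413691870448174863354196611288500490862489819946514777727356653496937, 36, 2018692949634250771073210230388315244267468919⟩,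
   ⟨[34681, 35192, 12036761, 47258], 2559936377, 116, 832347252950165633898421803933483311562715381462513974232482916218743176, 117, 922170800150045374314898876124036403915446026311099776717049936576463118173351810952, 67, 2712727121773619497548612552657882438159534472⟩,
   ⟨[34681, 35192, 50855, 13089206], 2559015275, 101, 75139861700012812465921119425527444452568987534503914238302009224, 101, 1260631483154829172140949724658443015617075898497348562753229522260694920, 53, 2399292334355840072688753155574847280636201352⟩,
   ⟨[34681, 35192, 50869, 13084566], 2491840615, 101, 19123497296246360300455392977228232707552531671246167831075477821320, 99, 11974292958001259765538377887312695562859452863999102943239412764809963670833271, 66, 2311226254296724206598047074218267615605327735⟩,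
   ⟨[34681, 2542504312, 39546], 2542368886, 87, 49560237534223198313381070700747010774644787691129638388449708680, 85, 209201648460583157182403345713873567484601333006793985648950856688894249608, 52, 173156063140394928166243378428982357709674618919048⟩,
   ⟨[34681, 9931128, 12036761], 2543159672, 116, 12687443482685141610803568450309101892866685099449281260302943950984, 101, 54488724308292030470830696789417655689981255995798771597870861295809934694536, 67, 176331582912699951376972485421210481437079970093192⟩,
   ⟨[34681, 9931128, 11118491], 2778171768, 87, 49560237534241643835583157783928277976091200160210219923403217032, 85, 4198244770510697330074605525767139413362130572440947285022541108254856, 83, 2691825639018313508213589999404799651974060168⟩,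
   ⟨[34681, 2778171768, 46742], 2778171768, 115, 49560326104238834497440744815373954889069479664779853293934778504, 115, 49560326104238834497440744815373954889069479664779853293934778504, 83, 2691825639018313508213589999404799651974060168⟩,
   ⟨[34681, 3046607224, 46742], 2543159672, 115, 49560326104238834417201362092090836733778799360832995123899308168, 115, 3247985531573647204748552923542926007331901519236538439696404864997512, 67, 176331582912699951376972485421210481437079970093192⟩,
   ⟨[34681, 10127736, 42917, 46742], 2543159672, 116, 12687858078609761841188442256519423689386212495674974095791137203848, 85, 68139288860895079969269211275333114281326563232336741148908702761802075314312, 67, 176331582912699951376972485421210481437079970093192⟩,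
   ⟨[34681, 10127736, 47274, 47528], 2559015275, 102, 2978450909853714799051158516945373795533211995727499733384, 87, 1162390675773962186382895459736552890603014500820924015867887107795687304, 53, 2399292334355840072688753155574847280636201352⟩,
   ⟨[34681, 10979704, 50872, 51126], 2491840615, 117, 195384026975133271384579946542508639416707692170591164226312328, 100, 3074363544241504971368308577080804594066923455770546968912620158801364571240564855, 66, 2311226254296724206598047074218267615605327735⟩,
   ⟨[34681, 2542504312, 39547], 2542368886, 87, 49560237534223198313381070700747010774644787691129638388449708680, 85, 209201648453617080760540622869399161814302393124860235670902449747862784648, 52, 173156063140394928166243378428982357709674618919048⟩,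
   ⟨[34681, 39547, 2844494200], 2542368886, 103, 12786565861290634441570767799462239165043687147564662614762729343624, 101, 13710239233056249004722790260376165119331619143349748588141763157698924770790024, 52, 173156063140394928166243378428982357709674618919048⟩,
   ⟨[34681, 39050, 3113912696], 2542368886, 118, 762483432922550985410146724593333468360900619738787359594888, 100, 898543763994508298353798322574442890655623142484344133641950496988906481605591800200, 52, 173156063140394928166243378428982357709674618919048⟩,
   ⟨[35192, 9799545, 11970711], 2542368886, 99, 2954025632395988289453300432447430466723891445288051120264, 99, 209201594116578762321098003195636847640201432578700933539087720565849036936, 52, 173156063140394928166243378428982357709674618919048⟩,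
   ⟨[34681, 848954886520, 50872], 3586636200, 101, 83438867642797243695274082545233416964832002046208850183139130684726807468168, 117, 13950477768311062726281789553446634137715015304618130539624254182015331091454088, 131, 3766459195879271536304534729343243048779892920⟩,
   ⟨[34681, 35192, 11901335, 12101541], 2777053287, 115, 54492154827981025489437862383544003683274129438174332633068928288761068296328, 85, 11995212476156010792249952000664309433294993234159532096054939344665647089485943, 66, 2304672356016678953553865963493385986236647287⟩,
   ⟨[35192, 46742, 792833197945], 2559015275, 102, 4058152996024274249295174787890350524407067402962352838141464363308936, 85, 2900579254470311672514212757795156541318586931764970798767095039949690, 53, 2399292334355840072688753155574847280636201352⟩,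
   ⟨[35192, 793136105337, 47513], 3063449465, 85, 3278534380048810605102173991777134639082160763689494053917027073628040, 116, 3600956913535797457287875806103788507598853614506124875113316596524871654335551368, 115, 177804900036826150602772808690850518156530631018888⟩,
   ⟨[35192, 10979193, 13150888, 51640], 3367413911, 102, 83523662385306857738416965373375842359623092053605299789437986875609097738120, 102, 4499076171850922225667186241138272808103497359242125207815569679382727647297116296, 115, 221563289920382486304212151389170739256635405416359⟩,
   ⟨[34681, 35192, 10065803, 12171174], 2256038503, 101, 14073927025887182572951239730380324909408419700909033269006151701441424598210696, 101, 200872411708642336919752089378062581112187155808041107938222870278576259262786399930487, 36, 2308602638548959587466277155908665620923189111⟩,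
   ⟨[35192, 3349645177, 13216138], 2778171782, 102, 3606065327530490646685830372002253993901003377147482563621907143251704565833701256, 116, 1050850318238127468274158690701609644449009369213235671590363395187903281525970998920, 67, 3002636810688328313941678960660576981360289430⟩,
   ⟨[2543159672, 3064301433], 2543159672, 99, 12687443482709559393549033556029356260951763601168690739697879127688, 99, 12687443482709559393549033556029356260951763601168690739697879127688, 67, 176331582912699951376972485421210481437079970093192⟩,
   ⟨[34681, 35192, 13084566, 13158056], 2324134248, 100, 1280856279574939737805706594231250476980519072968405368227798534593006747732659443592, 100, 12118722263827166966144678844275197859947606088176025101664474712073739544598408, 52, 2330990837650229546345015911992392037469620344⟩,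
   ⟨[34681, 35192, 11966614, 13023402], 2491840615, 117, 3274852994432128730720232845931448620709419159935436553620925824014216, 100, 785249318781263609204897760859142340543101697192273118977209866068677439894792407159, 66, 2311226254296724206598047074218267615605327735⟩,
   ⟨[35192, 9996153, 13089192], 2593687417, 115, 49560326104238840257567641949028821619112968680792577324873193352, 100, 17762594051884586441803750086033757073581400265471085004725776062344, 69, 177798814612067903450035191289487879019394917435784⟩,
   ⟨[35192, 10979193, 11180427], 2543159672, 101, 763218855283741571107210154947152605349541685685431549073288, 101, 54488724308316370391428973081990608695968509831342282953008482738422303856776, 67, 176331582912699951376972485421210481437079970093192⟩,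
   ⟨[35192, 10979193, 47514, 47771], 2543159672, 101, 763218855283741572502063153598300459333250676666172876298120, 101, 54488724308316370391428973081990608701417154357323329257632345984440824666248, 67, 176331582912699951376972485421210481437079970093192⟩,
   ⟨[10979193, 2845542776], 3063384440, 85, 12713463042745915530481126526248324852310612764359439931694680414088, 85, 915716579062106161281982248851256674899013762991673779091550578458050840616093980808, 83, 2685271740738268255169408888679918022605379720⟩,
   ⟨[34681, 35192, 11180410, 47528], 2542368886, 118, 195384026963400591743650674938240539650228824073533234345453960, 86, 899910928886566347150635309835103239771863049941983762822577079897856423815413340296, 52, 173156063140394928166243378428982357709674618919048⟩,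
   ⟨[34681, 35192, 11180411, 47528], 3063384440, 102, 50018310902630487265577791928963921506288857696896860774100150664, 117, 55847340355538566650713911150264642164466374008665860802766312381942940014728, 83, 2685271740738268255169408888679918022605379720⟩,
   ⟨[34681, 35192, 2845349514], 2256828519, 84, 222526234963603742207026159630898433530554093267054833578907528, 84, 244539075139749382711695915105187403599993871695634059392579292354038958199, 50, 151388621635585874906296264276185917901618721359735⟩,
   ⟨[34681, 35192, 42902, 11049866], 2542368886, 86, 195385542805024905917675073201412703123273189142905309363738504, 86, 292298816460060220077560472693114846127622733105784921074756230175324209232090446272648, 52, 173156063140394928166243378428982357709674618919048⟩,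
   ⟨[34681, 35192, 10983819, 47543], 2543159672, 101, 49970114920511886058849667350453649647067263770426544424051316872, 101, 3570973036268226491271465330270425046304756981561316969581021288764109009887729800, 67, 176331582912699951376972485421210481437079970093192⟩,
   ⟨[34681, 35192, 43658, 12097931], 2845280632, 118, 3274841408143747819875235117769153101344402399219908786048916836162184, 117, 13949991636125325893928681694808390221935685430955672206580915450048984248916104, 84, 176079066415056817445920218712949476339029598902408⟩,
   ⟨[34681, 35192, 10984345, 43659], 2542368871, 103, 12786565861290645310747025341821941583554348093807805196092302858376, 101, 3069370357949150480691154917918106812361505891205043987322996197100412151950645384, 67, 2304694818989785851483858459760713956081637512⟩,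
   ⟨[34681, 35192, 39062, 13089192], 2256828519, 100, 69304787685307273819841600666725390924625292319852295575068776328, 100, 11989220654323611528625201544954433954097507945061180856895486855630752797132919, 50, 151388621635585874906296264276185917901618721359735⟩,
   ⟨[34681, 35192, 3316095382], 2845345657, 115, 12687443483101974408593661494535321846368368831795102535179006678920, 116, 54492396414489983252412918157197495611569651838329374837343216535988750161800, 68, 2707572507288134479374344721393193184394709384⟩,
   ⟨[34681, 35192, 3350570902], 2543159672, 115, 12687443482685141610981309412703650935636767722769000784868580824968, 115, 13949991635989990159836850709941792683430387370853961468454151553222156078192776, 67, 176331582912699951376972485421210481437079970093192⟩,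
   ⟨[34681, 35192, 39319, 13154214], 3080226681, 99, 193595023844707707190660532353146131608394661441446373254207624, 100, 12786149664263136052770835238500845028174757449935288522369986504584, 83, 2707572507288134479396388765897630089012021640⟩,
   ⟨[34681, 35192, 11049623, 51383], 2778171768, 102, 762486114454881205758197780248698198440804110200512347478152, 101, 3250940425409995420583630041169328153557362831545119757749066850211976, 83, 2691825639018313508213589999404799651974060168⟩,
   ⟨[34681, 35192, 3349850263], 2543159672, 101, 762483443001043440916807966396216878049819630961549352867976, 101, 13955417526297170686128349035796076998155642071260686986970975238413629458585736, 67, 176331582912699951376972485421210481437079970093192⟩,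
   ⟨[34681, 35192, 13019287, 51369], 2542368886, 115, 12687443482685141638502899061701047726060328532085562753876738152584, 100, 230522451459860235246285509023511832823587677598163739617574580245466537233199746619528, 52, 173156063140394928166243378428982357709674618919048⟩,
   ⟨[34681, 35192, 47513, 13084823], 2542369656, 116, 213080896755242701914614468816825014454961694787655987434957882529816221832, 101, 213405755806980873636235741755169151456753010116094530628335950213486712968, 53, 2689202023270548889081820081095197657291921544⟩,
   ⟨[34681, 35192, 42648, 12039577], 2777053287, 115, 49611762292827037103919342511164494545906093151302331440350861192, 101, 183046563756579511678198883233393162869035347594587669391753746866071111799, 66, 2304672356016678953553865963493385986236647287⟩,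
   ⟨[34681, 35192, 42648, 43673, 47258], 2559936377, 118, 12792349419652277817229550446209740900319062654847378235092382488456, 117, 14071209719086385716474897401794989073416839824871317525929665199818159676692104, 67, 2712727121773619497548612552657882438159534472⟩,
   ⟨[34681, 35192, 42648, 47258, 47513], 2845345657, 118, 12792349419652277817229169847209581934157167525665710750616322021256, 117, 54492396414491275231163030422096743932721837774232629457961070141177644685192, 68, 2707572507288134479374344721393193184394709384⟩,
   ⟨[34681, 35192, 42648, 12170920], 2543159672, 118, 49970114261059857535696054500052114947724303076701243495772821384, 115, 59914757856050544319861080348202201594732787579052719647636373038147720700273119601338248, 67, 176331582912699951376972485421210481437079970093192⟩,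
   ⟨[34681, 35192, 42648, 51112], 2845345657, 99, 1058316173407806271355788336786842544444014259081591726249864, 116, 3274847983602796002445719141472842084756362528082116616450017839257480, 68, 2707572507288134479374344721393193184394709384⟩,
   ⟨[34681, 35192, 42648, 50869], 2559015275, 99, 45074854009943769228063909312981605663761877908821896, 101, 291531496006466091922736610682755429886195366667130926753355656, 53, 2399292334355840072688753155574847280636201352⟩,
   ⟨[34681, 35192, 42648, 51129, 51368], 2777053287, 100, 21497826602029631370423356213417588852484573571901596420570376339290659607779208, 100, 83975885164178247433522199528505811514486838155927226988535697504173488048247, 66, 2304672356016678953553865963493385986236647287⟩,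
   ⟨[34681, 35192, 3115820696], 2543159672, 117, 49970290735606405055154266063543081976473892841245037757605582728, 85, 17682558551239044648608453196248567142805134048900245322181790282857012208904072, 67, 176331582912699951376972485421210481437079970093192⟩,
   ⟨[34681, 35192, 50597, 13018776], 2559015286, 117, 68117340868177790881236393543293926378432526978631262263195441032, 99, 817249543745613431912542986167582408346039711035413008900698524598376328, 67, 2641714895784518939339611325123675820760992136⟩,
   ⟨[34681, 35192, 43673, 47000, 47258], 2777053287, 116, 832347252950165633898421803933483311240814447394299682097823164324686216, 101, 46769501963051739853257751190567004475207366081434461759565943306520950835319, 66, 2304672356016678953553865963493385986236647287⟩,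
   ⟨[34681, 35192, 43673, 47000, 47514], 3063384440, 118, 195195758828148104068718944404440850564207219350215144430414216, 116, 212859979796800880795028947346451697517961643000403303592169399857579599752, 83, 2685271740738268255169408888679918022605379720⟩,
   ⟨[34681, 35192, 43658, 12098457], 2542368871, 85, 271512833626242083870396152369116822853862134528769651591619563409698822792, 85, 69507285408303107887913347355691046841080293105823311337096659965697500813448, 67, 2304694818989785851483858459760713956081637512⟩,
   ⟨[34681, 35192, 3349652889], 2256828519, 101, 16174291755976707803486287516004102553544841584472370192117819545736, 100, 3070996440418975111521173539144266731423419904361256659351411198170621272984684663, 50, 151388621635585874906296264276185917901618721359735⟩,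
   ⟨[34681, 35192, 42905, 13092265], 3131676810, 117, 300086874010931235157569472511419277231909746531403363605074509471840508040, 116, 1050850318238127899850615011577339757682581697550156526337229617693368730609337804936, 85, 3088171892009723780989887646579725220763441817⟩,
   ⟨[34681, 35192, 42905, 12171179], 2778171768, 101, 195515849374466914538514481065932870125749562673305559713224840, 101, 832240748904958832391573940658725358826358206226885311722680244255627400, 83, 2691825639018313508213589999404799651974060168⟩,
   ⟨[34681, 35192, 42905, 13023413], 2778171768, 99, 2954025632395677652847792733389449843814575016029287127176, 101, 19111082092939685234656918484007723568858850844918606566090911291528, 83, 2691825639018313508213589999404799651974060168⟩,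
   ⟨[34681, 35192, 43673, 12170920], 2542368886, 118, 762483432922453534293730901629032471607588095916132210878856, 116, 898932487119789592186106640049753077725093048867330313096346607330754915304150112392, 52, 173156063140394928166243378428982357709674618919048⟩,
   ⟨[34681, 35192, 43673, 13023656], 2542368886, 117, 3274852925238508463843448887350517265676904907733866203595697299171720, 100, 83848431611174897591268556195814070453203012131456015339411228427806009278678308745746568, 52, 173156063140394928166243378428982357709674618919048⟩,
   ⟨[34681, 35192, 11905447, 47257], 2778171768, 99, 246617332963338029064244958626245740252738465695063333836204168, 115, 13949991635963142546368689849634149100708936370319062791600470017092222475212936, 83, 2691825639018313508213589999404799651974060168⟩,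
   ⟨[34681, 35192, 42902, 13084826], 2542369656, 100, 970068956566407265834847980335251486698634796941009424521096, 101, 3247769951111805422441667749178282423703795912853815680236345605331080, 53, 2689202023270548889081820081095197657291921544⟩,
   ⟨[34681, 35192, 50597, 13084566], 2273605224, 117, 1142819341091048522190734369071073110404861745023505302954218691585677192, 99, 184660198878579021414219028315132035204736178134540800103673436539678393975, 50, 2332127737052030195933069627471350401790802039⟩,
   ⟨[34681, 35192, 43159, 50598], 2778171768, 101, 1045688506686171854492788349019823299813781169959897783572616, 115, 49560326104238834497440744876377619469188071398843728448164829320, 83, 2691825639018313508213589999404799651974060168⟩,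
   ⟨[34681, 35192, 51113, 13154200], 2777053287, 101, 4525347807596116933906770227273045497318615432765617928128985405566366662196246664, 101, 3065069792447198471186127425044088380720898081556882630798267380801335015507527799, 66, 2304672356016678953553865963493385986236647287⟩,
   ⟨[34681, 35192, 51113, 13154201], 2777053287, 101, 4554990582440492329173301173087837245573939292433318475111576352479607778418669704, 101, 3065069794214045535964423850200492368514644627495704386961540533802151405736724599, 66, 2304672356016678953553865963493385986236647287⟩,
   ⟨[34681, 35192, 51370, 13219753], 2324134248, 117, 299774644320217736959594377093842935810304966155559124031410692121651886472, 102, 47340312169165622776182853164774829067044810368608575650051669070844744219016, 52, 2330990837650229546345015911992392037469620344⟩,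
   ⟨[34681, 35192, 50872, 13084566], 2778171768, 99, 296621143848108121943343817982441727925564440787025989232793480, 115, 831484296081253441951749256637006939831373685509282166850692471947958408, 83, 2691825639018313508213589999404799651974060168⟩,
   ⟨[34681, 35192, 51129, 13154201], 2777053287, 100, 327927273641049898007472306161966866245916549614100231545172966625910503560, 100, 21491041805338047597485129605826019502149196768901258904393286506745431756146807, 66, 2304672356016678953553865963493385986236647287⟩,
   ⟨[34681, 9144696, 39546, 42902], 2542368886, 117, 49563558883845401134665060667883230826635474504424642331748567688, 101, 53555622005909288238695256502751633276093690760051880653486482363113948088968, 52, 173156063140394928166243378428982357709674618919048⟩,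
   ⟨[34681, 9931128, 47274, 47528], 2778171768, 86, 193594677868059710620515665718221340375557038461045129070876808, 85, 70127835309195686605974075277353436675289686631774422482113108104, 83, 2691825639018313508213589999404799651974060168⟩,
   ⟨[34681, 10127736, 11114646], 3063384440, 84, 193494220976760550139003707548281986770083078601081130090862472, 116, 3248091668124099031344241217654338931475382930920456499210463339911560, 83, 2685271740738268255169408888679918022605379720⟩,
   ⟨[34681, 10127736, 12035736], 2543159672, 102, 2978450909853712958160622277196496576808146011487491037064, 85, 269392561569608933807219066071618818008327632055631852600786064634414671752, 67, 176331582912699951376972485421210481437079970093192⟩,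
   ⟨[34681, 43688, 3113912696], 3080226681, 118, 195195758828173053073300215487729393089336213996874170214492552, 116, 13950447829029198703282069100800043599958389211988768902757305867889443068155784, 83, 2707572507288134479396388765897630089012021640⟩,
   ⟨[34681, 43159, 2845542776], 2793830503, 70, 49608729226884208167901031818555962875048157249394257667984824456, 101, 3065069758738531290311565179571034955882565858473188317737819875713013900780275831, 98, 151119606527751628321105835503066840615729952622455⟩,
   ⟨[34681, 10979704, 11180427], 2777053287, 101, 763218855283741571107210154947152605349541689310581532301448, 85, 962130406837913349882827983192313854302412411612073297987501326947879031, 66, 2304672356016678953553865963493385986236647287⟩,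
   ⟨[34681, 10979704, 47274, 47528], 2559936377, 85, 274238525239794540128810704794566412673365063520381939223206024, 117, 922170800150045374314900369605305860684286473424554866598414182827535501726939977608, 67, 2712727121773619497548612552657882438159534472⟩,
   ⟨[34681, 10127736, 12032138], 2778171768, 84, 3395289671928459763864129740068032774450914339715931478408, 101, 3250940425409995420583630618716622078245249957258368434361389539694984, 83, 2691825639018313508213589999404799651974060168⟩,
   ⟨[34681, 43159, 11110776, 50869], 2256828519, 99, 193494220976760549759908735352454455363646531390135800457435272, 100, 3072957612137827282638545678440703308388947959199595812697585004221918672164784247, 50, 151388621635585874906296264276185917901618721359735⟩,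
   ⟨[35192, 219604524173177], 3299186566, 101, 55080951006439774141157647212752723370357308523033248406632213269438847817608, 116, 15465992033161953406266267107341858679870573213073524598921088938807426046097890660877506184, 97, 2998706528156047680029267768245297346673747606⟩,
   ⟨[35192, 47531, 801710245753], 2828700028, 101, 77560671336328518894905997437387717018140834244148577018218520700521010468744, 103, 235969068513539248825797665216299569065306817785958876861161626465704729197632160307080, 86, 182200873189108812147754324180188673908179756296601⟩,
   ⟨[35192, 9996153, 47286, 13023656], 2593687417, 115, 831487877086656935102535014487329546916624503844663004903684096445093768, 100, 298006877128782913804812944803852870906380194703630284447941902591319316360, 69, 177798814612067903450035191289487879019394917435784⟩,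
   ⟨[34681, 35192, 39319, 3366561674], 2777053287, 100, 14583477734283033231843027346797808994448723455726297630024313378952, 100, 62602079584747044836102196200208521705856528457510030900752340880898374797431, 66, 2304672356016678953553865963493385986236647287⟩,
   ⟨[34681, 35192, 46742, 3366561701], 2273605224, 115, 831484296081253832828323251060519771366880704680233706992477691329357448, 100, 3095177933136789228539642750433908477255581347747873270899454027406181176911103607, 50, 2332127737052030195933069627471350401790802039⟩,
   ⟨[34681, 35192, 46742, 50872, 13084581], 2273605224, 101, 292783958265742523943289950466479728063731202646268020321192861021723141768, 99, 12101956381399982896050914968025023819073758125676057421065603159944455038469751, 50, 2332127737052030195933069627471350401790802039⟩,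
   ⟨[34681, 35192, 39050, 13023656, 51111], 2559015275, 102, 296227877458286453521457974202460599517027361640448593686829396283014821768, 101, 76178769200784655231812134101034339194530569893684272761923912756374161357690, 53, 2399292334355840072688753155574847280636201352⟩,
   ⟨[34681, 35192, 39062, 11971240, 47514], 3063384440, 116, 914230589211463266954016313857041284487857346921555188248296487447775199214050973576, 116, 54493935503918324254253105178369560323453214124067541299739277943622523791240, 83, 2685271740738268255169408888679918022605379720⟩,
   ⟨[11110776, 3316090745, 50854], 2239195494, 101, 4934793628214481918243633402802494433845667656276181353389642083495938259733223304, 100, 13039017743594407640373913020530104220721620915915556778106816287365092999980692782283523702, 35, 2286214439447689628547715807368281383489734262⟩,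
   ⟨[10979193, 3131672952, 51126], 3063384440, 117, 838359411566419558465164263605421569463980701463670471028028555042264968, 116, 3571314557184791298326731137305015514544044165624555803852204128823253585756788872, 83, 2685271740738268255169408888679918022605379720⟩,
   ⟨[35192, 2812643193, 43402, 50869], 2777118312, 101, 4892548450329862115628792820565327337998055692533669638712253543389064, 100, 82053084834694393801121273864138432222235231159619766764306028543135655167607, 98, 152861938759712074132096587545825954621069382285431⟩,
   ⟨[35192, 10979193, 12163993, 47770], 2895809659, 118, 14065336747563984106284164592542037471709088933940387009178106956980488850937736, 103, 3600602241624024073045301632947813916066210740208234727441950174490601499833895816, 87, 180480765463959301528980728326777340492346289855371⟩,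
   ⟨[34681, 35192, 39319, 47014, 12102554], 3080226681, 102, 838359411566419858530397040143361602898501772080052072475942712836069512, 102, 54916108102891998540212067318595153700059622755427189752665489002167024527240, 83, 2707572507288134479396388765897630089012021640⟩,
   ⟨[34681, 35192, 39319, 47014, 13092261], 2256828519, 117, 1142819341091046324017333321519773887913242813733903678047332978244688008, 100, 786534521912421582941219718689778268597624220010108391880669183864910096451461744759, 50, 151388621635585874906296264276185917901618721359735⟩,
   ⟨[35192, 43402, 3349645177, 51386], 2777053287, 101, 329473589610797475750178920771709698234572450084050159836193316016815118216, 101, 787148301751243583878278508673831645246188374396621918537956725180943823792175024247, 66, 2304672356016678953553865963493385986236647287⟩,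
   ⟨[34681, 35192, 42902, 47513, 13085352], 2777053287, 100, 298119471778198930195000941669392447685277719057119867794320631069400405896, 100, 19537557702456045061816369851437276654124536346999062818723923158729784747853943, 66, 2304672356016678953553865963493385986236647287⟩,
   ⟨[35192, 10979193, 43930, 12163993], 2592701293, 118, 54942721670171812914731267671956172441110365333806839045145515081870238848904, 87, 3600604501304033144661054068273105532363908210529572528925448282610956823106914952, 55, 2444068732558379990525875852655615755503111050⟩,
   ⟨[34681, 35192, 43688, 3113982330], 2542368857, 87, 216718113499386009930120786290369112011513229314912119257642640007723919752, 87, 2648443464235155675418280374593790407611614174236860541777649975429777877088442504, 52, 1991237568598899528694006509778181307827329160⟩,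
   ⟨[34681, 35192, 39290, 43945, 12163707], 3063384440, 87, 838357596572908090604987949665070211477765069309559062462519422703340168, 117, 214620765818807090472604358901326182268123044533687021838478869213911681672, 83, 2685271740738268255169408888679918022605379720⟩,
   ⟨[34681, 35192, 12032407, 12102554], 2593687417, 118, 54942914894946834565266475290336929926288422418849288196137568649527924594824, 118, 54942721671330244971613466552376996642770385186271748509758419828946665842824, 69, 177798814612067903450035191289487879019394917435784⟩,
   ⟨[35192, 10979193, 47800, 13216424], 2777053287, 101, 298105641238805193942603322708073993336434380001788333991697974339284014984, 101, 3074240492205664806430033887506161851120718682329761092190412314695558584279206007, 66, 2304672356016678953553865963493385986236647287⟩,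
   ⟨[34681, 35192, 42902, 51113, 13158056], 2777053287, 101, 327656818723857583782010171328090124157889833363783795666070777120309766268695787116424, 101, 784663780008898751463696367658238170834869449817994064249452420347370675879183616119, 66, 2304672356016678953553865963493385986236647287⟩,
   ⟨[35192, 47515, 801710245753], 3333794215, 103, 54940830111014408112062723385007580750710737739394810326581047991453613594504, 117, 921756034362053087245341973947110859418810866772580085609242597301247591083421505416, 115, 244936190587473270513885464370691469902098169444278⟩,
   ⟨[35192, 39818, 10979193, 12032395], 2542369656, 87, 54940831021017328374071652577927945868791291046624263429062771544989833402248, 87, 3602925345128987459484994149918772395537906093446591079285965480070208842662320264, 53, 2689202023270548889081820081095197657291921544⟩,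
   ⟨[35192, 10065813, 10848121, 47017], 2845345657, 99, 3247985531667828340875264512678424808630532529737247298861102764955272, 99, 54916204644669341958817036591323870421292971203733841842333834200227108132488, 68, 2707572507288134479374344721393193184394709384⟩]

/-- The course of the case distinction. -/
def program : List ℕ :=
  [1399365705820885956685674602502697705645590767891100573892068483610893167282938912338652986539875146161027873891733236704857752098997322116184089110977140357705321174206006673186969,
   742158052962941986178325068888629942954324048201595332567555222190409487665274930985990473501950615566325712771461511613942879456741847606576078587517503596465837648005537924104375,
   1078979101212584214412033930214444220056920402642042252954294857475569683876737364368694587702094393079962081298381709206378181896379437416395749214520727546299153536341143891251370,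
   1229066883531349214911004655209286415140389858378538501859831417372233027615498333509579748291463439731790599173634347849633773280408846548067288765394399470628955905360408055306579,
   1078979101212584214412033930135882845467412820540611460065133997662567842941235107282275151794787040445606758198154542580418089692880552901296152338951523951644768258170214706120960,
   738165169870180183426728200439098057752591804976887378098356989431974045579716377493508859859953854317443731521057636973551104416350974529635742085276315319726108040098688659547475,
   1544980725869115393870014684381520955746897166505263495852162630444346069102928813805735774642708027658181727204385803292895042217008045645973622831847448133244878044580342696975558,
   565081484868025959164709356254074802880271644434779458343582517443064760370827292318617237642876008386778704636514245418931689271200812619706058444436401419124733472878966018048258,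
   670131610045070678610620292584987870747969521068091891137716739448379101424073869193541268013030148913635220506017668361759214772428546144979087342367973792443099615275320709639556,
   2355572364124448706350678846273136207636116426575841529975935344920797153039341852870394036922203189958548782998943186340112146407016510025239053963586982452318003163388132740833461,
   1066418056260497391550660833944730484403161394714237632937818172733888963878008301525883811918824757017479056948965361311251981464345351357801720007211020018843464522727215786971626,
   1171701773201204535475289820159905340164585409019013089447771812376573320759765775471485827208660594550073158103913091879596727867002164120428545440518202849826554024978502235891979,
   625157289385978093268073836924721712111873324468089402677189103882444151881563144974729329564940768396028627731655656471961631588565113061405795180333199431803498555971116661473446,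
   1256748217528838688890502026375817972320837250753281368126520524045533864657597896420995409721634085210815271918254022659580248533881862889118510857824987237476749979847857452278019,
   624773521936765687055461747269364638835334639524701417334822089773951067904236384401988956751721629301259020445251927760447268409473267898534049224963183465806768449037408787581079,
   673400143442400720950102452582506166416520517794948893756784396260986719695718285566612567707162378077755877041462668000630396019706438385979419497024656947253181999887503943015594,
   742625480377971725348806510527725052413176591200556336419065914155340105321057145431512740347860341096082453220244084946997807889675307821860630722921206585366803665347915226022206,
   1459428158648461273465777865742727950730883045037797224941127576530191979521057681916888948557230436591522156857326122813464613010730871022099316623123377586563724673053115597117711,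
   1779679477101574855617498112770839524850195658407349697048946841716589049917436850065652918258734638843080876672728154219922169841535646247751759525425439942244888431764172616949112,
   1038646221493178176253332137658859725564416506105586686224347485025088719310799351496381405310161750351714323188391585059354665614791334200870931031634232608646263717795705892531575,
   1151571397742387247177250575634283309597469676507428629549886001695007283038931219919500819840564120968535342656829721792121594289947382769524594409477574992970715400493519580959910,
   742292492834008257768628015863013693790784828172557025808277216860080207010900495959657290698174618040094294849574714493052970874816336158626387202935243790205381100218902692295185,
   1156327773402904382895861166470666963202028022876308936479456977440146022261220179852299165757075982825580708692721189144750743824023781280666274460754553300137190339081573937387791,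
   1164935304590286039812597286310809909860521794893137316294404281362169391787822901156660697626450013847106716560529786266870100906388566398225082897132562841036014682008188101102867,
   1873174971515097996878433427442851826304261338470536626064312946246666279162944430029064023000015315779968809948137941885439217534137814434054020338113113107568389453566238802501921,
   1066418056781721176264854938112003354076238707124504130816304830957803260080878285686336311354275260185910899378364232215055928540188831454966278975201965850505100418369431060769396,
   1074395945566385258557126202651077469275665141528445170261219619446607398975580749101450420690272865098310455019971911059838002667600834003939662467764039198125530495215010718067107,
   1083090103830859385930281340415137033513021850690827863149475173464695487326818595432536906919324915466357838407560137670671272362698406088400540939723272374481968610791304606253222,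
   1503939720220914538263428259313204955960982201955980217303435748596080731483883042512319604138382513295528064819613698076995834325651924796181835822282966853752317920942186207560903,
   1452759957950829242329326160989580788724817292554889898429749439066167586361054478702010871415555909827599471560260239154122851961609048361384125655229824832767408975795580433493505,
   1456135688373545794675056477224930932573149738009721336992502557361420265646533572397542185814902934096099822758221487556392079099647545181965482268620836575795031388138653262182555,
   1204689721172028624845204375176668784284527708478989334141432383268417553635547406299049508962216825869743453388066354511734711912325256920302203960110543739886242845505469731376452,
   1431621057090073632311642717113595387684532890022611761037779491380819059446296829712775972680078872855033254325266297231399222662421480116413915876325276505952400807781643247331528,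
   742807117196283712000865447104302850597738449368125876300633118935737836030935582334671196959914944792251174689441850485063232924133007926241602047398553228305822309872534121898245,
   695667929047742392817636434193404404489612931963944341078423533701945754247971727683380335671927373092968254522384780151208451294803804420190295459920721604809997282809535292140852,
   1922276336331840203998099634210948708171937530578382782905963686504736801794577654297144005647158848233161598405975012369584458609813615490305470149369426355006426676175085973462200,
   802894843975595287468316201925065117162778790265463741025378708335549423480584109283067330033178594389959612518918763539695369960856610739376610903474052148349451555385369026875748,
   1074977605694281836145284523534366446117466951867026824427828083805325183121550142573018486362383180983108272683402111683087570548979430311990243790450514796975110957499251766254060,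
   1513192288850661041311570531371857668052575599966692450271458429418063313462737372344735307826283589530320254152628864420588235589082378141685847339841953210043094584956772106313882,
   560776393542699210704691530994241540000874063311951702468466698803618154822973188257969461346866400982419002913601113367445459963555040129249799437397721164865302004710569054520679,
   1617585013322848944756085356950751508689166417037558804886438265286774366213257374913759862058431876577800599819509424436441394235514021107491051972826061458381755327421090578504989,
   1046513368856937401352976350323346118517989420037044939017071930654787143357787843472824717847798162671336190152688215314060300756344673069607054577925201761675387339265122219778415,
   754335033619881790743757798048469506362697836519331161710834977764081843847816711952795201370472112184965912999337056832459989950848854598838583988566734235307495095827735870890277,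
   746694192528887006710934090690723038342103168111130892189658121811112084337311063071797601544496787139947470846313742490031022848089598030181272497781374059277999334693466130571688,
   1378299694114885533353714572158312684556097498425880185736860033908563361755368218272539807542106427985219761222529495130433685551388836699558149974855249993081679061297159007836343,
   750215041433806076585231261672278601868837317097918021034031092397489396946489491599802456201523840405974085521071791465944078982607624421582921510110250983327874617593618510459254,
   1124104514023730310114611035151468871667434982135708015709177742868723795900825370548010902811981987691744469605168053350346305093474132974674780825178346278064504637917682959821180,
   625089663851262556590496993305251926255225348380579563691530729908386072332106582399101670110776922368079965253803820400452304588147409365345620140835394220678689381202705332326554,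
   1860776144176110772689530219636471598541680102460058737811516695351768602062098889420025561797210970060865413376956660111852939353520956429610191558033787652147086191632589811493123,
   746714007315654838198718516192300894446975346193493015388675366932250008135073663512322572294524222991418926181503328496338584262175657641373289797529511928078292313368878117311879,
   746348776300638136793084564182583155690549622938258016043996237535055322748885210160200908601453079563587532726882784002506280247282595978329442536522908197552577711038909433162037,
   750824923891776896862628212752006364025460900559384785164838686052296907238050876917065623793761002871363127443348379589372202847906360729222656597758030919628994669067350320639158,
   1476552005100621229502225308200489338934638748693243155669089540158292461800653255773786389738341948167680607298358875568210059349134859786085280968974073396861081798224498022229326,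
   812312953851639267957873381251300531001956091208014450068108358009240709105137013351436728137260034117600118032328639753189909516847141124319461667188086879183042390715287771163940,
   738700037966355319523031388811973499952167377728659065739538019935717763458278718612595130382416005277913328642920740574088021636925941874036252475825093714198699173503716552885602,
   496260707288068054292709657334592860366964510210448240776662357883367451539822655143776891428548535672560350963734741745011209611881985203014050138729597702175587253518660145452400,
   734180290809838509014339211788905786823995588043299123934497765796788624265569814831840163483924859166094527980263466805324794934383240157566929242664596321625817259609127682294923,
   1079457840448806819518667387904494475323747160737564043564054621519610184098647762063321053625763396010810816207017428145677074317947364612558366340656561812313998903518550787644680,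
   1062739144102653359814931367109586417559980966746707114067235592805982788201153339591648072902017183271034897063080066970550675948605327109736292393386955383416865554794958768249104,
   494865191131879048512183622824843489019861364361502548269259872201398136590260139384502195856268305811299865607178206145238800062603574584253478102922208014503743031543420995113226,
   1131365457972618039470832377583053802583952807146155591206138058969341247571635888283061440278781067917339823352267390166434468490824568327584756441810686832086764147445028393428518,
   803068976560589393961127503764292596542883822844357492833423206637755900236775158097120427780261926517765077042018249813671252621954641994943430750470603450816364356286971681047939,
   1301892593693180417374779410805231451229971106710616956290911106906457633124435317011294061702252947888126698166637295058894434509607339300073573905705746587602159670110845966484759,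
   495457826796289773305335249322469386859663333238001280897747052952096232916157425535149267181328055144315599269577427938616773666214439905530261814065651147663263073951216618964283,
   1143518331018007709684792967750330715526555129174412651789741444924700628798970289971479681257539187876769604414021882294531801122193594612616656612043881188586111044795445710144651,
   1378358995205262104851944780310770237790245060922839602684328909417743695807227518512481592242765219072489298440220061860947469025384615161716904177465172151348934205588694755503425,
   1143518265626619745896634463712128958944551280670067406410616857926687325907184183733671205281109021990667042797854128946137581806942861883124674560849303694749058496670748096255308,
   1282130941876752210098362976317492041984048673549433437636261561303952976010353682425552403998630741097437853900067231244441328431998596047878364113335527789696059962605224222569779,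
   807556724534284544513128534044931621051790026588442973664592497411492555219587195440389370343906266144961417520207950432210841942818968285296845787996235939942277086612238423447735,
   2213870583123727851540324064611403515729435526671742557842496087316868484988159802448863521691311846910735340713137512520699580326023217338318811262140373538086680816051515339066566,
   1140308615964499654546283985317158661143243960570769754804972357358124014620662625604982886272412982902871346390812895394344678810688210030033979377810173391166724858568518762117305,
   738676800539527039475850500298708672049103758882915715508452301453644271295192861100733574898804060940337796055870117147548565313732502670757434999991251591308823444532422310537400,
   1095278720102060579036433849085803694077026845639036634303546825384445839360269350824899915435281071260603741374542839045146079741239847723344814278967913624767252142963535305244838,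
   734785748251348594643046637409683615071765087989996717811904998850691018607110694792684954143343394330779076921333755372419955572683198883433538393210477345002846741081465565820054,
   1318374934826394596479960825102656589055651029191903824683265673713222157740343749482652196980016184978253876823438503087598415832112495390463762672447375886452220667354967197259327,
   1038036506094694128604595974604370317501408327132358434101836042856248646821707564864015975315880788533483506239499530406362605921201778228849266885412508402711181917200513690244486,
   1038037668981612345173007579722202540911157563368661439328478829995664936516801562958906089877509621396278204943421651761108160409053336377109526000198013650785637176871570416940182,
   1115156548376756188138898539374352399539619849106213981431785304009579200534285181650561741696968234632750193742769892618158045996377046906142532935397312898460183943328998667682998,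
   1115156788026760135792367296912924583742163207094524370004560205610732321229726350462068117620316419435134914486733315972806051069540157678443791204773250025301919242995101402047670,
   625200823695535526899512417474805619713051000754440367216900393487633349391572114631871192683532797147218209673130947160397251310118689111629208571097625011276869618789328173062343,
   1759402268376858897909204076584530663327444264577013089607811155797208064272061125631552915503295118915201311655913451899217324472952777496337110469564881964105279053389131730455161,
   669169815479836464860772989613174632281374566685660292858171052415310687113014118925028194537677355411529715274123902275167217578136514407550552061858033755420575761830531906609335,
   742233183588475618886279368061392042879471428820499031083584137940019068376300160757079988044382648473865051969081968161483804540792368322165272331165014586696782524646102699005408,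
   690107934240866614696657508050644935657062341283994019603031626362052669738819243394737321492286037838000997379256189285981222001933430344529585438960154662799887310455405204023450,
   1164049007724749744437953592717672685545344344914424160782509758577186613600175102708345666909121062483731631710826060832747871287876894921900833097412680093295157674772810786023687,
   1585222201414367301634071332961844434341513128150041827550489464729122608515007036541974061263082712505737040266633752603034845101177821307391613385707907468163112362409678900209940,
   1601795803877472269937555276059891508349081990662766896817314585512048757529963478927341858020465627377339444931603530849033144345555919500228024604280874343199958120861137147287096,
   1046869571658693491869594992081350833455808483384500094078616487706451923314893892460530999141371600853105397703071098155937013883501957053567925561103746998630686034625209038017918,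
   564428771929851045971414058730732563653710207384727581536678960100594213758135352690679358767729564877999944554881468857210100102179065402826645654131664919475788506821250766776613,
   750686368219848295865627102689130399771234248285688757184631051155998217327764323909822990460925590671534472880864131992256736765513522291636737074837213289244382823012746638148032,
   689538073749762675867170033874990508375010272116342703740844249976080484604216585839066546713828589575326990600239694388543006611125541351693437480079431634576779035014551001426090,
   1378299694412546058625013760157873381152338865685191526713506168694227366998285875711839323247730950956801058875240189579282096209032222079738614459368108469378176844894981989739705,
   670705227093271908841480210144673499964125112058134372380181052181800704198406502845580877994125549510313831375841635211194497803579072137831683277877219857229583467298008296927606,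
   1342352439267648727718964790838732664673914756768466362711282623153510935232598523014768961648511450612314596041801086630555529085495879412783237140177598109092581152683856789817746,
   2261756039629270871891635842599728316962578629433585852097170763784950382293831437959629259964685998663957395703036799387843833686407697250969167919879399552353440183377832886665667,
   750342822246175989972491001556037237151049208912358496270890758009594463729900051358293446361185036698125327945689407865965562618658738317155381815601246543498673903914310512673046,
   1460302607465271354180043676389203081189514346128151686430734434235747084955076905419348323331347271380731283328569355237629483835818677651352660463843996111682076225664831136634115,
   743958635008266579829737185235973718049448994705077655144152890400999831405024716264663950202993873753948016686063757018587926276838208544812094492862827106464878908886504307965111,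
   1629662709531066678662728336699371089487166913884717889991659555967117094172740168921661589685865068279755164266783203898564601417848493414947572511589566604229658133384991223329974,
   1180337264272856809099436999161372726152440315842125925751695654779535795709046227260043220586556422587780186297443984477787245532802106085965403410517427741226296796326319276713115,
   743238786415455203071724468463235418555007130757125705975026771176382146167757239526905473845009929426759787619250130007164699972990532764706510873652946984493416127050216448986408,
   1297318198187663535149867392342479948733784529972804242385077518434193933906456727450681554888302737392578033196042327717560448074841159954554552287649795478946633321410913683927311,
   1796249034035323056095196834434392154982757756126603943827583719075954945886575527927582634054206297289578454957842875233000598354635045795066462021501331662915433960556236981441794,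
   746162781061016275827318034337052987209520308900486460558976007264226776985561268139177924607745688898540544414304768484288439126109119159487451227240010080399238867630077138742410,
   1334663721480710445661184730755835889287449616427243236803318579919659760179386193704498013885865137546345331350279295797970866311464142023380497074717265631534281412379066270760119,
   689609316234350002634583976811315244491949125411620978145612940511811472540055957572613655497729680006520034176342914330843729493367523391958414584159125519657638624552382114381994,
   1512551250922447498007606552091237498968549033835822198736603780047155714269524097806611830380004861989397140150797023625301110440415348381645353475027369619527897488146039313846539,
   1959400444504746783920354651830446612720068173220805687234428755241752370884930913353045263372384167613769434092318089530434390976457241726434931175584884714231934715590401538055352,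
   812135316936278457793876717150530376581730537888776778720974429702153472520393931799431873363447270409115024653155335870876279818905910935934239372594543939336086479980393891446954,
   1136269171047103096815159563544292199890814398502226678387379917455420759901745924192410315827828944099060409436404922508803574358028017688317743523519044380258872334567462774433991,
   1168354295703131554709150545087194533900686125739913357498374395313085414347663211623978916835254358684882460178690467422949475351426285238781503851774823125312583745047390991995163,
   738236382412209199566668780167288255904116255129228125585118132628031068411894449107890902357780311282645301465243250573004621931661033400954042007440684260788896101715526674472087,
   1573355560035977971708503129254618125328132865149906704389562611721894625320942857286325459402257675803363657717621969175914918666697076521960016956975843691240041410176573948426553,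
   629744503165723777487650161964335625666578625196740556144855519438863988225713735501195042725174174623175829185512544516526458877755444972703962812708974087074859478140770574313760,
   1184461347967619321893657506006975612429857566289941278640288333513016621152304852939221811674717977667305312472170896400917635249468494656919707675689987781556244218904083400332427,
   804280242201585606908539661441008277567428849181450004607272102012668187109993350503583508937897496621593257172849850085487453020073850066729557589992839534547411186847411042721231,
   674120953260066736932935066286800409997934706348774487335796524507408804637163145493980625531085104570265826333138166194370216323111270458893649763260366415022691680822160770385096,
   559886692380895192543410069605574458707079485936613841670955320525568085130802823838077012655420250902041419148665272444958814023861593971883268716363822147177711462547071304917175,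
   1937765082256237840510867920551820470082065772661052244774040771643744324054609930459552206390783936833690705119946941661803374722507138589959454666198040607842621997327217611505830,
   1270505192029205560875131652613642598467225378843860161313538842146198491838211118920035618679937596325137619762874493698489303814910335562041316599128382830016050432586373890512508,
   750390446184236673905087866354877234072837888270675379379046389103011321274851550225479761945814317226454435077475941945972858627537458838277769305763721395033936525871055231949143,
   690698203861446251300607565842111265170401326651702379777473246443937280243706160310642372840362943428362720775392931002536034597050138039934959469204748158662091537889067756887419,
   750389278252339653588650735379782851428740690574892194031307891158173469566175002529671192169677102571738530103768463016507847288940472324665338073353511947461303937820859607483574,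
   1395241425397810613168330422997618857472151709040277460374413313119941906808774314626166020302337055790927650248567628308401851738754445300472232325253808561912754428863054858180218,
   608852902498573558226544799441850933927839628154570124347505703066411653683766350409327705333612307536125077799224083902753563629128604665631241894829666817254744981855024332302595,
   746725345894357249390595174172061170640048728781738519121945272203757677272839850007834060300758659592104217748658020647731984363599552365689243688259666378278808303302907485394198,
   1192668060221888630993887933671547165466898872324529751467412447946135461452786743186687174284925312192148789690521360457380974354994608011509903671771049803624312170308108235729079,
   738775419929552266386016426503961060313159399517998840015504407719022170252762875672531785821238584807586757710417605136669667816337140148964041147249380549294407833482780118014137,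
   1038036919309156105654515670348062315042109780487171773843838574518480446659157954401221399211954077942198289645606177745749112819347008183268083866148596256383233444686418330001589,
   799340899770681224909488912121879096681967792538203013491308986877944253973191915456125929789308308451567394087622143694635234781035197710252756910098015844882797161557478839993662].flatMap (instructions 60) ++
    instructions 11 654532705523968487540332306943385

lemma all_valid_witnesses : witnesses.all Witness.valid = true := by
  decide +kernel

lemma search_program :
    search (witnesses.map Witness.template) program
      [[1 <<< 136, 1 <<< 135 ||| 1 <<< 121, 1 <<< 120 ||| 1 <<< 137]] = true := by
  decide +kernel

/-- If a proper 5-coloring of `T[a×b]` (`a, b ≥ 7`) contains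
crossing pairs, then it is nice. -/
theorem statement_12 (a b : ℕ) (ha : 7 ≤ a) (hb : 7 ≤ b)
    (φ : ZMod a × ZMod b → Fin 5) (hφ : Proper (triGrid a b) φ)
    (hcp : ∃ (v : ZMod a × ZMod b) (α β : Fin 5), α ≠ β ∧
      φ v = α ∧ φ (v + (2, -1)) = α ∧
      φ (v + (1, -1)) = β ∧ φ (v + (2, 0)) = β) :
    Nice a b φ := by
  obtain ⟨v, α, β, hαβ, h0, h1, h2, h3⟩ := hcp
  obtain ⟨o, rfl⟩ : ∃ o : ZMod a × ZMod b, o + (7, 8) = v := ⟨v - (7, 8), sub_add_cancel _ _⟩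
  have e0 : φ (pt o 135) = α := by
    rw [← h0, pt]
    norm_num
  have e1 : φ (pt o 121) = α := by
    rw [← h1, pt, add_assoc, Prod.mk_add_mk]
    norm_num
    rfl
  have e2 : φ (pt o 120) = β := by
    rw [← h2, pt, add_assoc, Prod.mk_add_mk]
    norm_num
    rfl
  have e3 : φ (pt o 137) = β := by
    rw [← h3, pt, add_assoc, Prod.mk_add_mk]
    norm_num
    rfl
  have hc : ∀ i j, Interior i → (around (1 <<< i)).testBit j → φ (pt o j) ≠ φ (pt o i) := by
    intro i j hi hj
    obtain ⟨k, hk, hkj⟩ := exists_of_testBit_around hj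
    obtain rfl := one_shiftLeft_testBit.1 hk
    exact (hφ (adj_pt ha hb hi hkj)).symm
  have hα : φ (pt o 136) ≠ α := e0 ▸ hc 135 136 (by simp [Interior]) (by decide)
  have hβ : φ (pt o 136) ≠ β := e2 ▸ hc 120 136 (by simp [Interior]) (by decide)
  have hfit : Fits (fun i => φ (pt o i))
      [1 <<< 136, 1 <<< 135 ||| 1 <<< 121, 1 <<< 120 ||| 1 <<< 137] := by
    refine ⟨[φ (pt o 136), α, β], by simp [hα, hβ, hαβ], ?_⟩
    simp only [List.forall₂_cons, Nat.testBit_or, Bool.or_eq_true, one_shiftLeft_testBit]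
    refine ⟨?_, ?_, ?_, List.Forall₂.nil⟩
    · rintro i rfl
      rfl
    · rintro i (rfl | rfl) <;> assumption
    · rintro i (rfl | rfl) <;> assumption
  obtain ⟨T, hT, h⟩ := exists_template_of_search hc search_program _ List.mem_cons_self hfit
  obtain ⟨w, hw, rfl⟩ := List.mem_map.1 hT
  exact Witness.nice ha hb (List.all_eq_true.1 all_valid_witnesses w hw) o hφ h

end KempePaper
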